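/- arXiv:1301.6875 — 3 statements merged into one kernel-verified Lean document; each statement's English description precedes it below -/
import Mathlib

section
/- For every maximal order O of B_p with successive minima D₁ ≤ D₂ ≤ D₃ of O^T, one has 4p ≤ D₁·D₂ and D₃ < 2p. -/
open scoped Quaternion

/-- The rational quaternion algebra with `i² = -p`, `j² = -q`. -/
abbrev Bq (p q : ℕ) := ℍ[ℚ, -(p : ℚ), -(q : ℚ)]

namespace GrossPaper

variable {p q : ℕ}

/-- The (reduced) trace `Tr(x) = x + x̄` of a quaternion, as a rational number. -/
def Trq (x : Bq p q) : ℚ := 2 * x.re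

/-- The (reduced) norm `Nr(x) = x·x̄` of a quaternion, as a rational number. -/
def Nrq (x : Bq p q) : ℚ := (x * star x).re

/-- The inverse of a nonzero quaternion: `c⁻¹ = star c / Nr c`. -/
noncomputable def qinv (c : Bq p q) : Bq p q := (Nrq c)⁻¹ • star c

/-- Conjugation of a set: `c S c⁻¹`. -/
noncomputable def conjSet (c : Bq p q) (S : Set (Bq p q)) : Set (Bq p q) :=
  (fun s => c * s * qinv c) '' S

/-- An order of `B_p`: a subring (hence containing `ℤ`) which is a free `ℤ`-module of
rank 4 spanning `B_p` over `ℚ`. -/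
def IsOrder (O : Subring (Bq p q)) : Prop :=
  Nonempty (Module.Basis (Fin 4) ℤ O) ∧ Submodule.span ℚ (O : Set (Bq p q)) = ⊤

/-- A maximal order: an order not properly contained in any other order. -/
def IsMaximalOrder (O : Subring (Bq p q)) : Prop :=
  IsOrder O ∧ ∀ O' : Subring (Bq p q), IsOrder O' → O ≤ O' → O' = O

/-- Two orders are of the same type if they are conjugate. -/
noncomputable def SameType (O O' : Subring (Bq p q)) : Prop :=
  ∃ c : Bq p q, c ≠ 0 ∧ conjSet c (O : Set (Bq p q)) = (O' : Set (Bq p q))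

/-- The Gross lattice `O^T = {2x - Tr(x) : x ∈ O}`. -/
def GrossLat (O : Subring (Bq p q)) : Set (Bq p q) :=
  {t | ∃ x ∈ O, t = 2 * x - algebraMap ℚ (Bq p q) (Trq x)}

/-- `SuccMin T i D` says `D` is the `i`-th successive minimum of `T`: the least real
number such that `T` contains `i` `ℚ`-linearly independent elements of norm at most `D`. -/
def SuccMin (T : Set (Bq p q)) (i : ℕ) (D : ℝ) : Prop :=
  IsLeast {r : ℝ | ∃ v : Fin i → Bq p q, (∀ n, v n ∈ T) ∧ LinearIndependent ℚ v ∧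
    ∀ n, ((Nrq (v n) : ℝ) ≤ r)} D

/-- A primitive element of the Gross lattice. -/
def Primitive (T : Set (Bq p q)) (t : Bq p q) : Prop :=
  t ∈ T ∧ t ≠ 0 ∧ ∀ (a : ℤ) (s : Bq p q), s ∈ T → t = a • s → a = 1 ∨ a = -1

/-- `k` is represented optimally by `T` : `Nr(t) = k` for some primitive `t ∈ T`. -/
def OptRep (T : Set (Bq p q)) (k : ℝ) : Prop :=
  ∃ t : Bq p q, Primitive T t ∧ (Nrq t : ℝ) = k

/-- The multiplicity `θ_T(k)`: half the number of `t ∈ T` with `Nr t = k`. -/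
noncomputable def theta (T : Set (Bq p q)) (k : ℝ) : ℚ :=
  ({t : Bq p q | t ∈ T ∧ (Nrq t : ℝ) = k}.ncard : ℚ) / 2

/-- The optimal multiplicity `θ'_T(k)`: half the number of primitive `t ∈ T` with `Nr t = k`. -/
noncomputable def thetaOpt (T : Set (Bq p q)) (k : ℝ) : ℚ :=
  ({t : Bq p q | Primitive T t ∧ (Nrq t : ℝ) = k}.ncard : ℚ) / 2

end GrossPaper

open GrossPaper

namespace GrossPf

lemma dvd_of_pow {l X Y : ℤ} {k j : ℕ} (h : l^(k+j) ∣ X) (e : X = Y) : l^k ∣ Y := by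
  rw [← e]; exact (pow_dvd_pow l (Nat.le_add_right k j)).trans h

lemma lift_odd (l : ℕ) (hl : l.Prime) (hl2 : l ≠ 2) (B A s0 : ℤ) (hB : ¬ (l:ℤ) ∣ B)
    (hs : ¬ (l:ℤ) ∣ s0) (h : (l:ℤ) ∣ B * s0^2 + A) (k : ℕ) :
    ∃ s : ℤ, (l:ℤ)^(k+1) ∣ B * s^2 + A ∧ ¬ (l:ℤ) ∣ s := by
  have hlp : Prime (l:ℤ) := Nat.prime_iff_prime_int.mp hl
  induction k with
  | zero => exact ⟨s0, by simpa using h, hs⟩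
  | succ k ih =>
    obtain ⟨s, ⟨w, hw⟩, hs'⟩ := ih
    have h2 : ¬ (l:ℤ) ∣ 2 := by
      intro h
      have : l ∣ 2 := by exact_mod_cast h
      exact hl2 ((Nat.prime_dvd_prime_iff_eq hl Nat.prime_two).mp this)
    have hc : ¬ (l:ℤ) ∣ 2 * B * s := by
      intro h
      rcases hlp.dvd_or_dvd h with h | h
      · rcases hlp.dvd_or_dvd h with h | h
        · exact h2 h
        · exact hB h
      · exact hs' h
    have hcop : IsCoprime (l:ℤ) (2*B*s) := (hlp.irreducible.coprime_iff_not_dvd).mpr hc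
    obtain ⟨x, y, hxy⟩ := hcop
    refine ⟨s - (l:ℤ)^(k+1) * (y * w), ?_, ?_⟩
    · refine ⟨x * w + B * l^k * (y*w)^2, ?_⟩
      have : B * (s - (l:ℤ)^(k+1) * (y * w))^2 + A
        = (B * s^2 + A) - (l:ℤ)^(k+1) * w * (y * (2*B*s)) + B * ((l:ℤ)^(k+1) * (y * w))^2 := by ring
      rw [this, hw]
      have h3 : y * (2*B*s) = 1 - x * l := by linarith
      rw [h3]; ring
    · intro h
      apply hs'
      have : (l:ℤ) ∣ (l:ℤ)^(k+1) * (y * w) := Dvd.dvd.mul_right (dvd_pow_self _ (by omega)) _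
      simpa using dvd_add h this

lemma lift_two (B A s0 : ℤ) (hB : ¬ (2:ℤ) ∣ B)
    (hs : ¬ (2:ℤ) ∣ s0) (h : (8:ℤ) ∣ B * s0^2 + A) (k : ℕ) :
    ∃ s : ℤ, (2:ℤ)^(k+3) ∣ B * s^2 + A ∧ ¬ (2:ℤ) ∣ s := by
  induction k with
  | zero => exact ⟨s0, by simpa using h, hs⟩
  | succ k ih =>
    obtain ⟨s, ⟨w, hw⟩, hs'⟩ := ih
    have hc : ¬ (2:ℤ) ∣ B * s := by
      intro h
      rcases Int.prime_two.dvd_or_dvd h with h | h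
      · exact hB h
      · exact hs' h
    obtain ⟨c, hcc⟩ : ∃ c, B * s = 2 * c + 1 := ⟨(B*s)/2, by omega⟩
    refine ⟨s + 2^(k+2) * w, ?_, ?_⟩
    · refine ⟨w * (c + 1) + B * 2^k * w^2, ?_⟩
      have : B * (s + 2^(k+2) * w)^2 + A
        = (B * s^2 + A) + 2^(k+3) * w * (B*s) + B * (2^(k+2) * w)^2 := by ring
      rw [this, hw, hcc]; ring
    · intro h
      apply hs'
      have : (2:ℤ) ∣ (2:ℤ)^(k+2) * w := Dvd.dvd.mul_right (dvd_pow_self _ (by omega)) _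
      exact (dvd_add_left this).mp h

lemma isotropic (p q : ℕ) (hp : p.Prime) (hodd : Odd p) (hq : q.Prime) (hq8 : q % 8 = 3)
    (hqr : ∃ r : ℤ, (q : ℤ) ∣ r ^ 2 + p) (l : ℕ) (hl : l.Prime) (hlp : l ≠ p) (k : ℕ) :
    ∃ s t : ℤ, (l:ℤ)^k ∣ s^2 + q * t^2 + p := by
  have hnp : ¬ (l:ℤ) ∣ p := by
    intro h
    exact hlp ((Nat.prime_dvd_prime_iff_eq hl hp).mp (by exact_mod_cast h))
  have hlpr : Prime (l:ℤ) := Nat.prime_iff_prime_int.mp hl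
  by_cases h2 : l = 2
  · subst h2
    have hp8 : p % 8 = 1 ∨ p % 8 = 3 ∨ p % 8 = 5 ∨ p % 8 = 7 := by
      rcases hodd with ⟨m, hm⟩; omega
    have S : ∀ s0 t0 : ℤ, ¬ (2:ℤ) ∣ s0 → (8:ℤ) ∣ s0^2 + q * t0^2 + p →
        ∃ s t : ℤ, (2:ℤ)^k ∣ s^2 + q * t^2 + p := by
      intro s0 t0 hs h
      obtain ⟨s, h, -⟩ := lift_two 1 (q*t0^2+p) s0 (by norm_num) hs (by convert h using 1; ring) k
      exact ⟨s, t0, dvd_of_pow h (by ring)⟩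
    have T : ∀ s0 t0 : ℤ, ¬ (2:ℤ) ∣ t0 → (8:ℤ) ∣ s0^2 + q * t0^2 + p →
        ∃ s t : ℤ, (2:ℤ)^k ∣ s^2 + q * t^2 + p := by
      intro s0 t0 hs h
      obtain ⟨s, h, -⟩ := lift_two q (s0^2+p) t0 (by omega) hs (by convert h using 1; ring) k
      exact ⟨s0, s, dvd_of_pow h (by ring)⟩
    rcases hp8 with h | h | h | h
    · exact T 2 1 (by norm_num) (by omega)
    · exact S 1 2 (by norm_num) (by omega)
    · exact T 0 1 (by norm_num) (by omega)
    · exact S 1 0 (by norm_num) (by omega)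
  · by_cases hlq : (l:ℤ) ∣ q
    · have : l = q := (Nat.prime_dvd_prime_iff_eq hl hq).mp (by exact_mod_cast hlq)
      subst this
      obtain ⟨r, hr⟩ := hqr
      obtain ⟨s, hs, -⟩ := lift_odd l hl h2 1 p r (fun h => hlpr.not_isUnit (isUnit_of_dvd_one h))
        (fun h => hnp ((dvd_add_right (Dvd.dvd.pow h two_ne_zero)).mp hr)) (by simpa using hr) k
      exact ⟨s, 0, dvd_of_pow hs (by ring)⟩
    · have : Fact l.Prime := ⟨hl⟩
      have hq0 : (q : ZMod l) ≠ 0 := by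
        intro h; apply hlq
        have := (ZMod.natCast_eq_zero_iff q l).mp h
        exact_mod_cast this
      obtain ⟨s, t, hst⟩ : ∃ s t : ZMod l, s^2 + q*t^2 + p = 0 := by
        open Polynomial in
        obtain ⟨a, b, h⟩ := @FiniteField.exists_root_sum_quadratic (ZMod l) _ _ _
          (X^2 : (ZMod l)[X]) (C (q : ZMod l) * X^2 + C 0 * X + C (p : ZMod l))
          (degree_X_pow 2) (degree_quadratic hq0)
          (by rw [ZMod.card]; exact hl.odd_of_ne_two h2 |> Nat.odd_iff.mp)
        refine ⟨a, b, ?_⟩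
        simp at h
        rw [← h]; ring
      obtain ⟨s, rfl⟩ := ZMod.intCast_surjective s
      obtain ⟨t, rfl⟩ := ZMod.intCast_surjective t
      have hd : (l:ℤ) ∣ s^2 + q*t^2+p := by
        rw [← ZMod.intCast_zmod_eq_zero_iff_dvd]; push_cast; exact hst
      by_cases hs : (l:ℤ) ∣ s
      · have ht : ¬ (l:ℤ) ∣ t := by
          intro ht
          apply hnp
          refine (dvd_add_right ?_).mp hd
          exact dvd_add (Dvd.dvd.pow hs two_ne_zero) (Dvd.dvd.mul_left (Dvd.dvd.pow ht two_ne_zero) _)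
        obtain ⟨t', ht', -⟩ := lift_odd l hl h2 q (s^2+p) t hlq ht (by convert hd using 1; ring) k
        exact ⟨s, t', dvd_of_pow ht' (by ring)⟩
      · obtain ⟨s', hs', -⟩ := lift_odd l hl h2 1 (q*t^2+p) s
          (fun h => hlpr.not_isUnit (isUnit_of_dvd_one h)) hs (by convert hd using 1; ring) k
        exact ⟨s', t, dvd_of_pow hs' (by ring)⟩

lemma nonres_ne (p q : ℕ) [hp : Fact p.Prime] (hodd : Odd p) [hq : Fact q.Prime] (hq8 : q % 8 = 3)
    (hpq : p ≠ q) (hqr : ∃ r : ℤ, (q : ℤ) ∣ r ^ 2 + p) : legendreSym p (-(q:ℤ)) = -1 := by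
  have hp2 : p ≠ 2 := by rintro rfl; exact absurd hodd (by decide)
  have hq2 : q ≠ 2 := by rintro rfl; omega
  have hpq0 : ((p:ℤ) : ZMod q) ≠ 0 := by
    intro h
    have := (ZMod.intCast_zmod_eq_zero_iff_dvd _ _).mp h
    exact hpq ((Nat.prime_dvd_prime_iff_eq hq.out hp.out).mp (by exact_mod_cast this)).symm
  have h1 : legendreSym q (-(p:ℤ)) = 1 := by
    rw [legendreSym.eq_one_iff _ (by simpa using hpq0)]
    obtain ⟨r, hr⟩ := hqr
    refine ⟨(r : ZMod q), ?_⟩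
    have := (ZMod.intCast_zmod_eq_zero_iff_dvd _ _).mpr hr
    push_cast at this ⊢
    linear_combination -this
  rw [legendreSym.at_neg hq2, ZMod.χ₄_nat_three_mod_four (by omega)] at h1
  have hr := legendreSym.quadratic_reciprocity' hp2 hq2
  have h3 : legendreSym q p = -1 := by linarith
  have hq' : q / 2 % 2 = 1 := by omega
  rw [pow_mul', Odd.neg_one_pow (Nat.odd_iff.mpr hq'), h3] at hr
  rw [legendreSym.at_neg hp2, ZMod.χ₄_eq_neg_one_pow (Nat.odd_iff.mp hodd)]
  exact hr.symm

lemma nonres_eq (p : ℕ) [hp : Fact p.Prime] (hq8 : p % 8 = 3) : legendreSym p (-1) = -1 := by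
  rw [legendreSym.at_neg_one (by rintro rfl; omega), ZMod.χ₄_nat_three_mod_four (by omega)]

lemma aniso_p (p : ℕ) [hp : Fact p.Prime] (u : ℤ) (hu : legendreSym p (-u) = -1) (k : ℕ) :
    ∀ a b c d : ℤ, (p:ℤ)^(2*k) ∣ a^2 + u*c^2 + p*(b^2+u*d^2) →
      (p:ℤ)^k ∣ a ∧ (p:ℤ)^k ∣ b ∧ (p:ℤ)^k ∣ c ∧ (p:ℤ)^k ∣ d := by
  have hp0 : (p:ℤ) ≠ 0 := by exact_mod_cast hp.out.ne_zero
  induction k with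
  | zero => intro a b c d _; simp
  | succ k ih =>
    intro a b c d h
    have h1 : (p:ℤ) ∣ a^2 - (-u)*c^2 := by
      have : (p:ℤ) ∣ a^2 + u*c^2 + p*(b^2+u*d^2) := (dvd_pow_self _ (by omega)).trans h
      have := (dvd_add_left (dvd_mul_right (p:ℤ) (b^2+u*d^2))).mp this
      have e : a^2 - (-u)*c^2 = a^2 + u*c^2 := by ring
      rw [e]; exact this
    obtain ⟨⟨a, rfl⟩, ⟨c, rfl⟩⟩ := legendreSym.prime_dvd_of_eq_neg_one hu h1
    have h2 : (p:ℤ) ∣ b^2 - (-u)*d^2 := by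
      have h3 : (p:ℤ)^2 ∣ (p*a)^2 + u*(p*c)^2 + p*(b^2+u*d^2) := (pow_dvd_pow _ (by omega)).trans h
      have h4 : (p:ℤ)*p ∣ p*(b^2+u*d^2) := by
        rw [← sq]
        refine (dvd_add_right ?_).mp h3
        exact ⟨a^2+u*c^2, by ring⟩
      have := Int.dvd_of_mul_dvd_mul_left hp0 h4
      have e : b^2 - (-u)*d^2 = b^2 + u*d^2 := by ring
      rw [e]; exact this
    obtain ⟨⟨b, rfl⟩, ⟨d, rfl⟩⟩ := legendreSym.prime_dvd_of_eq_neg_one hu h2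
    have h5 : (p:ℤ)^(2*k) ∣ a^2 + u*c^2 + p*(b^2+u*d^2) := by
      have : (p:ℤ)^2 * p^(2*k) ∣ p^2 * (a^2 + u*c^2 + p*(b^2+u*d^2)) := by
        have e : (p:ℤ)^(2*(k+1)) = p^2 * p^(2*k) := by ring
        have e' : (p*a)^2 + u*(p*c)^2 + p*((p*b)^2+u*(p*d)^2)
          = (p:ℤ)^2 * (a^2 + u*c^2 + p*(b^2+u*d^2)) := by ring
        rw [← e, ← e']; exact h
      exact Int.dvd_of_mul_dvd_mul_left (pow_ne_zero _ hp0) this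
    obtain ⟨h1, h2, h3, h4⟩ := ih a b c d h5
    rw [pow_succ']
    exact ⟨mul_dvd_mul_left _ h1, mul_dvd_mul_left _ h2, mul_dvd_mul_left _ h3, mul_dvd_mul_left _ h4⟩

lemma clear4 (a b c d : ℚ) : ∃ E : ℕ, 0 < E ∧ ∃ A B C D : ℤ, E * a = A ∧ E * b = B ∧
    E * c = C ∧ E * d = D := by
  refine ⟨a.den*b.den*c.den*d.den, by positivity, a.num*b.den*c.den*d.den,
    b.num*a.den*c.den*d.den, c.num*a.den*b.den*d.den, d.num*a.den*b.den*c.den, ?_, ?_, ?_, ?_⟩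
  · have := Rat.mul_den_eq_num a
    push_cast; rw [← this]; ring
  · have := Rat.mul_den_eq_num b
    push_cast; rw [← this]; ring
  · have := Rat.mul_den_eq_num c
    push_cast; rw [← this]; ring
  · have := Rat.mul_den_eq_num d
    push_cast; rw [← this]; ring

lemma plocal (p : ℕ) [hp : Fact p.Prime] (u : ℤ) (hu : legendreSym p (-u) = -1)
    (a b c d : ℚ) (n : ℤ) (h : a^2 + u*c^2 + p*(b^2+u*d^2) = n) :
    ∃ E : ℤ, ¬ (p:ℤ) ∣ E ∧ ∃ A B C D : ℤ, E * a = A ∧ E * b = B ∧ E * c = C ∧ E * d = D := by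
  obtain ⟨E, hE, A, B, C, D, hA, hB, hC, hD⟩ := clear4 a b c d
  obtain ⟨k, F, hF, rfl⟩ := Nat.exists_eq_pow_mul_and_not_dvd hE.ne' p hp.out.ne_one
  have hp0 : (p:ℚ) ≠ 0 := by exact_mod_cast hp.out.ne_zero
  have key : (p:ℤ)^(2*k) ∣ A^2 + u*C^2 + p*(B^2+u*D^2) := by
    refine ⟨F^2 * n, ?_⟩
    have : ((A^2 + u*C^2 + p*(B^2+u*D^2) : ℤ) : ℚ) = ((p^(2*k) * (F^2*n) : ℤ) : ℚ) := by
      push_cast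
      rw [← hA, ← hB, ← hC, ← hD, ← h]
      push_cast; ring
    exact_mod_cast this
  obtain ⟨⟨A, rfl⟩, ⟨B, rfl⟩, ⟨C, rfl⟩, ⟨D, rfl⟩⟩ := aniso_p p u hu k _ _ _ _ key
  have hpk : (p:ℚ)^k ≠ 0 := pow_ne_zero _ hp0
  refine ⟨F, by exact_mod_cast hF, A, B, C, D, ?_, ?_, ?_, ?_⟩ <;> push_cast at * <;>
    apply mul_left_cancel₀ hpk <;> linarith

/-- Seeber's inequality -/
lemma seeber_nonneg (a b c F G H : ℚ) (ha : 0 < a) (hab : a ≤ b) (hbc : b ≤ c)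
    (hF : 0 ≤ F) (hG : 0 ≤ G) (hH : 0 ≤ H) (hFb : F ≤ b) (hGa : G ≤ a) (hHa : H ≤ a) :
    0 ≤ 2*a*b*c + F*G*H - a*F^2 - b*G^2 - c*H^2 := by
  have h0 : 0 ≤ (c-b)*(2*a*b - H^2) := by
    apply mul_nonneg (by linarith); nlinarith
  have h1 : 0 ≤ 2*a*b*b + F*G*H - a*F^2 - b*G^2 - b*H^2 := by
    have e1 : 0 ≤ a*F*(b-F) := by
      apply mul_nonneg (by positivity) (by linarith)
    have e2 : 0 ≤ b*(G*(a-G)) := mul_nonneg (by linarith) (mul_nonneg hG (by linarith))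
    have e3 : 0 ≤ b*(H*(a-H)) := mul_nonneg (by linarith) (mul_nonneg hH (by linarith))
    -- remaining: 2ab^2 + FGH - abF - abG - abH
    have e4 : 0 ≤ (b - F)*(a*a - G*H) := by
      apply mul_nonneg (by linarith); nlinarith
    have e5 : 0 ≤ b*((a-G)*(a-H)) := mul_nonneg (by linarith) (mul_nonneg (by linarith) (by linarith))
    have e6 : 0 ≤ a*(b-a)*(b-F) := mul_nonneg (mul_nonneg ha.le (by linarith)) (by linarith)
    have e7 : 0 ≤ a*b*(b-a) := mul_nonneg (mul_nonneg ha.le (by linarith)) (by linarith)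
    nlinarith
  nlinarith

lemma seeber_nonpos (a b c F G H : ℚ) (ha : 0 < a) (hab : a ≤ b) (hbc : b ≤ c)
    (hF : 0 ≤ F) (hG : 0 ≤ G) (hH : 0 ≤ H) (hFb : F ≤ b) (hGa : G ≤ a) (hHa : H ≤ a)
    (hs : F + G + H ≤ a + b) :
    0 ≤ 2*a*b*c - F*G*H - a*F^2 - b*G^2 - c*H^2 := by
  have h0 : 0 ≤ (c-b)*(2*a*b - H^2) := by
    apply mul_nonneg (by linarith); nlinarith
  have h1 : 0 ≤ 2*a*b*b - F*G*H - a*F^2 - b*G^2 - b*H^2 := by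
    rcases le_total (G+H) a with h | h
    · have e1 : 0 ≤ a*((b-F)*(b+F)) := mul_nonneg ha.le (mul_nonneg (by linarith) (by linarith))
      have e2 : 0 ≤ b*((a-(G+H))*(a+(G+H))) :=
        mul_nonneg (by linarith) (mul_nonneg (by linarith) (by linarith))
      have e3 : 0 ≤ (2*b-F)*(G*H) := mul_nonneg (by linarith) (by positivity)
      have e7 : 0 ≤ a*b*(b-a) := mul_nonneg (mul_nonneg ha.le (by linarith)) (by linarith)
      nlinarith
    · obtain ⟨t, ht⟩ : ∃ t, t = G + H - a := ⟨_, rfl⟩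
      have hG' : G = a + t - H := by linarith
      have ht0 : 0 ≤ t := by linarith
      have hta : t ≤ a := by linarith
      have e1 : 0 ≤ (2*b-F)*((a-G)*(a-H)) :=
        mul_nonneg (by linarith) (mul_nonneg (by linarith) (by linarith))
      have e2 : 0 ≤ a*((b-t-F)*(b-t+F)) :=
        mul_nonneg ha.le (mul_nonneg (by linarith) (by linarith))
      have e3 : 0 ≤ a*t*(b-t-F) := mul_nonneg (by positivity) (by linarith)
      have e4 : 0 ≤ a*b*(b-a) := mul_nonneg (mul_nonneg ha.le (by linarith)) (by linarith)
      have e5 : 0 ≤ b*(t*(a-t)) := mul_nonneg (by linarith) (mul_nonneg ht0 (by linarith))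
      subst hG'
      linarith
  nlinarith

lemma seeber (a b c f g h : ℚ) (ha : 0 < a) (hab : a ≤ b) (hbc : b ≤ c)
    (f1 : 2*f ≤ b) (f2 : -b ≤ 2*f) (g1 : 2*g ≤ a) (g2 : -a ≤ 2*g) (h1 : 2*h ≤ a) (h2 : -a ≤ 2*h)
    (s1 : 0 ≤ a + b + 2*f + 2*g + 2*h) (s2 : 0 ≤ a + b + 2*f - 2*g - 2*h)
    (s3 : 0 ≤ a + b - 2*f + 2*g - 2*h) (s4 : 0 ≤ a + b - 2*f - 2*g + 2*h) :
    a*b*c ≤ 2*(a*b*c + 2*f*g*h - a*f^2 - b*g^2 - c*h^2) := by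
  rcases le_total 0 f with hf | hf <;> rcases le_total 0 g with hg | hg <;>
    rcases le_total 0 h with hh | hh
  · have := seeber_nonneg a b c (2*f) (2*g) (2*h) ha hab hbc (by linarith) (by linarith)
      (by linarith) (by linarith) (by linarith) (by linarith)
    linarith
  · have := seeber_nonpos a b c (2*f) (2*g) (-2*h) ha hab hbc (by linarith) (by linarith)
      (by linarith) (by linarith) (by linarith) (by linarith) (by linarith)
    linarith
  · have := seeber_nonpos a b c (2*f) (-2*g) (2*h) ha hab hbc (by linarith) (by linarith)
      (by linarith) (by linarith) (by linarith) (by linarith) (by linarith)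
    linarith
  · have := seeber_nonneg a b c (2*f) (-2*g) (-2*h) ha hab hbc (by linarith) (by linarith)
      (by linarith) (by linarith) (by linarith) (by linarith)
    linarith
  · have := seeber_nonpos a b c (-2*f) (2*g) (2*h) ha hab hbc (by linarith) (by linarith)
      (by linarith) (by linarith) (by linarith) (by linarith) (by linarith)
    linarith
  · have := seeber_nonneg a b c (-2*f) (2*g) (-2*h) ha hab hbc (by linarith) (by linarith)
      (by linarith) (by linarith) (by linarith) (by linarith)
    linarith
  · have := seeber_nonneg a b c (-2*f) (-2*g) (2*h) ha hab hbc (by linarith) (by linarith)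
      (by linarith) (by linarith) (by linarith) (by linarith)
    linarith
  · have := seeber_nonpos a b c (-2*f) (-2*g) (-2*h) ha hab hbc (by linarith) (by linarith)
      (by linarith) (by linarith) (by linarith) (by linarith) (by linarith)
    linarith

end GrossPf

namespace GrossPf
set_option linter.unusedSimpArgs false

set_option maxRecDepth 100000 in
lemma ker2 : ∀ (a b c u v w : ZMod 2),
    4 * a * b * c + u * v * w - a * u ^ 2 - b * v ^ 2 - c * w ^ 2 = 0 →
      ∃ x y z : ZMod 2, ¬(x = 0 ∧ y = 0 ∧ z = 0) ∧
          a * x ^ 2 + b * y ^ 2 + c * z ^ 2 + u * y * z + v * x * z + w * x * y = 0 ∧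
            2 * a * x + w * y + v * z = 0 ∧ w * x + 2 * b * y + u * z = 0 ∧
            v * x + u * y + 2 * c * z = 0 := by
  decide

lemma kernel_vec (l : ℕ) (hl : l.Prime) (a b c u v w : ℤ)
    (h : (l:ℤ) ∣ 4*a*b*c + u*v*w - a*u^2 - b*v^2 - c*w^2) :
    ∃ x y z : ℤ, ¬ ((l:ℤ) ∣ x ∧ (l:ℤ) ∣ y ∧ (l:ℤ) ∣ z) ∧
      (l:ℤ) ∣ a*x^2+b*y^2+c*z^2+u*y*z+v*x*z+w*x*y ∧ (l:ℤ) ∣ 2*a*x+w*y+v*z ∧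
      (l:ℤ) ∣ w*x+2*b*y+u*z ∧ (l:ℤ) ∣ v*x+u*y+2*c*z := by
  have : Fact l.Prime := ⟨hl⟩
  suffices H : ∃ x y z : ZMod l, ¬ (x = 0 ∧ y = 0 ∧ z = 0) ∧
      a*x^2+b*y^2+c*z^2+u*y*z+v*x*z+w*x*y = 0 ∧ 2*a*x+w*y+v*z = 0 ∧
      w*x+2*b*y+u*z = 0 ∧ v*x+u*y+2*c*z = 0 by
    obtain ⟨x, y, z, h0, h1, h2, h3, h4⟩ := H
    obtain ⟨x, rfl⟩ := ZMod.intCast_surjective x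
    obtain ⟨y, rfl⟩ := ZMod.intCast_surjective y
    obtain ⟨z, rfl⟩ := ZMod.intCast_surjective z
    refine ⟨x, y, z, ?_, ?_, ?_, ?_, ?_⟩
    · simpa only [← ZMod.intCast_zmod_eq_zero_iff_dvd] using h0
    all_goals rw [← ZMod.intCast_zmod_eq_zero_iff_dvd]; push_cast; assumption
  rw [← ZMod.intCast_zmod_eq_zero_iff_dvd] at h
  push_cast at h
  generalize (a : ZMod l) = a at *
  generalize (b : ZMod l) = b at *
  generalize (c : ZMod l) = c at *
  generalize (u : ZMod l) = u at *
  generalize (v : ZMod l) = v at *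
  generalize (w : ZMod l) = w at *
  by_cases h2 : l = 2
  · subst h2
    exact ker2 a b c u v w h
  · have h20 : (2 : ZMod l) ≠ 0 := by
      intro h0
      have h0' : ((2:ℕ) : ZMod l) = 0 := by exact_mod_cast h0
      rw [ZMod.natCast_eq_zero_iff] at h0'
      exact h2 ((Nat.prime_dvd_prime_iff_eq hl Nat.prime_two).mp h0')
    have hdet : (!![2*a, w, v; w, 2*b, u; v, u, 2*c] : Matrix (Fin 3) (Fin 3) (ZMod l)).det = 0 := by
      rw [Matrix.det_fin_three]; simp
      linear_combination 2*h
    obtain ⟨z, hz0, hz⟩ := Matrix.exists_mulVec_eq_zero_iff.mpr hdet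
    have e0 := congrFun hz 0
    have e1 := congrFun hz 1
    have e2 := congrFun hz 2
    simp [Matrix.mulVec, dotProduct, Fin.sum_univ_three] at e0 e1 e2
    refine ⟨z 0, z 1, z 2, ?_, ?_, e0, e1, e2⟩
    · rintro ⟨a1, a2, a3⟩
      apply hz0; ext i; fin_cases i <;> simpa
    · apply mul_left_cancel₀ h20
      linear_combination z 0 * e0 + z 1 * e1 + z 2 * e2

section cliff
variable {A : Type*} [Ring A] [Algebra ℚ A]

structure Rel (m : ℚ) (e1 e2 e3 : A) (a b c u v w : ℤ) : Prop where
  h1 : m • (e1*e1) = a • (1:A)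
  h2 : m • (e2*e2) = b • (1:A)
  h3 : m • (e3*e3) = c • (1:A)
  h23 : m • (e2*e3+e3*e2) = u • (1:A)
  h31 : m • (e3*e1+e1*e3) = v • (1:A)
  h12 : m • (e1*e2+e2*e1) = w • (1:A)

def Comb (X Y Z x : A) : Prop := ∃ n0 n1 n2 n3 : ℤ, x = n0 • (1:A) + n1 • X + n2 • Y + n3 • Z

lemma Rel.cyc {m : ℚ} {e1 e2 e3 : A} {a b c u v w : ℤ} (R : Rel m e1 e2 e3 a b c u v w) :
    Rel m e2 e3 e1 b c a v w u := ⟨R.h2, R.h3, R.h1, R.h31, R.h12, R.h23⟩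

lemma Rel.shift {m : ℚ} {e1 e2 e3 : A} {a b c u v w : ℤ} (R : Rel m e1 e2 e3 a b c u v w)
    (x y : ℤ) : Rel m e1 e2 (x • e1 + y • e2 + e3) a b
      (c + x^2*a + y^2*b + x*y*w + x*v + y*u) (u + x*w + 2*y*b) (v + 2*x*a+y*w) w := by
  obtain ⟨h1, h2, h3, h23, h31, h12⟩ := R
  refine ⟨h1, h2, ?_, ?_, ?_, h12⟩
  · have : m • ((x • e1 + y • e2 + e3) * (x • e1 + y • e2 + e3)) =
      x^2 • (m • (e1*e1)) + y^2 • (m • (e2*e2)) + (m • (e3*e3)) + (x*y) • (m • (e1*e2+e2*e1))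
       + x • (m • (e3*e1+e1*e3)) + y • (m • (e2*e3+e3*e2)) := by
      simp only [mul_add, add_mul, smul_mul_assoc, mul_smul_comm]
      module
    rw [this, h1, h2, h3, h23, h31, h12]; module
  · have : m • (e2 * (x • e1 + y • e2 + e3) + (x • e1 + y • e2 + e3) * e2) =
      (2*y) • (m • (e2*e2)) + x • (m • (e1*e2+e2*e1)) + (m • (e2*e3+e3*e2)) := by
      simp only [mul_add, add_mul, smul_mul_assoc, mul_smul_comm]
      module
    rw [this, h2, h12, h23]; module
  · have : m • ((x • e1 + y • e2 + e3) * e1 + e1 * (x • e1 + y • e2 + e3)) =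
      (2*x) • (m • (e1*e1)) + y • (m • (e1*e2+e2*e1)) + (m • (e3*e1+e1*e3)) := by
      simp only [mul_add, add_mul, smul_mul_assoc, mul_smul_comm]
      module
    rw [this, h1, h12, h31]; module

lemma Rel.shift_comb {m : ℚ} {e1 e2 e3 : A} {a b c u v w : ℤ} (R : Rel m e1 e2 e3 a b c u v w)
    (x y : ℤ) (t : A) :
    Comb (m • (e2*e3)) (m • (e3*e1)) (m • (e1*e2)) t ↔
    Comb (m • (e2*(x • e1 + y • e2 + e3))) (m • ((x • e1 + y • e2 + e3)*e1)) (m • (e1*e2)) t := by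
  obtain ⟨h1, h2, h3, h23, h31, h12⟩ := R
  have h21 : m • (e2*e1) = w • (1:A) - m • (e1*e2) := by
    rw [← h12]; module
  have E1 : m • (e2*(x • e1 + y • e2 + e3)) =
      m • (e2*e3) + x • (w • (1:A) - m • (e1*e2)) + y • (b • (1:A)) := by
    rw [← h21, ← h2]
    simp only [mul_add, add_mul, smul_mul_assoc, mul_smul_comm]
    module
  have E2 : m • ((x • e1 + y • e2 + e3)*e1) =
      m • (e3*e1) + x • (a • (1:A)) + y • (w • (1:A) - m • (e1*e2)) := by
    rw [← h21, ← h1]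
    simp only [mul_add, add_mul, smul_mul_assoc, mul_smul_comm]
    module
  rw [E1, E2]
  generalize m • (e2*e3) = X
  generalize m • (e3*e1) = Y
  generalize m • (e1*e2) = Z
  constructor
  · rintro ⟨n0, n1, n2, n3, rfl⟩
    exact ⟨n0 - n1*x*w - n1*y*b - n2*x*a - n2*y*w, n1, n2, n3 + n1*x + n2*y, by module⟩
  · rintro ⟨n0, n1, n2, n3, rfl⟩
    exact ⟨n0 + n1*x*w + n1*y*b + n2*x*a + n2*y*w, n1, n2, n3 - n1*x - n2*y, by module⟩

lemma Rel.ring {m : ℚ} {e1 e2 e3 : A} {a b c u v w : ℤ} (R : Rel m e1 e2 e3 a b c u v w) :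
    ∃ C : Subring A, ∀ t, t ∈ C ↔ Comb (m • (e2*e3)) (m • (e3*e1)) (m • (e1*e2)) t := by
  obtain ⟨h1, h2, h3, h23, h31, h12⟩ := R
  have h32 : m • (e3*e2) = u • (1:A) - m • (e2*e3) := by rw [← h23]; module
  have h13 : m • (e1*e3) = v • (1:A) - m • (e3*e1) := by rw [← h31]; module
  have h21 : m • (e2*e1) = w • (1:A) - m • (e1*e2) := by rw [← h12]; module
  obtain ⟨X, hX⟩ : ∃ X, X = m • (e2*e3) := ⟨_, rfl⟩
  obtain ⟨Y, hY⟩ : ∃ Y, Y = m • (e3*e1) := ⟨_, rfl⟩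
  obtain ⟨Z, hZ⟩ : ∃ Z, Z = m • (e1*e2) := ⟨_, rfl⟩
  rw [← hX] at h32
  rw [← hY] at h13
  rw [← hZ] at h21
  rw [← hX, ← hY, ← hZ]
  -- (m • (p*q)) * (m • (r*s)) = m • (p * (m • (q*r)) * s)
  have M : ∀ p q r s : A, (m • (p*q)) * (m • (r*s)) = m • (p * (m • (q*r)) * s) := by
    intro p q r s
    simp only [smul_mul_assoc, mul_smul_comm, mul_assoc]
  have XX : X*X = u • X - (b*c) • (1:A) := by
    have : m • (e2 * (u • (1:A) - X) * e3) = u • (m • (e2*e3)) - (m • (e2*e2)) * (m • (e3*e3)) := by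
      rw [M, hX]; simp only [mul_sub, sub_mul, smul_mul_assoc, mul_smul_comm, mul_one, smul_sub]
      module
    rw [← h32, ← M, ← hX, h2, h3] at this
    rw [this]; simp only [smul_mul_assoc, one_mul]; module
  have YY : Y*Y = v • Y - (c*a) • (1:A) := by
    have : m • (e3 * (v • (1:A) - Y) * e1) = v • (m • (e3*e1)) - (m • (e3*e3)) * (m • (e1*e1)) := by
      rw [M, hY]; simp only [mul_sub, sub_mul, smul_mul_assoc, mul_smul_comm, mul_one, smul_sub]
      module
    rw [← h13, ← M, ← hY, h3, h1] at this
    rw [this]; simp only [smul_mul_assoc, one_mul]; module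
  have ZZ : Z*Z = w • Z - (a*b) • (1:A) := by
    have : m • (e1 * (w • (1:A) - Z) * e2) = w • (m • (e1*e2)) - (m • (e1*e1)) * (m • (e2*e2)) := by
      rw [M, hZ]; simp only [mul_sub, sub_mul, smul_mul_assoc, mul_smul_comm, mul_one, smul_sub]
      module
    rw [← h21, ← M, ← hZ, h1, h2] at this
    rw [this]; simp only [smul_mul_assoc, one_mul]; module
  have YZ : Y*Z = a • (u • (1:A) - X) := by
    rw [hY, hZ, M, h1, ← h32]; simp only [mul_smul_comm, smul_mul_assoc, mul_one]; module
  have ZX : Z*X = b • (v • (1:A) - Y) := by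
    rw [hZ, hX, M, h2, ← h13]; simp only [mul_smul_comm, smul_mul_assoc, mul_one]; module
  have XY : X*Y = c • (w • (1:A) - Z) := by
    rw [hX, hY, M, h3, ← h21]; simp only [mul_smul_comm, smul_mul_assoc, mul_one]; module
  -- reversed products
  have ZY : Z*Y = -(v*w) • (1:A) + v • Z + w • Y + a • X := by
    have : (w • (1:A) - Z) * (v • (1:A) - Y) = a • X := by
      rw [← h21, ← h13, M, h1, hX]; simp only [mul_smul_comm, smul_mul_assoc, mul_one]; module
    rw [← this]; simp only [mul_sub, sub_mul, smul_mul_assoc, mul_smul_comm, mul_one, one_mul]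
    module
  have XZ : X*Z = -(w*u) • (1:A) + w • X + u • Z + b • Y := by
    have : (u • (1:A) - X) * (w • (1:A) - Z) = b • Y := by
      rw [← h32, ← h21, M, h2, hY]; simp only [mul_smul_comm, smul_mul_assoc, mul_one]; module
    rw [← this]; simp only [mul_sub, sub_mul, smul_mul_assoc, mul_smul_comm, mul_one, one_mul]
    module
  have YX : Y*X = -(u*v) • (1:A) + u • Y + v • X + c • Z := by
    have : (v • (1:A) - Y) * (u • (1:A) - X) = c • Z := by
      rw [← h13, ← h32, M, h3, hZ]; simp only [mul_smul_comm, smul_mul_assoc, mul_one]; module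
    rw [← this]; simp only [mul_sub, sub_mul, smul_mul_assoc, mul_smul_comm, mul_one, one_mul]
    module
  refine ⟨{ carrier := {t | Comb X Y Z t}, zero_mem' := ⟨0,0,0,0, by simp⟩
            one_mem' := ⟨1,0,0,0, by simp⟩, add_mem' := ?_, neg_mem' := ?_, mul_mem' := ?_ },
            fun t => Iff.rfl⟩
  · rintro _ _ ⟨n0,n1,n2,n3,rfl⟩ ⟨k0,k1,k2,k3,rfl⟩
    refine ⟨n0*k0 - n1*k1*b*c - n2*k2*c*a - n3*k3*a*b + n2*k3*a*u + n3*k1*b*v + n1*k2*c*w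
        - n3*k2*v*w - n1*k3*w*u - n2*k1*u*v,
      n0*k1 + n1*k0 + n1*k1*u - n2*k3*a + n3*k2*a + n1*k3*w + n2*k1*v,
      n0*k2 + n2*k0 + n2*k2*v - n3*k1*b + n3*k2*w + n1*k3*b + n2*k1*u,
      n0*k3 + n3*k0 + n3*k3*w - n1*k2*c + n3*k2*v + n1*k3*u + n2*k1*c, ?_⟩
    simp only [mul_add, add_mul, smul_mul_assoc, mul_smul_comm, mul_one, one_mul,
      XX, YY, ZZ, XY, YX, XZ, ZX, YZ, ZY]
    module
  · rintro _ _ ⟨n0,n1,n2,n3,rfl⟩ ⟨k0,k1,k2,k3,rfl⟩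
    exact ⟨n0+k0, n1+k1, n2+k2, n3+k3, by module⟩
  · rintro _ ⟨n0,n1,n2,n3,rfl⟩
    exact ⟨-n0, -n1, -n2, -n3, by module⟩
end cliff
end GrossPf

open scoped Quaternion
open GrossPaper
namespace GrossPf
set_option linter.unusedSimpArgs false
variable {p q : ℕ}

lemma comb_indep (O : Subring (Bq p q)) (hs : Submodule.span ℚ (O : Set (Bq p q)) = ⊤)
    {X Y Z : Bq p q} (h : ∀ t ∈ O, Comb X Y Z t) : LinearIndependent ℚ ![1, X, Y, Z] := by
  apply linearIndependent_of_top_le_span_of_card_eq_finrank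
  · rw [← hs, Submodule.span_le]
    intro t ht
    obtain ⟨n0, n1, n2, n3, rfl⟩ := h t ht
    have M : ∀ (n : ℤ) (i : Fin 4), n • (![1, X, Y, Z] : Fin 4 → Bq p q) i ∈
        Submodule.span ℚ (Set.range (![1, X, Y, Z] : Fin 4 → Bq p q)) := fun n i =>
      zsmul_mem (Submodule.subset_span (Set.mem_range_self i)) n
    exact add_mem (add_mem (add_mem (M n0 0) (M n1 1)) (M n2 2)) (M n3 3)
  · rw [QuaternionAlgebra.finrank_eq_four]; simp

lemma order_of (C : Subring (Bq p q)) (hs : Submodule.span ℚ (C : Set (Bq p q)) = ⊤)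
    {X Y Z : Bq p q} (h : ∀ t, t ∈ C ↔ Comb X Y Z t) : IsOrder C := by
  refine ⟨⟨?_⟩, hs⟩
  have hli := comb_indep C hs (fun t ht => (h t).mp ht)
  have hX : X ∈ C := (h X).mpr ⟨0,1,0,0, by simp⟩
  have hY : Y ∈ C := (h Y).mpr ⟨0,0,1,0, by simp⟩
  have hZ : Z ∈ C := (h Z).mpr ⟨0,0,0,1, by simp⟩
  let g : Fin 4 → C := ![1, ⟨X, hX⟩, ⟨Y, hY⟩, ⟨Z, hZ⟩]
  have hz : LinearIndependent ℤ ![1, X, Y, Z] := hli.restrict_scalars' ℤ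
  let φ : C →ₗ[ℤ] Bq p q := C.subtype.toAddMonoidHom.toIntLinearMap
  have hg : φ ∘ g = ![1, X, Y, Z] := by
    ext i : 1; fin_cases i <;> rfl
  refine Module.Basis.mk (v := g) (LinearIndependent.of_comp φ (by rw [hg]; exact hz)) ?_
  rintro ⟨t, ht⟩ -
  obtain ⟨n0, n1, n2, n3, e⟩ := (h t).mp ht
  have : (⟨t, ht⟩ : C) = n0 • g 0 + n1 • g 1 + n2 • g 2 + n3 • g 3 := by
    apply Subtype.ext
    simpa [g] using e
  rw [this]
  have M : ∀ (n : ℤ) (i : Fin 4), n • g i ∈ Submodule.span ℤ (Set.range g) := fun n i =>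
      Submodule.smul_mem _ _ (Submodule.subset_span ⟨i, rfl⟩)
  exact add_mem (add_mem (add_mem (M n0 0) (M n1 1)) (M n2 2)) (M n3 3)

lemma strict {O : Subring (Bq p q)} (hO : IsMaximalOrder O) {X Y Z X' Y' Z' : Bq p q}
    (h : ∀ t, t ∈ O ↔ Comb X Y Z t) {C : Subring (Bq p q)} (hC : ∀ t, t ∈ C ↔ Comb X' Y' Z' t)
    (l k : ℤ) (hl : ¬ l ∣ 1) (hX : X = l • X') (hY : Y = k • Y') (hZ : Z = Z') : False := by
  have hle : O ≤ C := by
    intro t ht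
    obtain ⟨n0, n1, n2, n3, rfl⟩ := (h t).mp ht
    rw [hC]
    exact ⟨n0, n1*l, n2*k, n3, by rw [hX, hY, hZ]; module⟩
  have hs : Submodule.span ℚ (C : Set (Bq p q)) = ⊤ := by
    rw [eq_top_iff, ← hO.1.2]; exact Submodule.span_mono hle
  have hli := comb_indep C hs (fun t ht => (hC t).mp ht)
  have hCO := hO.2 C (order_of C hs hC) hle
  have hX' : X' ∈ O := by
    rw [← hCO, hC]; exact ⟨0,1,0,0, by simp⟩
  obtain ⟨n0, n1, n2, n3, e⟩ := (h X').mp hX'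
  rw [Fintype.linearIndependent_iff] at hli
  have := hli ![(n0:ℚ), n1*l - 1, n2*k, n3] (by
    rw [Fin.sum_univ_four]
    simp only [Matrix.cons_val]
    rw [hX, hY, hZ] at e
    have e2 : (n0:ℚ) • (1 : Bq p q) + ((n1*l - 1 : ℚ)) • X' + ((n2*k : ℚ)) • Y' + (n3:ℚ) • Z'
      = (n0 • (1 : Bq p q) + n1 • l • X' + n2 • k • Y' + n3 • Z') - X' := by
      module
    rw [e2, ← e, sub_self]) 1
  simp only [Matrix.cons_val] at this
  apply hl
  refine ⟨n1, ?_⟩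
  have : ((n1*l - 1 : ℤ) : ℚ) = 0 := by push_cast; exact this
  have : n1*l - 1 = 0 := by exact_mod_cast this
  linarith

structure Tup (O : Subring (Bq p q)) (m : ℚ) (e1 e2 e3 : Bq p q) (a b c u v w : ℤ) : Prop where
  rel : Rel m e1 e2 e3 a b c u v w
  mem : ∀ t, t ∈ O ↔ Comb (m • (e2*e3)) (m • (e3*e1)) (m • (e1*e2)) t
  spn : ∀ t : Bq p q, t.re = 0 → ∃ x y z : ℚ, t = x • e1 + y • e2 + z • e3

lemma Tup.cyc {O : Subring (Bq p q)} {m : ℚ} {e1 e2 e3 : Bq p q} {a b c u v w : ℤ}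
    (T : Tup O m e1 e2 e3 a b c u v w) : Tup O m e2 e3 e1 b c a v w u := by
  refine ⟨T.rel.cyc, ?_, ?_⟩
  · intro t; rw [T.mem]
    constructor
    · rintro ⟨n0, n1, n2, n3, rfl⟩
      exact ⟨n0, n2, n3, n1, by abel⟩
    · rintro ⟨n0, n1, n2, n3, rfl⟩
      exact ⟨n0, n3, n1, n2, by abel⟩
  · intro t ht
    obtain ⟨x, y, z, rfl⟩ := T.spn t ht
    exact ⟨y, z, x, by abel⟩

lemma Tup.shift {O : Subring (Bq p q)} {m : ℚ} {e1 e2 e3 : Bq p q} {a b c u v w : ℤ}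
    (T : Tup O m e1 e2 e3 a b c u v w) (x y : ℤ) : Tup O m e1 e2 (x • e1 + y • e2 + e3) a b
      (c + x^2*a + y^2*b + x*y*w + x*v + y*u) (u + x*w + 2*y*b) (v + 2*x*a+y*w) w := by
  refine ⟨T.rel.shift x y, ?_, ?_⟩
  · intro t; rw [T.mem, T.rel.shift_comb x y]
  · intro t ht
    obtain ⟨r, s, z, rfl⟩ := T.spn t ht
    exact ⟨r - z * x, s - z * y, z, by module⟩

lemma Tup.moveA {O : Subring (Bq p q)} (hO : IsMaximalOrder O)
    {m : ℚ} {e1 e2 e3 : Bq p q} {a b c u v w : ℤ}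
    (T : Tup O m e1 e2 e3 a b c u v w) (l : ℕ) (hl : l.Prime) (hb : (l:ℤ) ∣ b) (hc : (l:ℤ) ∣ c)
    (hu : (l:ℤ) ∣ u) : False := by
  obtain ⟨b, rfl⟩ := hb
  obtain ⟨c, rfl⟩ := hc
  obtain ⟨u, rfl⟩ := hu
  have hl0 : (l:ℚ) ≠ 0 := by exact_mod_cast hl.ne_zero
  have hl1 : ¬ (l:ℤ) ∣ 1 := (Nat.prime_iff_prime_int.mp hl).not_dvd_one
  have D : ∀ (t : Bq p q) (n : ℤ), m • t = (l * n) • (1 : Bq p q) → (m/l) • t = n • (1 : Bq p q) := by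
    intro t n h
    have : (m/l) • t = (l:ℚ)⁻¹ • (m • t) := by rw [smul_smul]; congr 1; field_simp
    rw [this, h]
    have : ((l:ℤ) * n) • (1 : Bq p q) = (l:ℚ) • (n • (1 : Bq p q)) := by
      rw [mul_smul]; module
    rw [this, smul_smul, inv_mul_cancel₀ hl0, one_smul]
  have E : ∀ t : Bq p q, (m/l) • ((l:ℚ) • t) = m • t := by
    intro t; rw [smul_smul]; congr 1; field_simp
  have R : Rel (m/l) ((l:ℚ) • e1) e2 e3 (l*a) b c u v w := by
    refine ⟨?_, D _ _ T.rel.h2, D _ _ T.rel.h3, D _ _ T.rel.h23, ?_, ?_⟩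
    · rw [smul_mul_assoc, E, mul_smul_comm, smul_comm, T.rel.h1]; module
    · rw [mul_smul_comm, smul_mul_assoc, ← smul_add, E, T.rel.h31]
    · rw [mul_smul_comm, smul_mul_assoc, ← smul_add, E, T.rel.h12]
  obtain ⟨C, hC⟩ := R.ring
  refine strict hO T.mem hC l 1 hl1 ?_ ?_ ?_
  · have := E (e2*e3)
    rw [← this]; module
  · rw [mul_smul_comm, E, one_smul]
  · rw [smul_mul_assoc, E]

lemma Tup.moveB {O : Subring (Bq p q)} (hO : IsMaximalOrder O)
    {m : ℚ} {e1 e2 e3 : Bq p q} {a b c u v w : ℤ}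
    (T : Tup O m e1 e2 e3 a b c u v w) (l : ℕ) (hl : l.Prime) (hc : (l:ℤ)^2 ∣ c) (hu : (l:ℤ) ∣ u)
    (hv : (l:ℤ) ∣ v) : False := by
  obtain ⟨c, rfl⟩ := hc
  obtain ⟨v, rfl⟩ := hv
  obtain ⟨u, rfl⟩ := hu
  have hl0 : (l:ℚ) ≠ 0 := by exact_mod_cast hl.ne_zero
  have hl1 : ¬ (l:ℤ) ∣ 1 := (Nat.prime_iff_prime_int.mp hl).not_dvd_one
  have D : ∀ (n : ℤ), (l:ℚ)⁻¹ • ((l * n) • (1 : Bq p q)) = n • (1 : Bq p q) := by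
    intro n
    have : ((l:ℤ) * n) • (1 : Bq p q) = (l:ℚ) • (n • (1 : Bq p q)) := by
      rw [mul_smul]; module
    rw [this, smul_smul, inv_mul_cancel₀ hl0, one_smul]
  have R : Rel m e1 e2 ((l:ℚ)⁻¹ • e3) a b c u v w := by
    refine ⟨T.rel.h1, T.rel.h2, ?_, ?_, ?_, T.rel.h12⟩
    · rw [smul_mul_assoc, mul_smul_comm, smul_comm m, smul_comm m, T.rel.h3, sq, mul_assoc, D, D]
    · rw [smul_mul_assoc, mul_smul_comm, ← smul_add, smul_comm m, T.rel.h23, D]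
    · rw [smul_mul_assoc, mul_smul_comm, ← smul_add, smul_comm m, T.rel.h31, D]
  obtain ⟨C, hC⟩ := R.ring
  have F : ∀ t : Bq p q, t = (l:ℤ) • ((l:ℚ)⁻¹ • t) := by
    intro t
    have : (l:ℤ) • ((l:ℚ)⁻¹ • t) = (l:ℚ) • ((l:ℚ)⁻¹ • t) := by module
    rw [this, smul_smul, mul_inv_cancel₀ hl0, one_smul]
  refine strict hO T.mem hC l l hl1 ?_ ?_ rfl
  · rw [mul_smul_comm, smul_comm m]; exact F _
  · rw [smul_mul_assoc, smul_comm m]; exact F _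

def Nf (a b c u v w : ℤ) : ℤ := 4*a*b*c + u*v*w - a*u^2 - b*v^2 - c*w^2

lemma inv_mod (l : ℕ) (hl : l.Prime) (z : ℤ) (hz : ¬ (l:ℤ) ∣ z) : ∃ k : ℤ, ((k * z : ℤ) : ZMod l) = 1 := by
  have : IsCoprime (l:ℤ) z := ((Nat.prime_iff_prime_int.mp hl).irreducible.coprime_iff_not_dvd).mpr hz
  obtain ⟨x, y, h⟩ := this
  refine ⟨y, ?_⟩
  have : y * z = 1 - x * l := by linarith
  rw [this]; push_cast; simp

lemma Tup.sing_aux {O : Subring (Bq p q)} {m : ℚ} {e1 e2 e3 : Bq p q} {a b c u v w : ℤ}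
    (T : Tup O m e1 e2 e3 a b c u v w) (l : ℕ) (hl : l.Prime) (x y z : ℤ) (hz : ¬ (l:ℤ) ∣ z)
    (h1 : (l:ℤ) ∣ a*x^2+b*y^2+c*z^2+u*y*z+v*x*z+w*x*y) (h2 : (l:ℤ) ∣ 2*a*x+w*y+v*z)
    (h3 : (l:ℤ) ∣ w*x+2*b*y+u*z) :
    ∃ (e1 e2 e3 : Bq p q) (a' b' c' u' v' w' : ℤ), Tup O m e1 e2 e3 a' b' c' u' v' w' ∧
      Nf a' b' c' u' v' w' = Nf a b c u v w ∧ (l:ℤ) ∣ c' ∧ (l:ℤ) ∣ u' ∧ (l:ℤ) ∣ v' := by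
  obtain ⟨k, hk⟩ := inv_mod l hl z hz
  rw [← ZMod.intCast_zmod_eq_zero_iff_dvd] at h1 h2 h3
  push_cast at h1 h2 h3 hk
  refine ⟨_, _, _, _, _, _, _, _, _, T.shift (k*x) (k*y), ?_, ?_, ?_, ?_⟩
  · unfold Nf; ring
  all_goals rw [← ZMod.intCast_zmod_eq_zero_iff_dvd]; push_cast
  · linear_combination (k:ZMod l)^2*h1 - (c*(k*z+1) + k*x*v + k*y*u)*hk
  · linear_combination (k:ZMod l)*h3 - u*hk
  · linear_combination (k:ZMod l)*h2 - v*hk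

lemma Tup.sing {O : Subring (Bq p q)} {m : ℚ} {e1 e2 e3 : Bq p q} {a b c u v w : ℤ}
    (T : Tup O m e1 e2 e3 a b c u v w) (l : ℕ) (hl : l.Prime) (hN : (l:ℤ) ∣ Nf a b c u v w) :
    ∃ (e1 e2 e3 : Bq p q) (a' b' c' u' v' w' : ℤ), Tup O m e1 e2 e3 a' b' c' u' v' w' ∧
      Nf a' b' c' u' v' w' = Nf a b c u v w ∧ (l:ℤ) ∣ c' ∧ (l:ℤ) ∣ u' ∧ (l:ℤ) ∣ v' := by
  obtain ⟨x, y, z, h0, h1, h2, h3, h4⟩ := kernel_vec l hl a b c u v w hN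
  by_cases hz : (l:ℤ) ∣ z
  · by_cases hy : (l:ℤ) ∣ y
    · have hx : ¬ (l:ℤ) ∣ x := fun h => h0 ⟨h, hy, hz⟩
      obtain ⟨f1, f2, f3, a', b', c', u', v', w', T', e, h⟩ :=
        T.cyc.sing_aux l hl y z x hx (by ring_nf at h1 ⊢; exact h1) (by ring_nf at h3 ⊢; exact h3)
          (by ring_nf at h4 ⊢; exact h4)
      exact ⟨f1, f2, f3, a', b', c', u', v', w', T', by rw [e]; unfold Nf; ring, h⟩
    · obtain ⟨f1, f2, f3, a', b', c', u', v', w', T', e, h⟩ :=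
        T.cyc.cyc.sing_aux l hl z x y hy (by ring_nf at h1 ⊢; exact h1)
          (by ring_nf at h4 ⊢; exact h4) (by ring_nf at h2 ⊢; exact h2)
      exact ⟨f1, f2, f3, a', b', c', u', v', w', T', by rw [e]; unfold Nf; ring, h⟩
  · exact T.sing_aux l hl x y z hz h1 h2 h3

lemma Tup.bin_aniso {O : Subring (Bq p q)} (hO : IsMaximalOrder O)
    {m : ℚ} {e1 e2 e3 : Bq p q} {a b c u v w : ℤ}
    (T : Tup O m e1 e2 e3 a b c u v w) (l : ℕ) (hl : l.Prime) (hc : (l:ℤ) ∣ c) (hu : (l:ℤ) ∣ u)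
    (hv : (l:ℤ) ∣ v) (x y : ℤ) (h : (l:ℤ) ∣ a*x^2+w*x*y+b*y^2) : (l:ℤ) ∣ x ∧ (l:ℤ) ∣ y := by
  rw [← ZMod.intCast_zmod_eq_zero_iff_dvd] at h
  push_cast at h
  constructor
  · by_contra hx
    obtain ⟨k, hk⟩ := inv_mod l hl x hx
    push_cast at hk
    refine (T.cyc.shift (k*y) 0).moveA hO l hl hc ?_ ?_
    · rw [← ZMod.intCast_zmod_eq_zero_iff_dvd]; push_cast
      linear_combination (k:ZMod l)^2*h - (a*(k*x+1) + k*y*w)*hk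
    · have : v + k*y*u + 2*0*c = v + k*y*u := by ring
      rw [this]; exact dvd_add hv (hu.mul_left _)
  · by_contra hy
    obtain ⟨k, hk⟩ := inv_mod l hl y hy
    push_cast at hk
    refine (T.cyc.cyc.shift 0 (k*x)).cyc.moveA hO l hl ?_ hc ?_
    · rw [← ZMod.intCast_zmod_eq_zero_iff_dvd]; push_cast
      linear_combination (k:ZMod l)^2*h - (b*(k*y+1) + k*x*w)*hk
    · have : u + 2*0*c + k*x*v = u + k*x*v := by ring
      rw [this]; exact dvd_add hu (hv.mul_left _)

lemma Tup.aniso {O : Subring (Bq p q)} (hO : IsMaximalOrder O)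
    {m : ℚ} {e1 e2 e3 : Bq p q} {a b c u v w : ℤ}
    (T : Tup O m e1 e2 e3 a b c u v w) (l : ℕ) (hl : l.Prime) (hc : (l:ℤ) ∣ c) (hu : (l:ℤ) ∣ u)
    (hv : (l:ℤ) ∣ v) (k : ℕ) : ∀ x y z : ℤ,
    (l:ℤ)^(2*k) ∣ a*x^2+b*y^2+c*z^2+u*y*z+v*x*z+w*x*y →
     (l:ℤ)^k ∣ x ∧ (l:ℤ)^k ∣ y ∧ (l:ℤ)^k ∣ z := by
  have hlp : Prime (l:ℤ) := Nat.prime_iff_prime_int.mp hl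
  have hc2 : ¬ (l:ℤ)^2 ∣ c := fun h => T.moveB hO l hl h hu hv
  induction k with
  | zero => intro x y z _; simp
  | succ k ih =>
    intro x y z h
    have h1 : (l:ℤ) ∣ a*x^2+w*x*y+b*y^2 := by
      have h2 : (l:ℤ) ∣ a*x^2+b*y^2+c*z^2+u*y*z+v*x*z+w*x*y := (dvd_pow_self _ (by omega)).trans h
      have h3 : (l:ℤ) ∣ c*z^2+u*y*z+v*x*z :=
        dvd_add (dvd_add (hc.mul_right _) ((hu.mul_right _).mul_right _)) ((hv.mul_right _).mul_right _)
      have := dvd_sub h2 h3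
      have e : a*x^2+b*y^2+c*z^2+u*y*z+v*x*z+w*x*y - (c*z^2+u*y*z+v*x*z) = a*x^2+w*x*y+b*y^2 := by ring
      rwa [e] at this
    obtain ⟨⟨x, rfl⟩, ⟨y, rfl⟩⟩ := T.bin_aniso hO l hl hc hu hv x y h1
    have h4 : (l:ℤ)^2 ∣ c*z^2 := by
      have h2 : (l:ℤ)^2 ∣ a*(l*x)^2+b*(l*y)^2+c*z^2+u*(l*y)*z+v*(l*x)*z+w*(l*x)*(l*y) :=
        (pow_dvd_pow _ (by omega)).trans h
      obtain ⟨u', rfl⟩ := hu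
      obtain ⟨v', rfl⟩ := hv
      have h3 : (l:ℤ)^2 ∣ a*(l*x)^2+b*(l*y)^2+l*u'*(l*y)*z+l*v'*(l*x)*z+w*(l*x)*(l*y) :=
        ⟨a*x^2+b*y^2+u'*y*z+v'*x*z+w*x*y, by ring⟩
      have := dvd_sub h2 h3
      have e : a*(l*x)^2+b*(l*y)^2+c*z^2+l*u'*(l*y)*z+l*v'*(l*x)*z+w*(l*x)*(l*y) -
        (a*(l*x)^2+b*(l*y)^2+l*u'*(l*y)*z+l*v'*(l*x)*z+w*(l*x)*(l*y)) = c*z^2 := by ring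
      rwa [e] at this
    have hz : (l:ℤ) ∣ z := by
      by_contra hz
      have hz2 : ¬ (l:ℤ) ∣ z^2 := fun h => hz (hlp.dvd_of_dvd_pow h)
      exact hc2 (hlp.pow_dvd_of_dvd_mul_right 2 hz2 h4)
    obtain ⟨z, rfl⟩ := hz
    have h5 : (l:ℤ)^(2*k) ∣ a*x^2+b*y^2+c*z^2+u*y*z+v*x*z+w*x*y := by
      have e1 : (l:ℤ)^(2*(k+1)) = l^2 * l^(2*k) := by ring
      have e2 : a*(l*x)^2+b*(l*y)^2+c*(l*z)^2+u*(l*y)*(l*z)+v*(l*x)*(l*z)+w*(l*x)*(l*y) =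
        (l:ℤ)^2 * (a*x^2+b*y^2+c*z^2+u*y*z+v*x*z+w*x*y) := by ring
      rw [e1, e2] at h
      exact Int.dvd_of_mul_dvd_mul_left (pow_ne_zero _ hlp.ne_zero) h
    obtain ⟨h1, h2, h3⟩ := ih x y z h5
    rw [pow_succ']
    exact ⟨mul_dvd_mul_left _ h1, mul_dvd_mul_left _ h2, mul_dvd_mul_left _ h3⟩

lemma Tup.nsq {O : Subring (Bq p q)} (hO : IsMaximalOrder O)
    {m : ℚ} {e1 e2 e3 : Bq p q} {a b c u v w : ℤ}
    (T : Tup O m e1 e2 e3 a b c u v w) (l : ℕ) (hl : l.Prime) (hl2 : l ≠ 2)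
    (hc : (l:ℤ) ∣ c) (hu : (l:ℤ) ∣ u) (hv : (l:ℤ) ∣ v) : ¬ (l:ℤ)^2 ∣ Nf a b c u v w := by
  intro h
  have hlp : Prime (l:ℤ) := Nat.prime_iff_prime_int.mp hl
  have hc2 : ¬ (l:ℤ)^2 ∣ c := fun h => T.moveB hO l hl h hu hv
  have h4 : (l:ℤ)^2 ∣ c * (4*a*b - w^2) := by
    obtain ⟨u', rfl⟩ := hu
    obtain ⟨v', rfl⟩ := hv
    have h3 : (l:ℤ)^2 ∣ u'*l*(v'*l)*w - a*(u'*l)^2 - b*(v'*l)^2 :=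
        ⟨u'*v'*w - a*u'^2-b*v'^2, by ring⟩
    have := dvd_sub h h3
    unfold Nf at this
    ring_nf at this ⊢; exact this
  have h5 : (l:ℤ) ∣ 4*a*b - w^2 := by
    by_contra hz
    exact hc2 (hlp.pow_dvd_of_dvd_mul_right 2 hz h4)
  have h6 := (T.bin_aniso hO l hl hc hu hv w (-2*a) (by
    have e : a*w^2+w*w*(-2*a)+b*(-2*a)^2 = a*(4*a*b-w^2) := by ring
    rw [e]; exact h5.mul_left _)).2
  have h7 : (l:ℤ) ∣ a := by
    rcases hlp.dvd_or_dvd h6 with h | h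
    · exfalso; apply hl2
      have : (l:ℤ) ∣ 2 := by simpa using h
      exact (Nat.prime_dvd_prime_iff_eq hl Nat.prime_two).mp (by exact_mod_cast this)
    · exact h
  have h8 := (T.bin_aniso hO l hl hc hu hv 1 0 (by simpa using h7)).1
  exact hlp.not_dvd_one h8
end GrossPf

open scoped Quaternion
open GrossPaper
namespace GrossPf
set_option linter.unusedSimpArgs false
variable {p q : ℕ}

lemma Rel.quad {m : ℚ} {e1 e2 e3 : Bq p q} {a b c u v w : ℤ}
    (R : Rel m e1 e2 e3 a b c u v w) (x y z : ℤ) :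
    m • ((x • e1 + y • e2 + z • e3) * (x • e1 + y • e2 + z • e3)) =
      (a*x^2+b*y^2+c*z^2+u*y*z+v*x*z+w*x*y) • (1 : Bq p q) := by
  have e : m • ((x • e1 + y • e2 + z • e3) * (x • e1 + y • e2 + z • e3)) =
     (x^2) • (m • (e1*e1)) + (y^2) • (m • (e2*e2)) + (z^2) • (m • (e3*e3)) +
     (y*z) • (m • (e2*e3+e3*e2)) + (x*z) • (m • (e3*e1+e1*e3)) + (x*y) • (m • (e1*e2+e2*e1)) := by
    simp only [add_mul, mul_add, smul_mul_assoc, mul_smul_comm, smul_smul, smul_add]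
    module
  rw [e, R.h1, R.h2, R.h3, R.h23, R.h31, R.h12]
  module

lemma coords3 (x y z : ℚ) : ∃ E : ℕ, 0 < E ∧ ∃ A B C : ℤ, E*x = A ∧ E*y = B ∧ E*z = C := by
  obtain ⟨E, h, A, B, C, _, h1, h2, h3, _⟩ := clear4 x y z 0
  exact ⟨E, h, A, B, C, h1, h2, h3⟩

lemma Tup.int_spn {O : Subring (Bq p q)} {m : ℚ} {e1 e2 e3 : Bq p q} {a b c u v w : ℤ}
    (T : Tup O m e1 e2 e3 a b c u v w) (t : Bq p q) (ht : t.re = 0) :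
    ∃ E : ℕ, 0 < E ∧ ∃ A B C : ℤ, (E:ℚ) • t = A • e1 + B • e2 + C • e3 := by
  obtain ⟨x, y, z, e⟩ := T.spn t ht
  obtain ⟨E, h, A, B, C, h1, h2, h3⟩ := coords3 x y z
  refine ⟨E, h, A, B, C, ?_⟩
  rw [e, smul_add, smul_add, smul_smul, smul_smul, smul_smul, h1, h2, h3]
  module

lemma Tup.l_eq_p (hp : Nat.Prime p) (hodd : Odd p) (hq : Nat.Prime q)
    (hq8 : q % 8 = 3) (hqr : ∃ r : ℤ, (q : ℤ) ∣ r ^ 2 + p)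
    {O : Subring (Bq p q)} (hO : IsMaximalOrder O)
    {m : ℚ} {e1 e2 e3 : Bq p q} {a b c u v w : ℤ}
    (T : Tup O m e1 e2 e3 a b c u v w) (l : ℕ) (hl : l.Prime)
    (hc : (l:ℤ) ∣ c) (hu : (l:ℤ) ∣ u) (hv : (l:ℤ) ∣ v) : l = p := by
  by_contra hlp
  have hlp' : Prime (l:ℤ) := Nat.prime_iff_prime_int.mp hl
  obtain ⟨D1, hD1, A1, B1, C1, i1⟩ := T.int_spn ⟨0,1,0,0⟩ rfl
  obtain ⟨D2, hD2, A2, B2, C2, i2⟩ := T.int_spn ⟨0,0,1,0⟩ rfl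
  obtain ⟨D3, hD3, A3, B3, C3, i3⟩ := T.int_spn ⟨0,0,0,1⟩ rfl
  obtain ⟨E, hE, F1, F2, F3, f1, f2, f3⟩ := coords3 e1.imJ e2.imJ e3.imJ
  obtain ⟨vv, d', hd', hden⟩ := Nat.exists_eq_pow_mul_and_not_dvd m.den_ne_zero l hl.ne_one
  obtain ⟨s, t, hS⟩ := isotropic p q hp hodd hq hq8 hqr l hl hlp (2*(E*(D1*D2*D3)*p)+vv)
  set K := E*(D1*D2*D3)*p with hK
  have hp0 := hp.pos
  have hKpos : 0 < K := by positivity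
  let V : Bq p q := ⟨0, q*t, p, s⟩
  let R1 : ℤ := q*t*(D2*D3)*A1 + p*(D1*D3)*A2 + s*(D1*D2)*A3
  let R2 : ℤ := q*t*(D2*D3)*B1 + p*(D1*D3)*B2 + s*(D1*D2)*B3
  let R3 : ℤ := q*t*(D2*D3)*C1 + p*(D1*D3)*C2 + s*(D1*D2)*C3
  have hV : ((D1*D2*D3 : ℕ) : ℚ) • V = R1 • e1 + R2 • e2 + R3 • e3 := by
    have : ((D1*D2*D3 : ℕ) : ℚ) • V = (q*t*(D2*D3):ℚ) • ((D1:ℚ) • (⟨0,1,0,0⟩ : Bq p q)) +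
        (p*(D1*D3):ℚ) • ((D2:ℚ) • (⟨0,0,1,0⟩ : Bq p q)) +
        (s*(D1*D2):ℚ) • ((D3:ℚ) • (⟨0,0,0,1⟩ : Bq p q)) := by
      ext <;> simp [V] <;> ring
    rw [this, i1, i2, i3]
    simp only [R1, R2, R3]
    module
  have hVV : V * V = (-(p*q*(s^2+q*t^2+p)) : ℚ) • (1 : Bq p q) := by
    ext <;> simp [V] <;> ring
  have hf := T.rel.quad R1 R2 R3
  rw [← hV] at hf
  set f : ℤ := a*R1^2+b*R2^2+c*R3^2+u*R2*R3+v*R1*R3+w*R1*R2 with hfdef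
  rw [smul_mul_assoc, mul_smul_comm, hVV] at hf
  have hf2 : m * ((D1*D2*D3 : ℕ) : ℚ)^2 * (-(p*q*(s^2+q*t^2+p)) : ℚ) = f := by
    have := congrArg QuaternionAlgebra.re hf
    simp at this
    push_cast
    linear_combination this
  have hf3 : (m.den : ℤ) * f = (s^2+q*t^2+p) * (-(m.num * ((D1*D2*D3 : ℕ):ℤ)^2*(p*q))) := by
    have hm : (m.den : ℚ) * m = m.num := Rat.den_mul_eq_num m
    have : ((m.den : ℤ) * f : ℚ) = (s^2+q*t^2+p) * (-(m.num * ((D1*D2*D3 : ℕ):ℚ)^2*(p*q))) := by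
      rw [← hf2, ← hm]; push_cast; ring
    exact_mod_cast this
  have hf4 : (l:ℤ)^(2*K) ∣ f := by
    have h1 : (l:ℤ)^(2*K+vv) ∣ (m.den : ℤ) * f := by rw [hf3]; exact hS.mul_right _
    rw [hden] at h1
    push_cast at h1
    rw [pow_add, mul_comm ((l:ℤ)^(2*K)), mul_assoc] at h1
    have h2 := Int.dvd_of_mul_dvd_mul_left (pow_ne_zero vv hlp'.ne_zero) h1
    exact hlp'.pow_dvd_of_dvd_mul_left _ (by exact_mod_cast hd') h2
  obtain ⟨g1, g2, g3⟩ := T.aniso hO l hl hc hu hv K R1 R2 R3 hf4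
  have hKe : (K:ℤ) = R1*F1 + R2*F2 + R3*F3 := by
    have h1 := congrArg QuaternionAlgebra.imJ hV
    simp [V] at h1
    have : (K:ℚ) = R1*F1 + R2*F2 + R3*F3 := by
      rw [← f1, ← f2, ← f3, hK]; push_cast
      linear_combination (E:ℚ) * h1
    exact_mod_cast this
  have hdvd : (l:ℤ)^K ∣ K := by
    rw [hKe]; exact dvd_add (dvd_add (g1.mul_right _) (g2.mul_right _)) (g3.mul_right _)
  have : l^K ∣ K := by exact_mod_cast hdvd
  exact absurd (Nat.le_of_dvd hKpos this) (not_le.mpr (Nat.lt_pow_self hl.one_lt))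

lemma Tup.bound (hp : Nat.Prime p) (hodd : Odd p) (hq : Nat.Prime q)
    (hq8 : q % 8 = 3) (hqr : ∃ r : ℤ, (q : ℤ) ∣ r ^ 2 + p)
    {O : Subring (Bq p q)} (hO : IsMaximalOrder O)
    {m : ℚ} {e1 e2 e3 : Bq p q} {a b c u v w : ℤ}
    (T : Tup O m e1 e2 e3 a b c u v w) (h0 : Nf a b c u v w ≠ 0) : (Nf a b c u v w).natAbs ≤ p := by
  set N := Nf a b c u v w with hN
  have key : ∀ l : ℕ, l.Prime → l ∣ N.natAbs → l = p ∧ ¬ l^2 ∣ N.natAbs := by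
    intro l hl hd
    obtain ⟨f1, f2, f3, a', b', c', u', v', w', T', e, h1, h2, h3⟩ :=
      T.sing l hl (Int.natCast_dvd.mpr hd)
    have := T'.l_eq_p hp hodd hq hq8 hqr hO l hl h1 h2 h3
    refine ⟨this, fun h => ?_⟩
    have := T'.nsq hO l hl (by rintro rfl; rw [← this] at hodd; exact absurd hodd (by decide)) h1 h2 h3
    apply this
    rw [e]
    have := Int.natCast_dvd.mpr h
    exact_mod_cast this
  have hn : N.natAbs ≠ 0 := Int.natAbs_ne_zero.mpr h0
  have : N.natAbs ∣ p := by
    rw [← Nat.factorization_le_iff_dvd hn hp.ne_zero]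
    intro l
    by_cases hl : l.Prime ∧ l ∣ N.natAbs
    · obtain ⟨h1, h2⟩ := key l hl.1 hl.2
      rw [hl.1.pow_dvd_iff_le_factorization hn] at h2
      rw [h1, hp.factorization_self]
      rw [h1] at h2; omega
    · have : N.natAbs.factorization l = 0 := by
        by_cases h : l.Prime
        · exact Nat.factorization_eq_zero_of_not_dvd fun h' => hl ⟨h, h'⟩
        · exact Nat.factorization_eq_zero_of_not_prime _ h
      rw [this]; exact Nat.zero_le _
  exact Nat.le_of_dvd hp.pos this
end GrossPf

open scoped Quaternion
open GrossPaper
namespace GrossPf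
set_option linter.unusedSimpArgs false
variable {p q : ℕ}

lemma nr_eq (x : Bq p q) : Nrq x = x.re^2 + p*x.imI^2 + q*x.imJ^2 + p*q*x.imK^2 := by
  unfold Nrq; simp; ring

lemma nr_mul (x y : Bq p q) : Nrq (x*y) = Nrq x * Nrq y := by
  simp only [nr_eq, QuaternionAlgebra.re_mul, QuaternionAlgebra.imI_mul, QuaternionAlgebra.imJ_mul, QuaternionAlgebra.imK_mul]
  ring

lemma nr_one : Nrq (1 : Bq p q) = 1 := by
  simp [nr_eq]

lemma nr_pow (x : Bq p q) (n : ℕ) : Nrq (x^n) = Nrq x ^ n := by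
  induction n with
  | zero => simp [nr_one]
  | succ n ih => rw [pow_succ, nr_mul, ih, pow_succ]

lemma int_of_pow (ν : ℚ) (F : ℕ) (hF : 0 < F) (h : ∀ n : ℕ, ∃ z : ℤ, F*ν^n = z) : ∃ z : ℤ, ν = z := by
  obtain ⟨z, hz⟩ := h F
  have h1 : (F:ℤ) * ν.num^F = z * (ν.den:ℤ)^F := by
    have : (F:ℚ) * ν.num^F = z * (ν.den:ℚ)^F := by
      rw [← hz, ← Rat.den_mul_eq_num ν]; ring
    exact_mod_cast this
  have h2 : (ν.den:ℤ)^F ∣ F := by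
    have : IsCoprime ((ν.den:ℤ)^F) (ν.num^F) := by
      apply IsCoprime.pow
      exact (Rat.isCoprime_num_den ν).symm
    exact this.dvd_of_dvd_mul_right ⟨z, by rw [h1]; ring⟩
  have h3 : ν.den^F ∣ F := by exact_mod_cast h2
  have h4 := Nat.le_of_dvd hF h3
  have h5 : ν.den = 1 := by
    by_contra hne
    have h6 : 1 < ν.den := by have := ν.den_pos; omega
    exact absurd h4 (not_le.mpr (Nat.lt_pow_self h6))
  exact ⟨ν.num, by rw [← Rat.den_mul_eq_num ν, h5]; simp⟩

lemma bdd_den {O : Subring (Bq p q)} (hO : IsOrder O) : ∃ E : ℕ, 0 < E ∧ ∀ x ∈ O,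
    ∃ A B C D : ℤ, E*x.re = A ∧ E*x.imI = B ∧ E*x.imJ = C ∧ E*x.imK = D := by
  obtain ⟨⟨b⟩, _⟩ := hO
  have h : ∀ i : Fin 4, _ := fun i => clear4 (b i : Bq p q).re (b i : Bq p q).imI (b i : Bq p q).imJ (b i : Bq p q).imK
  choose E hE A B C D h1 h2 h3 h4 using h
  refine ⟨E 0 * E 1 * E 2 * E 3, by have := hE 0; have := hE 1; have := hE 2; have := hE 3; positivity, ?_⟩
  intro x hx
  have e := b.sum_repr ⟨x, hx⟩
  rw [Fin.sum_univ_four] at e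
  set n := b.repr ⟨x, hx⟩
  have e' : n 0 • (b 0 : Bq p q) + n 1 • (b 1 : Bq p q) + n 2 • (b 2 : Bq p q) + n 3 • (b 3 : Bq p q) = x := by
    have := congrArg Subtype.val e
    simpa using this
  rw [← e']
  have G : ∀ (r : Fin 4 → ℚ) (A : Fin 4 → ℤ), (∀ i, E i * r i = A i) →
      ((E 0 * E 1 * E 2 * E 3 : ℕ):ℚ) * (n 0 * r 0 + n 1 * r 1 + n 2 * r 2 + n 3 * r 3) =
        (E 1*E 2*E 3 * n 0 * A 0 + E 0*E 2*E 3*n 1*A 1 + E 0*E 1*E 3*n 2*A 2 + E 0*E 1*E 2*n 3*A 3 : ℤ) := by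
    intro r A h
    push_cast
    rw [← h 0, ← h 1, ← h 2, ← h 3]; ring
  have G' : ∀ (r : Fin 4 → ℚ) (A : Fin 4 → ℤ), (∀ i, E i * r i = A i) → ∃ z : ℤ,
      ((E 0 * E 1 * E 2 * E 3 : ℕ):ℚ) * (n 0 * r 0 + n 1 * r 1 + n 2 * r 2 + n 3 * r 3) = z :=
    fun r A h => ⟨_, G r A h⟩
  obtain ⟨z1, g1⟩ := G' _ A h1
  obtain ⟨z2, g2⟩ := G' _ B h2
  obtain ⟨z3, g3⟩ := G' _ C h3
  obtain ⟨z4, g4⟩ := G' _ D h4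
  refine ⟨z1, z2, z3, z4, ?_, ?_, ?_, ?_⟩
  · simp only [QuaternionAlgebra.re_add, QuaternionAlgebra.re_smul]
    simpa only [zsmul_eq_mul] using g1
  · simp only [QuaternionAlgebra.imI_add, QuaternionAlgebra.imI_smul]
    simpa only [zsmul_eq_mul] using g2
  · simp only [QuaternionAlgebra.imJ_add, QuaternionAlgebra.imJ_smul]
    simpa only [zsmul_eq_mul] using g3
  · simp only [QuaternionAlgebra.imK_add, QuaternionAlgebra.imK_smul]
    simpa only [zsmul_eq_mul] using g4

lemma nr_int {O : Subring (Bq p q)} (hO : IsOrder O) (x : Bq p q) (hx : x ∈ O) : ∃ z : ℤ, Nrq x = z := by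
  obtain ⟨E, hE, h⟩ := bdd_den hO
  apply int_of_pow _ (E^2) (by positivity)
  intro n
  obtain ⟨A, B, C, D, h1, h2, h3, h4⟩ := h (x^n) (pow_mem hx n)
  refine ⟨A^2+p*B^2+q*C^2+p*q*D^2, ?_⟩
  rw [← nr_pow, nr_eq]
  push_cast
  rw [← h1, ← h2, ← h3, ← h4]; ring

lemma tr_int {O : Subring (Bq p q)} (hO : IsOrder O) (x : Bq p q) (hx : x ∈ O) : ∃ z : ℤ, Trq x = z := by
  obtain ⟨a, ha⟩ := nr_int hO x hx
  obtain ⟨b, hb⟩ := nr_int hO (x+1) (add_mem hx (one_mem _))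
  refine ⟨b - a - 1, ?_⟩
  push_cast
  rw [← ha, ← hb]
  simp [nr_eq, Trq]; ring

lemma comm_dvd (hp : Nat.Prime p) (hodd : Odd p) (hq : Nat.Prime q)
    (hq8 : q % 8 = 3) (hqr : ∃ r : ℤ, (q : ℤ) ∣ r ^ 2 + p)
    {O : Subring (Bq p q)} (hO : IsOrder O) (x y : Bq p q) (hx : x ∈ O) (hy : y ∈ O) :
    ∃ z : ℤ, Nrq (x*y - y*x) = p * z := by
  have := Fact.mk hp
  have := Fact.mk hq
  obtain ⟨n, hn⟩ := nr_int hO _ (sub_mem (mul_mem hx hy) (mul_mem hy hx))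
  obtain ⟨nx, hnx⟩ := nr_int hO x hx
  obtain ⟨ny, hny⟩ := nr_int hO y hy
  have hpp : Prime (p:ℤ) := Nat.prime_iff_prime_int.mp hp
  suffices H : ∃ E E' z : ℤ, ¬ (p:ℤ) ∣ E ∧ ¬ (p:ℤ) ∣ E' ∧ (E*E')^2 * Nrq (x*y-y*x) = p * z by
    obtain ⟨E, E', z, h1, h2, h3⟩ := H
    have h4 : (E*E')^2 * n = p * z := by
      rw [hn] at h3; exact_mod_cast h3
    have h5 : (p:ℤ) ∣ n := by
      rcases hpp.dvd_or_dvd (Dvd.intro _ h4.symm) with h | h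
      · rcases hpp.dvd_or_dvd (hpp.dvd_of_dvd_pow h) with h | h
        · exact absurd h h1
        · exact absurd h h2
      · exact h
    obtain ⟨z, rfl⟩ := h5
    exact ⟨z, by rw [hn]; push_cast; ring⟩
  rw [nr_eq] at hnx hny ⊢
  by_cases hpq : p = q
  · subst hpq
    have hu := nonres_eq p hq8
    obtain ⟨E, hE, A, B, C, D, h1, h2, h3, h4⟩ := plocal p 1 hu x.re x.imI (p*x.imK) x.imJ nx (by
      push_cast; rw [← hnx]; ring)
    obtain ⟨E', hE', A', B', C', D', h1', h2', h3', h4'⟩ := plocal p 1 hu y.re y.imI (p*y.imK) y.imJ ny (by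
      push_cast; rw [← hny]; ring)
    refine ⟨E, E', 4*(D*C'-C*D')^2+4*(C*B'-B*C')^2+p*4*(B*D'-D*B')^2, hE, hE', ?_⟩
    push_cast
    rw [← h2, ← h3, ← h4, ← h2', ← h3', ← h4']
    simp; ring
  · have hu := nonres_ne p q hodd hq8 hpq hqr
    obtain ⟨E, hE, A, B, C, D, h1, h2, h3, h4⟩ := plocal p q hu x.re x.imI x.imJ x.imK nx (by
      push_cast; rw [← hnx]; ring)
    obtain ⟨E', hE', A', B', C', D', h1', h2', h3', h4'⟩ := plocal p q hu y.re y.imI y.imJ y.imK ny (by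
      push_cast; rw [← hny]; ring)
    refine ⟨E, E', 4*q^2*(C*D'-D*C')^2+4*p*q*(D*B'-B*D')^2+4*q*(B*C'-C*B')^2, hE, hE', ?_⟩
    push_cast
    rw [← h2, ← h3, ← h4, ← h2', ← h3', ← h4']
    simp; ring
end GrossPf

open scoped Quaternion
open GrossPaper
namespace GrossPf
set_option linter.unusedSimpArgs false
variable {p q : ℕ}

lemma lat_re {O : Subring (Bq p q)} {t : Bq p q} (h : t ∈ GrossLat O) : t.re = 0 := by
  obtain ⟨x, _, rfl⟩ := h
  have : (2 : Bq p q) * x = (2:ℚ) • x := by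
    rw [two_mul, two_smul]
  rw [this, Algebra.algebraMap_eq_smul_one]
  simp only [QuaternionAlgebra.re_sub, QuaternionAlgebra.re_smul, QuaternionAlgebra.re_one, Trq, smul_eq_mul]
  ring

lemma le_of_li {n m : ℕ} {w : Fin n → Bq p q} (hw : LinearIndependent ℚ w) (u : Fin m → Bq p q)
    (h : ∀ i, w i ∈ Submodule.span ℚ (Set.range u)) : n ≤ m := by
  have h1 := finrank_span_eq_card hw
  have h2 : Submodule.span ℚ (Set.range w) ≤ Submodule.span ℚ (Set.range u) := by
    rw [Submodule.span_le]; rintro _ ⟨i, rfl⟩; exact h i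
  have h3 := Submodule.finrank_mono h2
  have h4 := finrank_range_le_card (R := ℚ) u
  unfold Set.finrank at h4
  simp at h1 h4
  omega

lemma int_of_sq (r : ℚ) (z : ℤ) (h : r^2 = z) : ∃ n : ℤ, r = n := by
  apply int_of_pow r r.den r.den_pos
  intro n
  rcases Nat.even_or_odd' n with ⟨k, rfl | rfl⟩
  · exact ⟨r.den * z^k, by rw [pow_mul, h]; push_cast; ring⟩
  · exact ⟨r.num * z^k, by rw [pow_succ, pow_mul, h, mul_comm (_^k), ← mul_assoc, Rat.den_mul_eq_num]; push_cast; ring⟩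

lemma lat_add {O : Subring (Bq p q)} {t s : Bq p q} (h : t ∈ GrossLat O) (h' : s ∈ GrossLat O) :
    t + s ∈ GrossLat O := by
  obtain ⟨x, hx, rfl⟩ := h
  obtain ⟨y, hy, rfl⟩ := h'
  refine ⟨x + y, add_mem hx hy, ?_⟩
  have : Trq (x+y) = Trq x + Trq y := by simp [Trq]; ring
  rw [this, map_add, mul_add]; abel

lemma lat_zsmul {O : Subring (Bq p q)} {t : Bq p q} (n : ℤ) (h : t ∈ GrossLat O) :
    n • t ∈ GrossLat O := by
  obtain ⟨x, hx, rfl⟩ := h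
  refine ⟨n • x, zsmul_mem hx n, ?_⟩
  have : Trq (n • x) = n • Trq x := by simp only [Trq, QuaternionAlgebra.re_smul]; simp; ring
  rw [this, map_zsmul, mul_smul_comm, smul_sub]

lemma nr_zero_iff (hp : 0 < p) (hq : 0 < q) (x : Bq p q) (h : Nrq x ≤ 0) : x = 0 := by
  have hp' : (0:ℚ) < p := by exact_mod_cast hp
  have hq' : (0:ℚ) < q := by exact_mod_cast hq
  rw [nr_eq] at h
  have h1 := sq_nonneg x.re
  have h2 := mul_nonneg hp'.le (sq_nonneg x.imI)
  have h3 := mul_nonneg hq'.le (sq_nonneg x.imJ)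
  have h4 := mul_nonneg (mul_pos hp' hq').le (sq_nonneg x.imK)
  have e1 : x.re^2 = 0 := by linarith
  have e2 : (p:ℚ)*x.imI^2 = 0 := by linarith
  have e3 : (q:ℚ)*x.imJ^2 = 0 := by linarith
  have e4 : (p*q:ℚ)*x.imK^2 = 0 := by linarith
  simp [hp'.ne', hq'.ne'] at e1 e2 e3 e4
  ext <;> simp [*]

lemma minima {T : Set (Bq p q)} {D₁ D₂ D₃ : ℝ}
    (hm1 : SuccMin T 1 D₁) (hm2 : SuccMin T 2 D₂) (hm3 : SuccMin T 3 D₃) :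
    ∃ v1 v2 v3 : Bq p q, v1 ∈ T ∧ v2 ∈ T ∧ v3 ∈ T ∧ LinearIndependent ℚ ![v3, v2, v1] ∧
      (Nrq v1 : ℝ) = D₁ ∧ (Nrq v2 : ℝ) = D₂ ∧ (Nrq v3 : ℝ) = D₃ ∧
      (∀ t ∈ T, t ≠ 0 → Nrq v1 ≤ Nrq t) ∧
      (∀ t ∈ T, t ∉ Submodule.span ℚ (Set.range ![v1]) → Nrq v2 ≤ Nrq t) ∧
      (∀ t ∈ T, t ∉ Submodule.span ℚ (Set.range ![v2, v1]) → Nrq v3 ≤ Nrq t) := by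
  classical
  have one_li : ∀ t : Bq p q, t ≠ 0 → LinearIndependent ℚ ![t] := by
    intro t ht
    exact LinearIndependent.of_subsingleton (v := ![t]) 0 (by simpa using ht)
  obtain ⟨w, hwT, hwli, hwn⟩ := hm1.1
  set v1 := w 0
  have hv1 : v1 ≠ 0 := hwli.ne_zero 0
  have A1 : ∀ t ∈ T, t ≠ 0 → D₁ ≤ Nrq t := by
    intro t ht h0
    refine hm1.2 ⟨![t], ?_, one_li t h0, ?_⟩
    · intro n; fin_cases n; exact ht
    · intro n; fin_cases n; exact le_rfl
  have e1 : (Nrq v1 : ℝ) = D₁ := le_antisymm (hwn 0) (A1 v1 (hwT 0) hv1)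
  obtain ⟨w2, hwT2, hwli2, hwn2⟩ := hm2.1
  obtain ⟨n2, hn2⟩ : ∃ n, w2 n ∉ Submodule.span ℚ (Set.range ![v1]) := by
    by_contra! h
    have := le_of_li hwli2 _ h
    omega
  set v2 := w2 n2
  have li2 : ∀ t : Bq p q, t ∉ Submodule.span ℚ (Set.range ![v1]) → LinearIndependent ℚ ![t, v1] :=
    fun t ht => linearIndependent_finCons.mpr ⟨one_li v1 hv1, ht⟩
  have ne2 : ∀ t : Bq p q, t ∉ Submodule.span ℚ (Set.range ![v1]) → t ≠ 0 := by
    rintro t ht rfl; exact ht (zero_mem _)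
  have A2 : ∀ t ∈ T, t ∉ Submodule.span ℚ (Set.range ![v1]) → D₂ ≤ Nrq t := by
    intro t ht h0
    refine hm2.2 ⟨![t, v1], ?_, li2 t h0, ?_⟩
    · intro n; fin_cases n
      exacts [ht, hwT 0]
    · intro n; fin_cases n
      · exact le_rfl
      · exact e1.le.trans (A1 t ht (ne2 t h0))
  have e2 : (Nrq v2 : ℝ) = D₂ := le_antisymm (hwn2 n2) (A2 v2 (hwT2 n2) hn2)
  obtain ⟨w3, hwT3, hwli3, hwn3⟩ := hm3.1
  obtain ⟨n3, hn3⟩ : ∃ n, w3 n ∉ Submodule.span ℚ (Set.range ![v2, v1]) := by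
    by_contra! h
    have := le_of_li hwli3 _ h
    omega
  set v3 := w3 n3
  have li3 : ∀ t : Bq p q, t ∉ Submodule.span ℚ (Set.range ![v2, v1]) → LinearIndependent ℚ ![t, v2, v1] :=
    fun t ht => linearIndependent_finCons.mpr ⟨li2 v2 hn2, ht⟩
  have ne3 : ∀ t : Bq p q, t ∉ Submodule.span ℚ (Set.range ![v2, v1]) → 
      t ∉ Submodule.span ℚ (Set.range ![v1]) := by
    intro t ht h
    refine ht (Submodule.span_mono ?_ h)
    simp
  have A3 : ∀ t ∈ T, t ∉ Submodule.span ℚ (Set.range ![v2, v1]) → D₃ ≤ Nrq t := by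
    intro t ht h0
    refine hm3.2 ⟨![t, v2, v1], ?_, li3 t h0, ?_⟩
    · intro n; fin_cases n
      exacts [ht, hwT2 n2, hwT 0]
    · intro n; fin_cases n
      · exact le_rfl
      · exact e2.le.trans (A2 t ht (ne3 t h0))
      · exact e1.le.trans (A1 t ht (ne2 t (ne3 t h0)))
  have e3 : (Nrq v3 : ℝ) = D₃ := le_antisymm (hwn3 n3) (A3 v3 (hwT3 n3) hn3)
  refine ⟨v1, v2, v3, hwT 0, hwT2 n2, hwT3 n3, li3 v3 hn3, e1, e2, e3, ?_, ?_, ?_⟩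
  · intro t ht h; have := A1 t ht h; rw [← e1] at this; exact_mod_cast this
  · intro t ht h; have := A2 t ht h; rw [← e2] at this; exact_mod_cast this
  · intro t ht h; have := A3 t ht h; rw [← e3] at this; exact_mod_cast this

lemma round1 (s v : Bq p q) (x : ℚ) : ∃ n : ℤ, Nrq ((x - n) • v + s) ≤ Nrq s + Nrq v / 4 := by
  set y := Int.fract x with hy
  have y0 := Int.fract_nonneg x
  have y1 := Int.fract_lt_one x
  have hx : x = ⌊x⌋ + y := (Int.floor_add_fract x).symm
  have key : (1-y) * Nrq (y • v + s) + y * Nrq ((y-1) • v + s) = Nrq s + y*(1-y)*Nrq v := by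
    simp only [nr_eq, QuaternionAlgebra.re_add, QuaternionAlgebra.imI_add, QuaternionAlgebra.imJ_add,
      QuaternionAlgebra.imK_add, QuaternionAlgebra.re_smul, QuaternionAlgebra.imI_smul,
      QuaternionAlgebra.imJ_smul, QuaternionAlgebra.imK_smul, smul_eq_mul]
    ring
  have hv : 0 ≤ Nrq v := by rw [nr_eq]; positivity
  have hb : y*(1-y)*Nrq v ≤ Nrq v / 4 := by nlinarith [sq_nonneg (2*y-1)]
  by_cases h : Nrq (y • v + s) ≤ Nrq s + Nrq v / 4
  · refine ⟨⌊x⌋, ?_⟩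
    have : x - ⌊x⌋ = y := by rw [hy]; rfl
    rwa [this]
  · refine ⟨⌊x⌋ + 1, ?_⟩
    have : x - ((⌊x⌋ + 1 : ℤ):ℚ) = y - 1 := by push_cast; linarith
    rw [this]
    by_contra h'
    push Not at h h'
    have h1 := mul_lt_mul_of_pos_left h (by linarith : 0 < 1 - y)
    have h2 := mul_le_mul_of_nonneg_left h'.le y0
    linarith

lemma gen {O : Subring (Bq p q)} (hp : 0 < p) (hq : 0 < q) {v1 v2 v3 : Bq p q}
    (m1 : v1 ∈ GrossLat O) (m2 : v2 ∈ GrossLat O) (m3 : v3 ∈ GrossLat O)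
    (li : LinearIndependent ℚ ![v3, v2, v1])
    (a1 : ∀ t ∈ GrossLat O, t ≠ 0 → Nrq v1 ≤ Nrq t)
    (a2 : ∀ t ∈ GrossLat O, t ∉ Submodule.span ℚ (Set.range ![v1]) → Nrq v2 ≤ Nrq t)
    (a3 : ∀ t ∈ GrossLat O, t ∉ Submodule.span ℚ (Set.range ![v2, v1]) → Nrq v3 ≤ Nrq t)
    (h12 : Nrq v1 ≤ Nrq v2) (h23 : Nrq v2 ≤ Nrq v3) :
    (∀ t : Bq p q, t.re = 0 → ∃ x y z : ℚ, t = x • v1 + y • v2 + z • v3) ∧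
    ∀ t ∈ GrossLat O, ∃ x y z : ℤ, t = x • v1 + y • v2 + z • v3 := by
  have r1 := lat_re m1
  have r2 := lat_re m2
  have r3 := lat_re m3
  have li4 : LinearIndependent ℚ ![1, v3, v2, v1] := by
    refine linearIndependent_finCons.mpr ⟨li, fun h => ?_⟩
    have h2 : Submodule.span ℚ (Set.range ![v3, v2, v1]) ≤ 
      LinearMap.ker ({ toFun := fun x => x.re, map_add' := by simp, map_smul' := by simp } : Bq p q →ₗ[ℚ] ℚ) := by
      rw [Submodule.span_le]
      rintro _ ⟨n, rfl⟩
      fin_cases n <;> simp [*]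
    have := h2 h
    simp at this
  have hspan : ∀ t : Bq p q, t.re = 0 → ∃ x y z : ℚ, t = x • v1 + y • v2 + z • v3 := by
    intro t ht
    have h := li4.span_eq_top_of_card_eq_finrank (by rw [QuaternionAlgebra.finrank_eq_four]; simp)
    have ht' : t ∈ Submodule.span ℚ (Set.range ![1, v3, v2, v1]) := by rw [h]; trivial
    rw [Submodule.mem_span_range_iff_exists_fun] at ht'
    obtain ⟨c, hc⟩ := ht'
    rw [Fin.sum_univ_four] at hc
    simp only [Matrix.cons_val] at hc
    have := congrArg QuaternionAlgebra.re hc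
    simp [r1, r2, r3, ht] at this
    rw [this] at hc
    exact ⟨c 3, c 2, c 1, by rw [← hc]; module⟩
  refine ⟨hspan, fun t ht => ?_⟩
  obtain ⟨x, y, z, e⟩ := hspan t (lat_re ht)
  obtain ⟨n1, hn1⟩ := round1 0 v1 x
  obtain ⟨n2, hn2⟩ := round1 ((x-n1) • v1 + 0) v2 y
  obtain ⟨n3, hn3⟩ := round1 ((y-n2) • v2 + ((x-n1) • v1 + 0)) v3 z
  have z0 : Nrq (0 : Bq p q) = 0 := by simp [nr_eq]
  rw [z0] at hn1
  have hli2 := (linearIndependent_finCons.mp li).2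
  have hli1 := (linearIndependent_finCons.mp (linearIndependent_finCons.mp li).1).2
  have hli0 := (linearIndependent_finCons.mp (linearIndependent_finCons.mp li).1).1
  have hv1 : v1 ≠ 0 := hli0.ne_zero 0
  have pos1 : 0 < Nrq v1 := by
    by_contra h
    exact hv1 (nr_zero_iff hp hq v1 (not_lt.mp h))
  have memv1 : v1 ∈ Submodule.span ℚ (Set.range ![v1]) := Submodule.subset_span ⟨0, rfl⟩
  have memv1' : v1 ∈ Submodule.span ℚ (Set.range ![v2, v1]) := Submodule.subset_span ⟨1, rfl⟩
  have memv2' : v2 ∈ Submodule.span ℚ (Set.range ![v2, v1]) := Submodule.subset_span ⟨0, rfl⟩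
  have tm : (z-n3) • v3 + ((y-n2) • v2 + ((x-n1) • v1 + 0)) ∈ GrossLat O := by
    have : (z-n3) • v3 + ((y-n2) • v2 + ((x-n1) • v1 + 0)) = t + ((-n1) • v1 + (-n2) • v2 + (-n3) • v3) := by
      rw [e]; module
    rw [this]
    exact lat_add ht (lat_add (lat_add (lat_zsmul _ m1) (lat_zsmul _ m2)) (lat_zsmul _ m3))
  have z3 : z - n3 = 0 := by
    by_contra hne
    have := a3 _ tm (by
      intro h
      have h2 : (z-n3) • v3 ∈ Submodule.span ℚ (Set.range ![v2, v1]) := by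
        have := sub_mem h (add_mem (Submodule.smul_mem _ (y-n2) memv2') (Submodule.smul_mem _ (x-n1) memv1'))
        convert this using 1; module
      exact hli2 ((Submodule.smul_mem_iff _ hne).mp h2))
    linarith
  rw [z3, zero_smul, zero_add] at tm
  have z2 : y - n2 = 0 := by
    by_contra hne
    have := a2 _ tm (by
      intro h
      have h2 : (y-n2) • v2 ∈ Submodule.span ℚ (Set.range ![v1]) := by
        have := sub_mem h (Submodule.smul_mem _ (x-n1) memv1)
        convert this using 1; module
      exact hli1 ((Submodule.smul_mem_iff _ hne).mp h2))
    linarith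
  rw [z2, zero_smul, zero_add] at tm
  have z1 : x - n1 = 0 := by
    by_contra hne
    have := a1 _ tm (by
      rw [add_zero]; exact smul_ne_zero hne hv1)
    linarith
  refine ⟨n1, n2, n3, ?_⟩
  rw [e, sub_eq_zero.mp z1, sub_eq_zero.mp z2, sub_eq_zero.mp z3]
  module

lemma basisO {O : Subring (Bq p q)} (hO : IsOrder O) {α1 α2 α3 : Bq p q}
    (m1 : α1 ∈ O) (m2 : α2 ∈ O) (m3 : α3 ∈ O)
    (hg : ∀ t ∈ GrossLat O, ∃ x y z : ℤ, t = x • (2 * α1 - algebraMap ℚ (Bq p q) (Trq α1))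
      + y • (2 * α2 - algebraMap ℚ (Bq p q) (Trq α2)) + z • (2 * α3 - algebraMap ℚ (Bq p q) (Trq α3))) :
    ∀ t, t ∈ O ↔ Comb α1 α2 α3 t := by
  intro t
  constructor
  · intro ht
    obtain ⟨x, y, z, e⟩ := hg _ ⟨t, ht, rfl⟩
    have two : ∀ s : Bq p q, 2 * s = (2:ℚ) • s := fun s => by rw [two_mul, two_smul]
    simp only [two, Algebra.algebraMap_eq_smul_one] at e
    let r : ℚ := (Trq t - x * Trq α1 - y * Trq α2 - z * Trq α3)/2
    have e2 : t - (x • α1 + y • α2 + z • α3) = r • 1 := by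
      have : (2:ℚ) • (t - (x • α1 + y • α2 + z • α3)) = (2:ℚ) • (r • (1 : Bq p q)) := by
        have : (2:ℚ) • (t - (x • α1 + y • α2 + z • α3)) =
          ((2:ℚ) • t - Trq t • 1) - (x • ((2:ℚ) • α1) + y • ((2:ℚ) • α2) + z • ((2:ℚ) • α3)) + Trq t • 1 := by
          module
        rw [this, e]
        simp only [r]
        module
      exact smul_right_injective _ (two_ne_zero) this
    have hr : r • (1 : Bq p q) ∈ O := by
      rw [← e2]
      exact sub_mem ht (add_mem (add_mem (zsmul_mem m1 _) (zsmul_mem m2 _)) (zsmul_mem m3 _))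
    obtain ⟨n, hn⟩ : ∃ n : ℤ, r = n := by
      obtain ⟨z, hz⟩ := nr_int hO _ hr
      apply int_of_sq r z
      rw [← hz]; simp [nr_eq]
    refine ⟨n, x, y, z, ?_⟩
    rw [hn] at e2
    rw [sub_eq_iff_eq_add] at e2
    rw [e2]; module
  · rintro ⟨n0, n1, n2, n3, rfl⟩
    exact add_mem (add_mem (add_mem (zsmul_mem (one_mem _) _) (zsmul_mem m1 _)) (zsmul_mem m2 _)) (zsmul_mem m3 _)

end GrossPf

open scoped Quaternion
open GrossPaper
namespace GrossPf
set_option linter.unusedSimpArgs false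
variable {p q : ℕ}

lemma bq_smul (r a b c d : ℚ) : r • (⟨a, b, c, d⟩ : Bq p q) = ⟨r*a, r*b, r*c, r*d⟩ := by
  ext <;> simp
lemma bq_mul (a b c d a' b' c' d' : ℚ) : (⟨a, b, c, d⟩ : Bq p q) * ⟨a', b', c', d'⟩ =
    ⟨a*a' - p*b*b' - q*c*c' - p*q*d*d', a*b' + b*a' + q*c*d' - q*d*c',
      a*c' - p*b*d' + c*a' + p*d*b', a*d' + b*c' - c*b' + d*a'⟩ := by
  ext <;> simp <;> ring
lemma bq_sub (a b c d a' b' c' d' : ℚ) : (⟨a, b, c, d⟩ : Bq p q) - ⟨a', b', c', d'⟩ =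
    ⟨a-a', b-b', c-c', d-d'⟩ := by
  ext <;> simp
lemma bq_add (a b c d a' b' c' d' : ℚ) : (⟨a, b, c, d⟩ : Bq p q) + ⟨a', b', c', d'⟩ =
    ⟨a+a', b+b', c+c', d+d'⟩ := by
  ext <;> simp
lemma bq_one : (1 : Bq p q) = ⟨1, 0, 0, 0⟩ := by
  ext <;> simp

/-- commutator -/
def cm (x y : Bq p q) : Bq p q := x * y - y * x

/-- triple trace -/
def tN (x y z : Bq p q) : ℚ := Trq (cm y z * x)

lemma cm_mk (a b c d a' b' c' d' : ℚ) : cm (⟨a, b, c, d⟩ : Bq p q) ⟨a', b', c', d'⟩ =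
    ⟨0, 2*q*(c*d'-d*c'), 2*p*(d*b'-b*d'), 2*(b*c'-c*b')⟩ := by
  simp only [cm, bq_mul, bq_sub]
  congr 1 <;> ring

lemma cm_re (x y : Bq p q) : (cm x y).re = 0 := by
  obtain ⟨a, b, c, d⟩ := x
  obtain ⟨a', b', c', d'⟩ := y
  rw [cm_mk]

lemma tN_mk (r1 x1 y1 z1 r2 x2 y2 z2 r3 x3 y3 z3 : ℚ) :
    tN (⟨r1, x1, y1, z1⟩ : Bq p q) ⟨r2, x2, y2, z2⟩ ⟨r3, x3, y3, z3⟩ =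
      -4*p*q*(x1*(y2*z3-z2*y3) + y1*(z2*x3-x2*z3) + z1*(x2*y3-y2*x3)) := by
  simp only [tN, cm_mk, bq_mul, Trq]; ring

lemma tN_cyc (x y z : Bq p q) : tN x y z = tN y z x := by
  obtain ⟨r1, x1, y1, z1⟩ := x
  obtain ⟨r2, x2, y2, z2⟩ := y
  obtain ⟨r3, x3, y3, z3⟩ := z
  simp only [tN_mk]; ring

/-- `Tr (c₁ t)` is an integer multiple of `N` for `t` in the order. -/
lemma tr_c {O : Subring (Bq p q)} {x y z : Bq p q} (h : ∀ t, t ∈ O ↔ Comb x y z t) (t : Bq p q)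
    (ht : t ∈ O) : ∃ n : ℤ, Trq (cm y z * t) = tN x y z * n := by
  obtain ⟨n0, n1, n2, n3, rfl⟩ := (h t).mp ht
  refine ⟨n1, ?_⟩
  obtain ⟨r1, x1, y1, z1⟩ := x
  obtain ⟨r2, x2, y2, z2⟩ := y
  obtain ⟨r3, x3, y3, z3⟩ := z
  simp only [← Int.cast_smul_eq_zsmul ℚ, bq_one, bq_smul, bq_add, cm_mk, tN_mk, bq_mul, Trq]
  ring

lemma Comb_cyc {x y z t : Bq p q} : Comb x y z t ↔ Comb y z x t := by
  constructor
  · rintro ⟨n0, n1, n2, n3, rfl⟩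
    exact ⟨n0, n2, n3, n1, by abel⟩
  · rintro ⟨n0, n1, n2, n3, rfl⟩
    exact ⟨n0, n3, n1, n2, by abel⟩

lemma cm_sq (x y : Bq p q) : cm x y * cm x y = Trq (cm x y * (x * y)) • (1 : Bq p q) := by
  obtain ⟨r2, x2, y2, z2⟩ := x
  obtain ⟨r3, x3, y3, z3⟩ := y
  simp only [cm_mk, bq_mul, Trq, bq_one, bq_smul]
  congr 1 <;> ring

lemma anti (x y : Bq p q) (hx : x.re = 0) (hy : y.re = 0) : x * y + y * x = Trq (x * y) • (1 : Bq p q) := by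
  obtain ⟨r2, x2, y2, z2⟩ := x
  obtain ⟨r3, x3, y3, z3⟩ := y
  subst hx
  subst hy
  simp only [cm_mk, bq_mul, Trq, bq_one, bq_smul, bq_add]
  congr 1 <;> ring

lemma cc (x y z : Bq p q) : cm z x * cm x y + tN x y z • x =
    ((cm z x * cm x y).re + tN x y z * x.re) • (1 : Bq p q) := by
  obtain ⟨r1, x1, y1, z1⟩ := x
  obtain ⟨r2, x2, y2, z2⟩ := y
  obtain ⟨r3, x3, y3, z3⟩ := z
  simp only [cm_mk, bq_mul, Trq, bq_one, bq_smul, bq_add, tN_mk]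
  congr 1 <;> ring

lemma dual (x y z t : Bq p q) (ht : t.re = 0) : tN x y z • t =
    Trq (x * t) • cm y z + Trq (y * t) • cm z x + Trq (z * t) • cm x y := by
  obtain ⟨r1, x1, y1, z1⟩ := x
  obtain ⟨r2, x2, y2, z2⟩ := y
  obtain ⟨r3, x3, y3, z3⟩ := z
  obtain ⟨r, a, b, c⟩ := t
  subst ht
  simp only [cm_mk, bq_mul, Trq, bq_one, bq_smul, bq_add, tN_mk]
  congr 1 <;> ring

lemma half_int (s : ℚ) (h u k : ℤ) (h1 : 2*s = h) (h2 : s^2 - s*u = k) : ∃ n : ℤ, s = n := by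
  have h3 : h^2 - 2*u*h = 4*k := by
    have : (h:ℚ)^2 - 2*u*h = 4*k := by rw [← h1, ← h2]; ring
    exact_mod_cast this
  have h4 : Even h := by
    by_contra hh
    rw [Int.not_even_iff_odd] at hh
    obtain ⟨j, rfl⟩ := hh
    have : (1:ℤ) = 2 * (2*k - 2*j^2-2*j + u*(2*j+1)) := by linarith
    omega
  obtain ⟨j, rfl⟩ := h4
  exact ⟨j, by push_cast at h1; linarith⟩

/-- `g₁ + α₁` is an integer. -/
lemma g_int {O : Subring (Bq p q)} (hO : IsOrder O) {x y z : Bq p q} (hx : x ∈ O)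
    (h0 : tN x y z ≠ 0) (b c u : ℤ)
    (hb : cm z x * cm z x = (tN x y z * b) • (1 : Bq p q))
    (hc : cm x y * cm x y = (tN x y z * c) • (1 : Bq p q))
    (hu : Trq (cm z x * cm x y) = tN x y z * u) :
    ∃ n : ℤ, (1 / tN x y z) • (cm z x * cm x y) = n • (1 : Bq p q) - x := by
  set N := tN x y z with hN
  have e := cc x y z
  rw [← hN] at e
  set k : ℚ := (cm z x * cm x y).re + N * x.re with hk
  obtain ⟨ρ, hρ⟩ := tr_int hO x hx
  obtain ⟨ν, hν⟩ := nr_int hO x hx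
  have h1 : 2 * (k / N) = ((u + ρ : ℤ) : ℚ) := by
    push_cast
    rw [← hρ]
    field_simp
    unfold Trq at hu ⊢
    rw [hk]; linear_combination hu
  have nrsq : ∀ (t : Bq p q) (r : ℚ), t.re = 0 → t * t = r • (1 : Bq p q) → Nrq t = -r := by
    intro t r h h'
    have := congrArg QuaternionAlgebra.re h'
    rw [nr_eq]
    simp [h] at this ⊢
    linear_combination -this
  have hb' := nrsq _ _ (cm_re _ _) hb
  have hc' := nrsq _ _ (cm_re _ _) hc
  have hnr : Nrq (cm z x * cm x y) = N^2 * (b*c) := by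
    rw [nr_mul, hb', hc']; ring
  have hxe : N • x = k • (1 : Bq p q) - cm z x * cm x y := by
    rw [← e]; abel
  have h2 : (k/N)^2 - (k/N)*u = ((ν - b*c : ℤ) : ℚ) := by
    have h3 : N^2 * Nrq x = k^2 - k * (N*u) + N^2*(b*c) := by
      have e1 : N^2 * Nrq x = Nrq (N • x) := by simp [nr_eq]; ring
      rw [e1, hxe, ← hnr, ← hu]
      simp [nr_eq, Trq]
      ring
    push_cast
    rw [← hν]
    field_simp
    linear_combination -h3
  obtain ⟨n, hn⟩ := half_int _ _ _ _ h1 h2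
  refine ⟨n, ?_⟩
  have : cm z x * cm x y = k • (1 : Bq p q) - N • x := by rw [hxe]; abel
  rw [this, smul_sub, smul_smul, smul_smul, ← Int.cast_smul_eq_zsmul ℚ, ← hn]
  have e1 : 1 / N * N = 1 := by field_simp
  have e2 : 1 / N * k = k / N := by ring
  rw [e1, e2, one_smul]

lemma nf_id (x y z : Bq p q) : 
    4 * (Trq (cm y z * (y*z))) * (Trq (cm z x * (z * x))) * (Trq (cm x y * (x * y)))
     + Trq (cm z x * cm x y) * Trq (cm x y * cm y z) * Trq (cm y z * cm z x)
     - Trq (cm y z * (y*z)) * Trq (cm z x * cm x y)^2 - Trq (cm z x * (z * x)) * Trq (cm x y * cm y z)^2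
     - Trq (cm x y * (x * y)) * Trq (cm y z * cm z x)^2 = - tN x y z ^ 4 := by
  have h1 : ∀ x y : Bq p q, Trq (cm x y * (x * y)) = (cm x y * cm x y).re := by
    intro x y; rw [cm_sq]; simp
  rw [h1, h1, h1]
  obtain ⟨r1, x1, y1, z1⟩ := x
  obtain ⟨r2, x2, y2, z2⟩ := y
  obtain ⟨r3, x3, y3, z3⟩ := z
  simp only [tN_mk, cm_mk, bq_mul, Trq]
  have hd : ∀ P1 Q1 R1 P2 Q2 R2 P3 Q3 R3 A B C U V W : ℚ,
     A = -(p*P1^2+q*Q1^2+p*q*R1^2) → B = -(p*P2^2+q*Q2^2+p*q*R2^2) → C = -(p*P3^2+q*Q3^2+p*q*R3^2) →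
     U = -2*(p*P2*P3+q*Q2*Q3+p*q*R2*R3) → V = -2*(p*P3*P1+q*Q3*Q1+p*q*R3*R1) →
     W = -2*(p*P1*P2+q*Q1*Q2+p*q*R1*R2) → 
     4*A*B*C+U*V*W-A*U^2-B*V^2-C*W^2 =
      -4*(p*q)^2*(P1*(Q2*R3-R2*Q3)+Q1*(R2*P3-P2*R3)+R1*(P2*Q3-Q2*P3))^2 := by
    intros; subst_vars; ring
  rw [hd (2*q*(y2*z3-z2*y3)) (2*p*(z2*x3-x2*z3)) (2*(x2*y3-y2*x3))
     (2*q*(y3*z1-z3*y1)) (2*p*(z3*x1-x3*z1)) (2*(x3*y1-y3*x1))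
     (2*q*(y1*z2-z1*y2)) (2*p*(z1*x2-x1*z2)) (2*(x1*y2-y1*x2))]
  · have : (2*q*(y2*z3-z2*y3))*((2*p*(z3*x1-x3*z1))*(2*(x1*y2-y1*x2)) - (2*(x3*y1-y3*x1))*(2*p*(z1*x2-x1*z2)))
      + (2*p*(z2*x3-x2*z3))*((2*(x3*y1-y3*x1))*(2*q*(y1*z2-z1*y2)) - (2*q*(y3*z1-z3*y1))*(2*(x1*y2-y1*x2)))
      + (2*(x2*y3-y2*x3))*((2*q*(y3*z1-z3*y1))*(2*p*(z1*x2-x1*z2)) - (2*p*(z3*x1-x3*z1))*(2*q*(y1*z2-z1*y2)))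
      = 8*p*q*(x1*(y2*z3-z2*y3) + y1*(z2*x3-x2*z3) + z1*(x2*y3-y2*x3))^2 := by ring
    rw [this]
    generalize x1*(y2*z3-z2*y3) + y1*(z2*x3-x2*z3) + z1*(x2*y3-y2*x3) = δ
    ring
  all_goals ring

lemma mkTup {O : Subring (Bq p q)} (hO : IsOrder O) {x y z : Bq p q}
    (h : ∀ t, t ∈ O ↔ Comb x y z t) (h0 : tN x y z ≠ 0) :
    ∃ a b c u v w : ℤ, Tup O (1 / tN x y z) (cm y z) (cm z x) (cm x y) a b c u v w ∧
      (Nf a b c u v w : ℚ) = - tN x y z := by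
  have hx : x ∈ O := (h x).mpr ⟨0,1,0,0, by simp⟩
  have hy : y ∈ O := (h y).mpr ⟨0,0,1,0, by simp⟩
  have hz : z ∈ O := (h z).mpr ⟨0,0,0,1, by simp⟩
  have h' : ∀ t, t ∈ O ↔ Comb y z x t := fun t => by rw [h, Comb_cyc]
  have h'' : ∀ t, t ∈ O ↔ Comb z x y t := fun t => by rw [h', Comb_cyc]
  have hc1 : cm y z ∈ O := sub_mem (mul_mem hy hz) (mul_mem hz hy)
  have hc2 : cm z x ∈ O := sub_mem (mul_mem hz hx) (mul_mem hx hz)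
  have hc3 : cm x y ∈ O := sub_mem (mul_mem hx hy) (mul_mem hy hx)
  obtain ⟨a, ha⟩ := tr_c h _ (mul_mem hy hz)
  obtain ⟨b, hb⟩ := tr_c h' _ (mul_mem hz hx)
  obtain ⟨c, hc⟩ := tr_c h'' _ (mul_mem hx hy)
  obtain ⟨w, hw⟩ := tr_c h _ hc2
  obtain ⟨u, hu⟩ := tr_c h' _ hc3
  obtain ⟨v, hv⟩ := tr_c h'' _ hc1
  have N2 : tN y z x = tN x y z := (tN_cyc _ _ _).symm
  have N3 : tN z x y = tN x y z := tN_cyc _ _ _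
  rw [N2] at hb hu
  rw [N3] at hc hv
  have hid := nf_id x y z
  have sa := cm_sq y z
  have sb := cm_sq z x
  have sc := cm_sq x y
  rw [ha] at sa
  rw [hb] at sb
  rw [hc] at sc
  obtain ⟨n1, g1⟩ := g_int hO hx h0 b c u sb sc hu
  obtain ⟨n2, g2⟩ := g_int (x := y) (y := z) (z := x) hO hy (by rwa [N2]) c a v
    (by rwa [N2]) (by rwa [N2]) (by rwa [N2])
  obtain ⟨n3, g3⟩ := g_int (x := z) (y := x) (z := y) hO hz (by rwa [N3]) a b w
    (by rwa [N3]) (by rwa [N3]) (by rwa [N3])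
  rw [N2] at g2
  rw [N3] at g3
  have ua := anti _ _ (cm_re z x) (cm_re x y)
  have va := anti _ _ (cm_re x y) (cm_re y z)
  have wa := anti _ _ (cm_re y z) (cm_re z x)
  rw [ha, hb, hc, hu, hv, hw] at hid
  rw [hu] at ua
  rw [hv] at va
  rw [hw] at wa
  set N := tN x y z
  have S : ∀ n : ℤ, (1/N) • ((N * n) • (1 : Bq p q)) = n • (1 : Bq p q) := by
    intro n
    rw [smul_smul, ← Int.cast_smul_eq_zsmul ℚ]
    congr 1
    field_simp
  refine ⟨a, b, c, u, v, w, ⟨⟨?_, ?_, ?_, ?_, ?_, ?_⟩, ?_, ?_⟩, ?_⟩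
  · rw [sa, S]
  · rw [sb, S]
  · rw [sc, S]
  · rw [ua, S]
  · rw [va, S]
  · rw [wa, S]
  · intro t
    rw [h, g1, g2, g3]
    constructor
    · rintro ⟨m0, m1, m2, m3, rfl⟩
      exact ⟨m0 + n1*m1+n2*m2+n3*m3, -m1, -m2, -m3, by module⟩
    · rintro ⟨m0, m1, m2, m3, rfl⟩
      exact ⟨m0 + n1*m1+n2*m2+n3*m3, -m1, -m2, -m3, by module⟩
  · intro t ht
    refine ⟨Trq (x*t)/N, Trq (y*t)/N, Trq (z*t)/N, ?_⟩
    have e : t = (1/N) • (N • t) := by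
      rw [smul_smul, one_div, inv_mul_cancel₀ h0, one_smul]
    refine e.trans ?_
    rw [dual x y z t ht]
    module
  · unfold Nf
    push_cast
    have h3 : N^3 ≠ 0 := pow_ne_zero _ h0
    apply mul_left_cancel₀ h3
    linear_combination hid
end GrossPf

open scoped Quaternion
open GrossPaper
namespace GrossPf
set_option linter.unusedSimpArgs false
variable {p q : ℕ}

lemma tN_ne (hp : 0 < p) (hq : 0 < q) {v1 v2 v3 : Bq p q}
    (h : ∀ t : Bq p q, t.re = 0 → ∃ x y z : ℚ, t = x • v1 + y • v2 + z • v3) : tN v1 v2 v3 ≠ 0 := by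
  obtain ⟨a1, a2, a3, e1⟩ := h ⟨0,1,0,0⟩ rfl
  obtain ⟨b1, b2, b3, e2⟩ := h ⟨0,0,1,0⟩ rfl
  obtain ⟨c1, c2, c3, e3⟩ := h ⟨0,0,0,1⟩ rfl
  obtain ⟨r1, x1, y1, z1⟩ := v1
  obtain ⟨r2, x2, y2, z2⟩ := v2
  obtain ⟨r3, x3, y3, z3⟩ := v3
  simp only [bq_smul, bq_add, QuaternionAlgebra.mk.injEq] at e1 e2 e3
  obtain ⟨-, e11, e12, e13⟩ := e1
  obtain ⟨-, e21, e22, e23⟩ := e2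
  obtain ⟨-, e31, e32, e33⟩ := e3
  rw [tN_mk]
  have key : (x1*(y2*z3-z2*y3) + y1*(z2*x3-x2*z3) + z1*(x2*y3-y2*x3)) *
     (a1*(b2*c3-b3*c2) + a2*(b3*c1-b1*c3) + a3*(b1*c2-b2*c1)) =
     (a1*x1+a2*x2+a3*x3)*((b1*y1+b2*y2+b3*y3)*(c1*z1+c2*z2+c3*z3)-(b1*z1+b2*z2+b3*z3)*(c1*y1+c2*y2+c3*y3))
     +(a1*y1+a2*y2+a3*y3)*((b1*z1+b2*z2+b3*z3)*(c1*x1+c2*x2+c3*x3)-(b1*x1+b2*x2+b3*x3)*(c1*z1+c2*z2+c3*z3))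
     +(a1*z1+a2*z2+a3*z3)*((b1*x1+b2*x2+b3*x3)*(c1*y1+c2*y2+c3*y3)-(b1*y1+b2*y2+b3*y3)*(c1*x1+c2*x2+c3*x3)) := by
    ring
  rw [← e11, ← e12, ← e13, ← e21, ← e22, ← e23, ← e31, ← e32, ← e33] at key
  norm_num at key
  have h1 := left_ne_zero_of_mul_eq_one key
  have hp' : (p:ℚ) ≠ 0 := by exact_mod_cast hp.ne'
  have hq' : (q:ℚ) ≠ 0 := by exact_mod_cast hq.ne'
  exact mul_ne_zero (mul_ne_zero (mul_ne_zero (by norm_num) hp') hq') h1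

/-- polar form -/
def bl (x y : Bq p q) : ℚ := (Nrq (x+y) - Nrq x - Nrq y)/2

lemma bl_eq (x y : Bq p q) : bl x y = x.re*y.re + p*x.imI*y.imI + q*x.imJ*y.imJ + p*q*x.imK*y.imK := by
  unfold bl; simp [nr_eq]; ring

lemma lat_mk (r x y z : ℚ) : 2 * (⟨r,x,y,z⟩ : Bq p q) - algebraMap ℚ (Bq p q) (Trq (⟨r, x, y, z⟩ : Bq p q)) = 
   ⟨0, 2*x, 2*y, 2*z⟩ := by
  rw [two_mul, Algebra.algebraMap_eq_smul_one, bq_one, bq_smul, bq_add, bq_sub]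
  simp only [Trq]
  congr 1 <;> ring

/-- The Gross element. -/
def gv (x : Bq p q) : Bq p q := 2 * x - algebraMap ℚ (Bq p q) (Trq x)

lemma gv_mk (r x y z : ℚ) : gv (⟨r,x,y,z⟩ : Bq p q) = ⟨0, 2*x, 2*y, 2*z⟩ := lat_mk r x y z

lemma tN_gv (x y z : Bq p q) : tN (gv x) (gv y) (gv z) = 8 * tN x y z := by
  obtain ⟨r1, x1, y1, z1⟩ := x
  obtain ⟨r2, x2, y2, z2⟩ := y
  obtain ⟨r3, x3, y3, z3⟩ := z
  simp only [gv_mk, tN_mk]; ring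

lemma nr_gv (x : Bq p q) : Nrq (gv x) = 4 * Nrq x - Trq x ^ 2 := by
  obtain ⟨r1, x1, y1, z1⟩ := x
  simp only [gv_mk, nr_eq, Trq]; ring

lemma nr_cm (x y : Bq p q) : 4 * Nrq (cm x y) = Nrq (gv x) * Nrq (gv y) - bl (gv x) (gv y)^2 := by
  obtain ⟨r1, x1, y1, z1⟩ := x
  obtain ⟨r2, x2, y2, z2⟩ := y
  simp only [gv_mk, nr_eq, Trq, bl_eq, cm_mk]; ring

lemma gram (x y z : Bq p q) : Nrq (gv x) * Nrq (gv y) * Nrq (gv z) +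
    2 * bl (gv y) (gv z) * bl (gv x) (gv z) * bl (gv x) (gv y) - Nrq (gv x) * bl (gv y) (gv z)^2
    - Nrq (gv y) * bl (gv x) (gv z)^2 - Nrq (gv z) * bl (gv x) (gv y)^2 = 4 * tN x y z ^ 2 := by
  obtain ⟨r1, x1, y1, z1⟩ := x
  obtain ⟨r2, x2, y2, z2⟩ := y
  obtain ⟨r3, x3, y3, z3⟩ := z
  simp only [gv_mk, nr_eq, Trq, bl_eq, tN_mk]; ring

lemma nr_comb (x y z : Bq p q) (m n : ℤ) : Nrq (z + (n • y + m • x)) = Nrq z + n^2 * Nrq y + m^2 * Nrq x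
    + 2 * n * bl y z + 2 * m * bl x z + 2 * m * n * bl x y := by
  obtain ⟨r1, x1, y1, z1⟩ := x
  obtain ⟨r2, x2, y2, z2⟩ := y
  obtain ⟨r3, x3, y3, z3⟩ := z
  simp only [← Int.cast_smul_eq_zsmul ℚ, bq_smul, bq_add, nr_eq, bl_eq]; ring

lemma main_aux (hp : Nat.Prime p) (hodd : Odd p) (hq : Nat.Prime q)
    (hq8 : q % 8 = 3) (hqr : ∃ r : ℤ, (q : ℤ) ∣ r ^ 2 + p)
    (O : Subring (Bq p q)) (hO : IsMaximalOrder O) (x y z : Bq p q)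
    (mx : x ∈ O) (my : y ∈ O) (mz : z ∈ O)
    (li : LinearIndependent ℚ ![gv z, gv y, gv x])
    (a1 : ∀ t ∈ GrossLat O, t ≠ 0 → Nrq (gv x) ≤ Nrq t)
    (a2 : ∀ t ∈ GrossLat O, t ∉ Submodule.span ℚ (Set.range ![gv x]) → Nrq (gv y) ≤ Nrq t)
    (a3 : ∀ t ∈ GrossLat O, t ∉ Submodule.span ℚ (Set.range ![gv y, gv x]) → Nrq (gv z) ≤ Nrq t) :
    4 * (p:ℚ) ≤ Nrq (gv x) * Nrq (gv y) ∧ Nrq (gv z) < 2 * (p:ℚ) := by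
  have gx : gv x ∈ GrossLat O := ⟨x, mx, rfl⟩
  have gy : gv y ∈ GrossLat O := ⟨y, my, rfl⟩
  have gz : gv z ∈ GrossLat O := ⟨z, mz, rfl⟩
  have hli2 := (linearIndependent_finCons.mp li).2
  have hli1 := (linearIndependent_finCons.mp (linearIndependent_finCons.mp li).1).2
  have hli0 := (linearIndependent_finCons.mp (linearIndependent_finCons.mp li).1).1
  have hv1 : gv x ≠ 0 := hli0.ne_zero 0
  have memv1 : gv x ∈ Submodule.span ℚ (Set.range ![gv x]) := Submodule.subset_span ⟨0, rfl⟩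
  have memv1' : gv x ∈ Submodule.span ℚ (Set.range ![gv y, gv x]) := Submodule.subset_span ⟨1, rfl⟩
  have memv2' : gv y ∈ Submodule.span ℚ (Set.range ![gv y, gv x]) := Submodule.subset_span ⟨0, rfl⟩
  have pos1 : 0 < Nrq (gv x) := by
    by_contra h
    exact hv1 (nr_zero_iff hp.pos hq.pos _ (not_lt.mp h))
  have h12 : Nrq (gv x) ≤ Nrq (gv y) := a1 _ gy (fun h => hli1 (by
    rw [h]; exact zero_mem _))
  have h23 : Nrq (gv y) ≤ Nrq (gv z) := a2 _ gz (fun h => hli2 (by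
    refine Submodule.span_mono ?_ h
    simp))
  obtain ⟨hs, hg⟩ := gen hp.pos hq.pos gx gy gz li a1 a2 a3 h12 h23
  have hN0 : tN x y z ≠ 0 := by
    have := tN_ne hp.pos hq.pos hs
    rw [tN_gv] at this
    exact right_ne_zero_of_mul this
  have hmem := basisO hO.1 mx my mz hg
  obtain ⟨a, b, c, u, v, w, T, hN⟩ := mkTup hO.1 hmem hN0
  have hNf : Nf a b c u v w ≠ 0 := by
    intro h; rw [h] at hN; apply hN0; push_cast at hN; linarith
  have hb := T.bound hp hodd hq hq8 hqr hO hNf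
  have hN2 : tN x y z ^ 2 ≤ (p:ℚ)^2 := by
    have e : tN x y z ^ 2 = (Nf a b c u v w : ℚ)^2 := by rw [hN]; ring
    have h1 : (Nf a b c u v w)^2 ≤ (p:ℤ)^2 := by
      rw [← Int.natAbs_sq]
      have : ((Nf a b c u v w).natAbs : ℤ) ≤ p := by exact_mod_cast hb
      exact pow_le_pow_left₀ (by positivity) this 2
    rw [e]; exact_mod_cast h1
  have hp0 : (0:ℚ) < p := by exact_mod_cast hp.pos
  -- first inequality
  have hc0 : cm x y ≠ 0 := by
    intro h
    apply hN0
    rw [← tN_cyc z x y]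
    unfold tN
    rw [h]; simp [Trq]
  have hfirst : 4 * (p:ℚ) ≤ Nrq (gv x) * Nrq (gv y) := by
    obtain ⟨n, hn⟩ := comm_dvd hp hodd hq hq8 hqr hO.1 x y mx my
    change Nrq (cm x y) = _ at hn
    have hpos : 0 < Nrq (cm x y) := by
      by_contra h
      exact hc0 (nr_zero_iff hp.pos hq.pos _ (not_lt.mp h))
    have hn0 : 0 < n := by
      rw [hn] at hpos
      have := pos_of_mul_pos_right hpos hp0.le
      exact_mod_cast this
    have hn1 : (1:ℚ) ≤ n := by exact_mod_cast hn0
    have := nr_cm x y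
    rw [hn] at this
    nlinarith [sq_nonneg (bl (gv x) (gv y))]
  refine ⟨hfirst, ?_⟩
  have B3 : ∀ m n : ℤ, Nrq (gv z) ≤ Nrq (gv z + (n • gv y + m • gv x)) := by
    intro m n
    apply a3 _ (lat_add gz (lat_add (lat_zsmul _ gy) (lat_zsmul _ gx)))
    intro h
    apply hli2
    have := sub_mem h (add_mem (zsmul_mem memv2' n) (zsmul_mem memv1' m))
    rwa [add_sub_cancel_right] at this
  have B2 : ∀ m : ℤ, Nrq (gv y) ≤ Nrq (gv y + m • gv x) := by
    intro m
    apply a2 _ (lat_add gy (lat_zsmul _ gx))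
    intro h
    apply hli1
    have := sub_mem h (zsmul_mem memv1 m)
    rwa [add_sub_cancel_right] at this
  have B2' : ∀ m : ℤ, 0 ≤ m^2 * Nrq (gv x) + 2 * m * bl (gv x) (gv y) := by
    intro m
    have h := B2 m
    have e := nr_comb (gv x) 0 (gv y) m 0
    have e0 : Nrq (0 : Bq p q) = 0 := by simp [nr_eq]
    rw [zero_smul, zero_add, e0] at e
    rw [e] at h; push_cast at h; linarith
  simp only [nr_comb] at B3
  have i1 := B3 1 0
  have i2 := B3 (-1) 0
  have i3 := B3 0 1
  have i4 := B3 0 (-1)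
  have i5 := B3 1 1
  have i6 := B3 (-1) 1
  have i7 := B3 1 (-1)
  have i8 := B3 (-1) (-1)
  have i9 := B2' 1
  have i10 := B2' (-1)
  push_cast at i1 i2 i3 i4 i5 i6 i7 i8 i9 i10
  have hseb := seeber (Nrq (gv x)) (Nrq (gv y)) (Nrq (gv z)) (bl (gv y) (gv z)) (bl (gv x) (gv z))
    (bl (gv x) (gv y)) pos1 h12 h23 (by linarith) (by linarith) (by linarith) (by linarith) (by linarith)
    (by linarith) (by linarith) (by linarith) (by linarith) (by linarith)
  rw [gram] at hseb
  have hle : Nrq (gv z) ≤ 2 * p := by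
    have hz0 : 0 ≤ Nrq (gv z) := by linarith
    have h1 := mul_le_mul_of_nonneg_right hfirst hz0
    have h2 : 4 * (p:ℚ) * Nrq (gv z) ≤ 4 * p * (2 * p) := by nlinarith
    exact le_of_mul_le_mul_left h2 (by positivity)
  refine lt_of_le_of_ne hle ?_
  rw [nr_gv]
  obtain ⟨ρ, hρ⟩ := tr_int hO.1 z mz
  obtain ⟨ν, hν⟩ := nr_int hO.1 z mz
  rw [hρ, hν]
  intro h
  have h' : 4 * ν - ρ^2 = 2 * (p:ℤ) := by exact_mod_cast h
  obtain ⟨k, hk⟩ := hodd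
  rcases Int.even_or_odd' ρ with ⟨j, rfl | rfl⟩
  · have : 4 * ν - 4 * j^2 = 2 * (2 * (k:ℤ) + 1) := by rw [hk] at h'; push_cast at h'; linarith
    omega
  · have : 4 * ν - 4 * (j^2) - 4 * j - 1 = 2 * (2 * (k:ℤ) + 1) := by rw [hk] at h'; push_cast at h'; linarith
    omega
end GrossPf

/-- `4p ≤ D₁D₂` and `D₃ < 2p`. -/
theorem general_minima_bounds (p q : ℕ) (hp : Nat.Prime p) (hodd : Odd p) (hq : Nat.Prime q)
    (hq8 : q % 8 = 3) (hqr : ∃ r : ℤ, (q : ℤ) ∣ r ^ 2 + p)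
    (O : Subring (Bq p q)) (hO : IsMaximalOrder O)
    (D₁ D₂ D₃ : ℝ)
    (hm1 : SuccMin (GrossLat O) 1 D₁) (hm2 : SuccMin (GrossLat O) 2 D₂)
    (hm3 : SuccMin (GrossLat O) 3 D₃) :
    4 * (p : ℝ) ≤ D₁ * D₂ ∧ D₃ < 2 * (p : ℝ) := by
  obtain ⟨v1, v2, v3, ⟨x, mx, e1⟩, ⟨y, my, e2⟩, ⟨z, mz, e3⟩, li, d1, d2, d3, a1, a2, a3⟩ :=
    GrossPf.minima hm1 hm2 hm3
  change v1 = GrossPf.gv x at e1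
  change v2 = GrossPf.gv y at e2
  change v3 = GrossPf.gv z at e3
  subst e1 e2 e3
  have := GrossPf.main_aux hp hodd hq hq8 hqr O hO x y z mx my mz li a1 a2 a3
  rw [← d1, ← d2, ← d3]
  exact_mod_cast this
end

section
/- Two orders O, O′ ⊆ B_p are of the same type if and only if there exists a nonzero c ∈ B_p with c·O^T·c⁻¹ = O′^T. -/
open scoped Quaternion

open GrossPaper

theorem nrq_eq {p q : ℕ} (c : Bq p q) :
    Nrq c = c.re ^ 2 + p * c.imI ^ 2 + q * c.imJ ^ 2 + p * q * c.imK ^ 2 := by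
  simp [Nrq]; ring

theorem nrq_ne {p q : ℕ} (hp : 0 < p) (hq : 0 < q) {c : Bq p q} (hc : c ≠ 0) : Nrq c ≠ 0 := by
  intro h
  apply hc
  rw [nrq_eq] at h
  have hp' : (0 : ℚ) < p := by exact_mod_cast hp
  have hq' : (0 : ℚ) < q := by exact_mod_cast hq
  have h1 := sq_nonneg c.re
  have h2 := mul_nonneg hp'.le (sq_nonneg c.imI)
  have h3 := mul_nonneg hq'.le (sq_nonneg c.imJ)
  have h4 := mul_nonneg (mul_pos hp' hq').le (sq_nonneg c.imK)
  have e1 : c.re ^ 2 = 0 := by linarith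
  have e2 : (p : ℚ) * c.imI ^ 2 = 0 := by linarith
  have e3 : (q : ℚ) * c.imJ ^ 2 = 0 := by linarith
  have e4 : (p : ℚ) * q * c.imK ^ 2 = 0 := by linarith
  ext
  · simpa using e1
  · simpa [hp.ne'] using e2
  · simpa [hq.ne'] using e3
  · simpa [hp.ne', hq.ne'] using e4

theorem qinv_mul {p q : ℕ} {c : Bq p q} (h : Nrq c ≠ 0) : qinv c * c = 1 := by
  have : star c * c = algebraMap ℚ (Bq p q) (Nrq c) := by
    have e := nrq_eq c
    generalize Nrq c = r at e
    ext <;> simp <;> linarith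
  rw [qinv, smul_mul_assoc, this, Algebra.algebraMap_eq_smul_one, smul_smul, inv_mul_cancel₀ h,
    one_smul]

theorem mul_qinv {p q : ℕ} {c : Bq p q} (h : Nrq c ≠ 0) : c * qinv c = 1 := by
  have : c * star c = algebraMap ℚ (Bq p q) (Nrq c) := by
    have e := nrq_eq c
    generalize Nrq c = r at e
    ext <;> simp <;> linarith
  rw [qinv, mul_smul_comm, this, Algebra.algebraMap_eq_smul_one, smul_smul, inv_mul_cancel₀ h,
    one_smul]

theorem re_comm {p q : ℕ} (x y : Bq p q) : (x * y).re = (y * x).re := by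
  simp; ring

theorem nrq_mul {p q : ℕ} (x y : Bq p q) : Nrq (x * y) = Nrq x * Nrq y := by
  simp only [nrq_eq]; simp; ring

theorem trq_conj {p q : ℕ} {c : Bq p q} (h : Nrq c ≠ 0) (x : Bq p q) :
    Trq (c * x * qinv c) = Trq x := by
  rw [Trq, re_comm, ← mul_assoc, qinv_mul h, one_mul, Trq]

theorem nrq_conj {p q : ℕ} {c : Bq p q} (h : Nrq c ≠ 0) (x : Bq p q) :
    Nrq (c * x * qinv c) = Nrq x := by
  have h1 : Nrq c * Nrq (qinv c) = 1 := by
    rw [← nrq_mul, mul_qinv h]; simp [nrq_eq]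
  rw [nrq_mul, nrq_mul]
  linear_combination Nrq x * h1

def gmap {p q : ℕ} (x : Bq p q) : Bq p q := 2 * x - algebraMap ℚ (Bq p q) (Trq x)

theorem gmap_conj {p q : ℕ} {c : Bq p q} (h : Nrq c ≠ 0) (x : Bq p q) :
    gmap (c * x * qinv c) = c * gmap x * qinv c := by
  rw [gmap, gmap, trq_conj h, mul_sub, sub_mul, ← Algebra.commutes (Trq x) c, mul_assoc _ c,
    mul_qinv h, mul_one]
  simp only [two_mul, mul_add, add_mul]

theorem nrq_gmap {p q : ℕ} (x : Bq p q) : Nrq (gmap x) = 4 * Nrq x - Trq x ^ 2 := by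
  have : gmap x = x + x - algebraMap ℚ (Bq p q) (Trq x) := by rw [gmap, two_mul]
  rw [this]
  have e : Trq x = 2 * x.re := rfl
  generalize Trq x = r at e
  simp only [nrq_eq]; simp; rw [e]; ring

theorem integral_star {p q : ℕ} {x : Bq p q} (hx : IsIntegral ℤ x) : IsIntegral ℤ (star x) := by
  obtain ⟨f, hf, h⟩ := hx
  refine ⟨f, hf, ?_⟩
  have h' := congrArg star h
  rw [star_zero] at h'
  rw [← h', Polynomial.eval₂_eq_sum_range, Polynomial.eval₂_eq_sum_range, star_sum]
  refine Finset.sum_congr rfl fun i _ => ?_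
  simp [star_mul, star_pow, (Int.cast_commute _ _).eq]

theorem rat_int {p q : ℕ} {r : ℚ} (h : IsIntegral ℤ (algebraMap ℚ (Bq p q) r)) :
    ∃ n : ℤ, r = n := by
  rw [isIntegral_algebraMap_iff (FaithfulSMul.algebraMap_injective ℚ (Bq p q))] at h
  obtain ⟨n, hn⟩ := IsIntegrallyClosed.isIntegral_iff.1 h
  exact ⟨n, by simpa using hn.symm⟩

theorem comm_int {B : Type*} [Ring B] {x y : B} (hxy : x * y = y * x) (hx : IsIntegral ℤ x)
    (hy : IsIntegral ℤ y) : IsIntegral ℤ (x + y) ∧ IsIntegral ℤ (x * y) := by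
  have hc : ∀ a ∈ ({x, y} : Set B), ∀ b ∈ ({x, y} : Set B), a * b = b * a := by
    rintro a (rfl | rfl) b (rfl | rfl) <;> simp [hxy]
  let A := Algebra.adjoin ℤ ({x, y} : Set B)
  letI : CommRing A := Algebra.adjoinCommRingOfComm ℤ hc
  let x' : A := ⟨x, Algebra.subset_adjoin (by simp)⟩
  let y' : A := ⟨y, Algebra.subset_adjoin (by simp)⟩
  have hinj : Function.Injective A.val := Subtype.val_injective
  have hx' : IsIntegral ℤ x' := (isIntegral_algHom_iff A.val hinj).1 hx
  have hy' : IsIntegral ℤ y' := (isIntegral_algHom_iff A.val hinj).1 hy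
  exact ⟨(hx'.add hy').map A.val, (hx'.mul hy').map A.val⟩

theorem integ {p q : ℕ} {O : Subring (Bq p q)} (hO : IsOrder O) {x : Bq p q} (hx : x ∈ O) :
    (∃ n : ℤ, Trq x = n) ∧ ∃ n : ℤ, Nrq x = n := by
  obtain ⟨⟨b⟩, -⟩ := hO
  haveI : Module.Finite ℤ O := Module.Finite.of_basis b
  have h1 : IsIntegral ℤ (⟨x, hx⟩ : O) := IsIntegral.of_finite ℤ _
  have h2 : IsIntegral ℤ x := h1.map O.subtype.toIntAlgHom
  have hs : x + star x = algebraMap ℚ (Bq p q) (Trq x) := by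
    have e : Trq x = 2 * x.re := rfl
    generalize Trq x = r at e
    ext <;> simp <;> linarith
  have hm : x * star x = algebraMap ℚ (Bq p q) (Nrq x) := by
    have e := nrq_eq x
    generalize Nrq x = r at e
    ext <;> simp <;> linarith
  have hm' : star x * x = algebraMap ℚ (Bq p q) (Nrq x) := by
    have e := nrq_eq x
    generalize Nrq x = r at e
    ext <;> simp <;> linarith
  have h3 := comm_int (hm.trans hm'.symm) h2 (integral_star h2)
  rw [hs, hm] at h3
  exact ⟨rat_int h3.1, rat_int h3.2⟩

theorem mem_of {p q : ℕ} {O : Subring (Bq p q)} (hO : IsOrder O) {x y : Bq p q} (hy : y ∈ O)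
    (hx1 : ∃ n : ℤ, Trq x = n) (hx2 : ∃ n : ℤ, Nrq x = n) (h : gmap x = gmap y) : x ∈ O := by
  obtain ⟨⟨a, ha⟩, b, hb⟩ := integ hO hy
  obtain ⟨m, hm⟩ := hx1
  obtain ⟨n, hn⟩ := hx2
  have e := congrArg Nrq h
  rw [nrq_gmap, nrq_gmap, ha, hb, hm, hn] at e
  have e' : 4 * n - m ^ 2 = 4 * b - a ^ 2 := by exact_mod_cast e
  have hpar : Even (m - a) := by
    have : Even (m ^ 2 - a ^ 2) := ⟨2 * (n - b), by linarith⟩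
    simpa [Int.even_sub, Int.even_pow] using this
  obtain ⟨k, hk⟩ := hpar
  have hk' : (m : ℚ) - a = k + k := by exact_mod_cast hk
  have : x = y + (k : Bq p q) := by
    have h0 : x + x - algebraMap ℚ (Bq p q) (Trq x) = y + y - algebraMap ℚ (Bq p q) (Trq y) := by
      rw [← two_mul, ← two_mul]; exact h
    rw [ha, hm] at h0
    have h1 := congrArg QuaternionAlgebra.re h0
    have h2 := congrArg QuaternionAlgebra.imI h0
    have h3 := congrArg QuaternionAlgebra.imJ h0
    have h4 := congrArg QuaternionAlgebra.imK h0
    simp at h1 h2 h3 h4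
    ext <;> simp <;> linarith
  rw [this]
  exact add_mem hy (intCast_mem O k)

/-- Lemma Lem: orders are of the same type iff their Gross lattices are conjugate. -/
theorem same_type_iff_gross_conjugate (p q : ℕ) (hp : Nat.Prime p) (hodd : Odd p)
    (hq : Nat.Prime q) (hq8 : q % 8 = 3) (hqr : ∃ r : ℤ, (q : ℤ) ∣ r ^ 2 + p)
    (O O' : Subring (Bq p q)) (hO : IsOrder O) (hO' : IsOrder O') :
    SameType O O' ↔ ∃ c : Bq p q, c ≠ 0 ∧ conjSet c (GrossLat O) = GrossLat O' := by
  refine exists_congr fun c => and_congr_right fun hc => ?_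
  have h := nrq_ne hp.pos hq.pos hc
  constructor
  · intro e
    have e' : ∀ y, y ∈ O' ↔ ∃ x ∈ O, c * x * qinv c = y := fun y => by
      rw [← SetLike.mem_coe, ← e]; rfl
    ext t
    constructor
    · rintro ⟨_, ⟨x, hx, rfl⟩, rfl⟩
      exact ⟨_, (e' _).2 ⟨x, hx, rfl⟩, (gmap_conj h x).symm⟩
    · rintro ⟨y, hy, rfl⟩
      obtain ⟨x, hx, rfl⟩ := (e' _).1 hy
      exact ⟨gmap x, ⟨x, hx, rfl⟩, (gmap_conj h x).symm⟩
  · intro e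
    ext y
    constructor
    · rintro ⟨x, hx, rfl⟩
      have : c * gmap x * qinv c ∈ GrossLat O' := by
        rw [← e]; exact ⟨gmap x, ⟨x, hx, rfl⟩, rfl⟩
      obtain ⟨z, hz, hz'⟩ := this
      obtain ⟨h1, h2⟩ := integ hO hx
      refine mem_of hO' hz ?_ ?_ ((gmap_conj h x).trans hz')
      · simpa only [trq_conj h] using h1
      · simpa only [nrq_conj h] using h2
    · intro hy
      have : gmap y ∈ GrossLat O' := ⟨y, hy, rfl⟩
      rw [← e] at this
      obtain ⟨_, ⟨z, hz, rfl⟩, hz'⟩ := this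
      have hxy : c * (qinv c * y * c) * qinv c = y := by
        rw [mul_assoc, mul_assoc, mul_assoc, mul_qinv h, mul_one, ← mul_assoc, mul_qinv h, one_mul]
      refine ⟨qinv c * y * c, ?_, hxy⟩
      obtain ⟨h1, h2⟩ := integ hO' hy
      rw [← hxy] at h1 h2
      rw [trq_conj h] at h1
      rw [nrq_conj h] at h2
      refine mem_of hO hz h1 h2 ?_
      have h3 : c * gmap (qinv c * y * c) * qinv c = c * gmap z * qinv c := by
        rw [← gmap_conj h, hxy]; exact hz'.symm
      have h4 := congrArg (fun t => qinv c * t * c) h3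
      have h5 : ∀ t, qinv c * (c * t * qinv c) * c = t := fun t => by
        rw [mul_assoc, mul_assoc, mul_assoc, qinv_mul h, mul_one, ← mul_assoc, qinv_mul h, one_mul]
      simpa only [h5] using h4
end

section
/- Let O and O′ be maximal orders of B_p with successive minima D₁ ≤ D₂ ≤ D₃ of O^T and D₁′ ≤ D₂′ ≤ D₃′ of O′^T. Assume D₂′ ≤ D₂, that D₁ and D₂ are both represented optimally by O′^T, and that D₁·D₂ < (16/3)·p and 8 ≤ D₁. Then D₁ = D₁′. -/
open scoped Quaternion

open GrossPaper

namespace GrossPaper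

variable {p q : ℕ}

lemma Nrq_eq (x : Bq p q) : Nrq x = x.re^2 + p * x.imI^2 + q * x.imJ^2 + p*q*x.imK^2 := by
  simp [Nrq]; ring

lemma Nrq_mul (x y : Bq p q) : Nrq (x*y) = Nrq x * Nrq y := by
  simp only [Nrq_eq]; simp; ring

lemma Nrq_pow (x : Bq p q) (n : ℕ) : Nrq (x^n) = Nrq x ^ n := by
  induction n with
  | zero => simp [Nrq_eq]
  | succ n ih => rw [pow_succ, Nrq_mul, ih, pow_succ]

/-- integrality of a rational -/
def IsI (r : ℚ) : Prop := ∃ n : ℤ, r = n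

lemma IsI.add {a b : ℚ} (ha : IsI a) (hb : IsI b) : IsI (a+b) := by
  obtain ⟨m, rfl⟩ := ha; obtain ⟨n, rfl⟩ := hb; exact ⟨m+n, by push_cast; rfl⟩
lemma IsI.sub {a b : ℚ} (ha : IsI a) (hb : IsI b) : IsI (a-b) := by
  obtain ⟨m, rfl⟩ := ha; obtain ⟨n, rfl⟩ := hb; exact ⟨m-n, by push_cast; rfl⟩
lemma IsI.mul {a b : ℚ} (ha : IsI a) (hb : IsI b) : IsI (a*b) := by
  obtain ⟨m, rfl⟩ := ha; obtain ⟨n, rfl⟩ := hb; exact ⟨m*n, by push_cast; rfl⟩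
lemma IsI.pow {a : ℚ} (ha : IsI a) (k : ℕ) : IsI (a^k) := by
  obtain ⟨m, rfl⟩ := ha; exact ⟨m^k, by push_cast; rfl⟩
lemma IsI.int (n : ℤ) : IsI n := ⟨n, rfl⟩
lemma IsI.nat (n : ℕ) : IsI n := ⟨n, by simp⟩

lemma isI_of_pow (M : ℤ) (hM : M ≠ 0) (r : ℚ) (h : ∀ n : ℕ, IsI (M * r^n)) : IsI r := by
  have hd : ∀ n : ℕ, ((r.den:ℤ)^n) ∣ M := by
    intro n
    obtain ⟨k, hk⟩ := h n
    have hden : (r.den : ℚ) ≠ 0 := by exact_mod_cast r.den_nz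
    have h1 : M * r.num^n = k * (r.den:ℤ)^n := by
      have : (M:ℚ) * (r.num:ℚ)^n = k * (r.den:ℚ)^n := by
        rw [← hk]
        conv_rhs => rw [← Rat.num_div_den r]
        rw [div_pow]
        simp only [Rat.num_div_den]
        field_simp
      exact_mod_cast this
    have hc : IsCoprime ((r.den:ℤ)^n) (r.num^n) := by
      apply IsCoprime.pow
      rw [Int.isCoprime_iff_gcd_eq_one]
      have := r.reduced
      rw [Int.gcd_comm]; simpa [Int.gcd] using this
    exact hc.dvd_of_dvd_mul_right ⟨k, by rw [h1]; ring⟩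
  have h1 : r.den = 1 := by
    by_contra hne
    have h2 : 2 ≤ r.den := by have := r.den_pos; omega
    have h3 := Int.natAbs_dvd_natAbs.2 (hd M.natAbs)
    have h4 := Nat.le_of_dvd (Int.natAbs_pos.2 hM) h3
    rw [Int.natAbs_pow, Int.natAbs_natCast] at h4
    have h5 : M.natAbs < 2 ^ M.natAbs := Nat.lt_two_pow_self
    have h6 := Nat.pow_le_pow_left h2 M.natAbs
    omega
  exact ⟨r.num, by rw [eq_comm]; exact Rat.coe_int_num_of_den_eq_one h1⟩

lemma exists_den4 (a b c d : ℚ) : ∃ M : ℕ, 0 < M ∧ IsI (M*a) ∧ IsI (M*b) ∧ IsI (M*c) ∧ IsI (M*d) := by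
  have key : ∀ r : ℚ, IsI (r.den * r) := fun r => ⟨r.num, by
    rw [mul_comm]; exact Rat.mul_den_eq_num r⟩
  refine ⟨a.den*b.den*c.den*d.den, ?_, ?_, ?_, ?_, ?_⟩
  · have := a.den_pos; have := b.den_pos; have := c.den_pos; have := d.den_pos
    positivity
  · have := ((IsI.nat b.den).mul (IsI.nat c.den)).mul ((IsI.nat d.den).mul (key a))
    convert this using 1; push_cast; ring
  · have := ((IsI.nat a.den).mul (IsI.nat c.den)).mul ((IsI.nat d.den).mul (key b))
    convert this using 1; push_cast; ring
  · have := ((IsI.nat a.den).mul (IsI.nat b.den)).mul ((IsI.nat d.den).mul (key c))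
    convert this using 1; push_cast; ring
  · have := ((IsI.nat a.den).mul (IsI.nat b.den)).mul ((IsI.nat c.den).mul (key d))
    convert this using 1; push_cast; ring

/-- the coordinates of `M x` are integers -/
def CI (M : ℤ) (x : Bq p q) : Prop :=
  IsI (M*x.re) ∧ IsI (M*x.imI) ∧ IsI (M*x.imJ) ∧ IsI (M*x.imK)

lemma CI.smul {M : ℤ} {x : Bq p q} (h : CI M x) (N : ℤ) : CI (M*N) x := by
  obtain ⟨a, b, c, d⟩ := h
  refine ⟨?_, ?_, ?_, ?_⟩
  · convert (IsI.int N).mul a using 1; push_cast; ring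
  · convert (IsI.int N).mul b using 1; push_cast; ring
  · convert (IsI.int N).mul c using 1; push_cast; ring
  · convert (IsI.int N).mul d using 1; push_cast; ring

lemma CI.add {M : ℤ} {x y : Bq p q} (h : CI M x) (h' : CI M y) : CI M (x+y) := by
  obtain ⟨a, b, c, d⟩ := h
  obtain ⟨a', b', c', d'⟩ := h'
  refine ⟨?_, ?_, ?_, ?_⟩ <;> simp only [QuaternionAlgebra.re_add, QuaternionAlgebra.imI_add, QuaternionAlgebra.imJ_add, QuaternionAlgebra.imK_add, mul_add]
  exacts [a.add a', b.add b', c.add c', d.add d']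

lemma CI.zs {M : ℤ} {x : Bq p q} (h : CI M x) (n : ℤ) : CI M (n • x) := by
  obtain ⟨a, b, c, d⟩ := h
  refine ⟨?_, ?_, ?_, ?_⟩ <;> simp [mul_left_comm _ (n:ℚ)]
  exacts [(IsI.int n).mul a, (IsI.int n).mul b, (IsI.int n).mul c, (IsI.int n).mul d]

lemma order_den {O : Subring (Bq p q)} (h : IsOrder O) : ∃ M : ℤ, M ≠ 0 ∧ ∀ x ∈ O, CI M x := by
  obtain ⟨⟨e⟩, -⟩ := h
  have h1 : ∀ i, ∃ M : ℤ, M ≠ 0 ∧ CI M (e i : Bq p q) := by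
    intro i
    obtain ⟨M, h0, h⟩ := exists_den4 (e i : Bq p q).re (e i : Bq p q).imI (e i : Bq p q).imJ (e i : Bq p q).imK
    exact ⟨M, by exact_mod_cast h0.ne', by simpa [CI] using h⟩
  choose M hM hC using h1
  refine ⟨∏ i, M i, Finset.prod_ne_zero_iff.2 fun i _ => hM i, fun x hx => ?_⟩
  have hC' : ∀ i, CI (∏ i, M i) (e i : Bq p q) := by
    intro i
    rw [← Finset.mul_prod_erase Finset.univ M (Finset.mem_univ i)]
    exact (hC i).smul _
  have hs := e.sum_repr ⟨x, hx⟩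
  have hs' : x = ∑ i, (e.repr ⟨x, hx⟩ i) • (e i : Bq p q) := by
    have := congrArg (fun z : O => (z : Bq p q)) hs
    simp only [] at this
    refine this.symm.trans ?_
    simp
  rw [hs']
  simp only [Fin.sum_univ_four]
  exact ((((hC' 0).zs _).add ((hC' 1).zs _)).add ((hC' 2).zs _)).add ((hC' 3).zs _)

lemma order_Nr {O : Subring (Bq p q)} (h : IsOrder O) {x : Bq p q} (hx : x ∈ O) : IsI (Nrq x) := by
  obtain ⟨M, h0, hM⟩ := order_den h
  refine isI_of_pow (M^2) (pow_ne_zero 2 h0) _ fun n => ?_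
  rw [← Nrq_pow]
  obtain ⟨a, b, c, d⟩ := hM _ (O.pow_mem hx n)
  rw [Nrq_eq]
  convert (((a.pow 2).add ((IsI.nat p).mul (b.pow 2))).add ((IsI.nat q).mul (c.pow 2))).add (((IsI.nat p).mul (IsI.nat q)).mul (d.pow 2)) using 1
  push_cast; ring

lemma order_Tr {O : Subring (Bq p q)} (h : IsOrder O) {x : Bq p q} (hx : x ∈ O) : IsI (2 * x.re) := by
  have h1 := order_Nr h (O.add_mem O.one_mem hx)
  have h2 := order_Nr h hx
  convert (h1.sub h2).sub (IsI.int 1) using 1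
  simp [Nrq_eq]; ring

lemma dvd_both (hp : p.Prime) (e : ℤ) (he : ¬ IsSquare (-(e : ZMod p))) (A C : ℤ)
    (h : (p:ℤ) ∣ A^2 + e * C^2) : (p:ℤ) ∣ A ∧ (p:ℤ) ∣ C := by
  have : Fact p.Prime := ⟨hp⟩
  rw [← ZMod.intCast_zmod_eq_zero_iff_dvd] at h
  push_cast at h
  have hC : (C : ZMod p) = 0 := by
    by_contra hC
    apply he
    refine ⟨A / C, ?_⟩
    field_simp
    linear_combination -h
  rw [hC] at h
  have hA : (A : ZMod p) = 0 := by simpa using h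
  exact ⟨(ZMod.intCast_zmod_eq_zero_iff_dvd _ _).1 hA, (ZMod.intCast_zmod_eq_zero_iff_dvd _ _).1 hC⟩

lemma p_integral (hp : p.Prime) (e : ℤ) (he : ¬ IsSquare (-(e : ZMod p))) (a c b d : ℚ)
    (h : IsI (a^2 + e * c^2 + p * (b^2 + e * d^2))) :
    ∃ s : ℤ, ¬ (p:ℤ) ∣ s ∧ IsI (s*b) ∧ IsI (s*c) ∧ IsI (s*d) := by
  classical
  have hex := exists_den4 a b c d
  let M := Nat.find hex
  obtain ⟨hM0, ⟨A, hA⟩, ⟨B, hB⟩, ⟨C, hC⟩, ⟨D, hD⟩⟩ := Nat.find_spec hex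
  change 0 < M at hM0
  change (M:ℚ) * _ = _ at hA hB hC hD
  refine ⟨M, ?_, ⟨B, by simpa using hB⟩, ⟨C, by simpa using hC⟩, ⟨D, by simpa using hD⟩⟩
  intro hdvd
  obtain ⟨m, hm⟩ := Int.natCast_dvd_natCast.1 hdvd
  obtain ⟨n, hn⟩ := h
  have heq : A^2 + e * C^2 + p * (B^2 + e * D^2) = (p*m)^2 * n := by
    have hm' : (M:ℚ) = p * m := by rw [hm]; push_cast; rfl
    have : (A:ℚ)^2 + e * C^2 + p * (B^2 + e * D^2) = (p*m)^2 * n := by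
      rw [← hA, ← hB, ← hC, ← hD, ← hn, ← hm']; ring
    exact_mod_cast this
  have hp0 : (p:ℤ) ≠ 0 := by exact_mod_cast hp.ne_zero
  obtain ⟨⟨A', hA'⟩, ⟨C', hC'⟩⟩ := dvd_both hp e he A C
    ⟨p*m^2*n - (B^2 + e * D^2), by linear_combination heq⟩
  obtain ⟨⟨B', hB'⟩, ⟨D', hD'⟩⟩ := dvd_both hp e he B D
    ⟨m^2*n - (A'^2 + e * C'^2), by
      apply mul_left_cancel₀ hp0
      rw [hA', hC'] at heq
      linear_combination heq⟩
  have hpq : (p:ℚ) ≠ 0 := by exact_mod_cast hp.ne_zero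
  have hmM : m < M := by
    rw [hm]
    have : 0 < m := by
      rcases Nat.eq_zero_or_pos m with h | h
      · rw [hm, h] at hM0; simp at hM0
      · exact h
    nlinarith [hp.two_le]
  refine Nat.find_min hex hmM ⟨?_, ⟨A', ?_⟩, ⟨B', ?_⟩, ⟨C', ?_⟩, ⟨D', ?_⟩⟩
  · rcases Nat.eq_zero_or_pos m with h | h
    · rw [hm, h] at hM0; simp at hM0
    · exact h
  all_goals apply mul_left_cancel₀ hpq
  · rw [hA', hm] at hA; push_cast at hA; linarith
  · rw [hB', hm] at hB; push_cast at hB; linarith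
  · rw [hC', hm] at hC; push_cast at hC; linarith
  · rw [hD', hm] at hD; push_cast at hD; linarith

lemma nonsq (hp : p.Prime) (hodd : Odd p) (hq : q.Prime) (hq8 : q % 8 = 3)
    (hqr : ∃ r : ℤ, (q : ℤ) ∣ r ^ 2 + p) (hne : p ≠ q) : ¬ IsSquare (-(((q:ℤ)) : ZMod p)) := by
  have : Fact p.Prime := ⟨hp⟩
  have : Fact q.Prime := ⟨hq⟩
  have hq4 : q % 4 = 3 := by omega
  have hp2 : p ≠ 2 := by rintro rfl; exact absurd hodd (by decide)
  have hq2 : q ≠ 2 := by omega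
  obtain ⟨r, hr⟩ := hqr
  rw [← ZMod.intCast_zmod_eq_zero_iff_dvd] at hr
  push_cast at hr
  have hs : IsSquare (-(p : ZMod q)) := ⟨r, by linear_combination -hr⟩
  have hm1 : ¬ IsSquare (-1 : ZMod q) := by
    rw [ZMod.exists_sq_eq_neg_one_iff]; omega
  push_cast
  intro hc
  have h4 : p % 4 = 1 ∨ p % 4 = 3 := by
    have := Nat.odd_iff.1 hodd; omega
  rcases h4 with h4 | h4
  · have h1 : IsSquare (-1 : ZMod p) := by
      rw [ZMod.exists_sq_eq_neg_one_iff]; omega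
    have h2 : IsSquare (q : ZMod p) := by simpa using h1.mul hc
    rw [ZMod.exists_sq_eq_prime_iff_of_mod_four_eq_one h4 hq2] at h2
    have h0 : (p : ZMod q) ≠ 0 := by
      intro h
      rw [ZMod.natCast_eq_zero_iff] at h
      exact hne ((Nat.prime_dvd_prime_iff_eq hq hp).1 h).symm
    apply hm1
    have := hs.div h2
    rwa [neg_div, div_self h0] at this
  · have h2 : IsSquare (q : ZMod p) := by
      rw [ZMod.exists_sq_eq_prime_iff_of_mod_four_eq_three h4 hq4 hne]
      intro h
      have h0 : (p : ZMod q) ≠ 0 := by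
        intro h
        rw [ZMod.natCast_eq_zero_iff] at h
        exact hne ((Nat.prime_dvd_prime_iff_eq hq hp).1 h).symm
      apply hm1
      have := hs.div h
      rwa [neg_div, div_self h0] at this
    have h0 : (q : ZMod p) ≠ 0 := by
      intro h
      rw [ZMod.natCast_eq_zero_iff] at h
      exact hne ((Nat.prime_dvd_prime_iff_eq hp hq).1 h)
    have h1 : IsSquare (-1 : ZMod p) := by
      have := hc.div h2
      rwa [neg_div, div_self h0] at this
    rw [ZMod.exists_sq_eq_neg_one_iff] at h1
    exact h1 h4

/-- unified local integrality -/
lemma loc_int (hp : p.Prime) (hodd : Odd p) (hq : q.Prime) (hq8 : q % 8 = 3)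
    (hqr : ∃ r : ℤ, (q : ℤ) ∣ r ^ 2 + p) (x : Bq p q) (h : IsI (Nrq x)) :
    ∃ s : ℤ, ¬ (p:ℤ) ∣ s ∧ IsI (s*x.imI) ∧ IsI (s*x.imJ) ∧ IsI (s*(q*x.imK)) := by
  have : Fact p.Prime := ⟨hp⟩
  by_cases hne : p = q
  · have he : ¬ IsSquare (-((1:ℤ) : ZMod p)) := by
      push_cast
      rw [ZMod.exists_sq_eq_neg_one_iff]; omega
    obtain ⟨s, hs, h1, h2, h3⟩ := p_integral hp 1 he x.re (q*x.imK) x.imI x.imJ (by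
      have hne' : (q:ℚ) = p := by exact_mod_cast hne.symm
      convert h using 1; rw [Nrq_eq]; push_cast
      linear_combination (q * x.imK^2 - x.imJ^2) * hne')
    exact ⟨s, hs, h1, h3, h2⟩
  · obtain ⟨s, hs, h1, h2, h3⟩ := p_integral hp q (nonsq hp hodd hq hq8 hqr hne) x.re x.imJ x.imI x.imK (by
      convert h using 1; rw [Nrq_eq]; push_cast; ring)
    refine ⟨s, hs, h1, h2, ?_⟩
    convert (IsI.nat q).mul h3 using 1; ring


lemma dvd_of_smul (hp : p.Prime) {s K n : ℤ} (hs : ¬ (p:ℤ) ∣ s) (h : s * K = p * n) : (p:ℤ) ∣ K :=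
  ((Nat.prime_iff_prime_int.1 hp).dvd_or_dvd ⟨n, h⟩).resolve_left hs

lemma nd_mul (hp : p.Prime) {s t : ℤ} (hs : ¬ (p:ℤ) ∣ s) (ht : ¬ (p:ℤ) ∣ t) : ¬ (p:ℤ) ∣ s * t :=
  fun h => ((Nat.prime_iff_prime_int.1 hp).dvd_or_dvd h).elim hs ht

lemma comm_dvd (hp : p.Prime) (hodd : Odd p) (hq : q.Prime) (hq8 : q % 8 = 3)
    (hqr : ∃ r : ℤ, (q : ℤ) ∣ r ^ 2 + p) {O : Subring (Bq p q)} (hO : IsOrder O)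
    {x y : Bq p q} (hx : x ∈ O) (hy : y ∈ O) : ∃ n : ℤ, Nrq (x*y-y*x) = p * n := by
  obtain ⟨K, hK⟩ := order_Nr hO (O.sub_mem (O.mul_mem hx hy) (O.mul_mem hy hx))
  obtain ⟨s, hs, ⟨b, hb⟩, ⟨c, hc⟩, ⟨d, hd⟩⟩ := loc_int hp hodd hq hq8 hqr x (order_Nr hO hx)
  obtain ⟨s', hs', ⟨b', hb'⟩, ⟨c', hc'⟩, ⟨d', hd'⟩⟩ := loc_int hp hodd hq hq8 hqr y (order_Nr hO hy)
  have e1 : (K:ℚ) = 4 * (p * (x.imJ * (q*y.imK) - (q*x.imK)*y.imJ)^2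
      + q * p^2 * (x.imK * y.imI - x.imI * y.imK)^2 + p * q * (x.imI * y.imJ - x.imJ * y.imI)^2) := by
    rw [← hK, Nrq_eq]; simp; ring
  have hss := nd_mul hp hs hs'
  have hss2 := nd_mul hp hss hss
  suffices h : (p:ℤ) ∣ K by
    obtain ⟨n, hn⟩ := h
    exact ⟨n, by rw [hK, hn]; push_cast; rfl⟩
  by_cases hne : p = q
  · apply dvd_of_smul hp hss2 (n := 4 * ((c*d'-d*c')^2 + (d*b'-b*d')^2 + q*(b*c'-c*b')^2))
    have : ((s*s'*(s*s')):ℚ) * K = p * (4 * ((c*d'-d*c')^2 + (d*b'-b*d')^2 + q*(b*c'-c*b')^2)) := by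
      have hne' : (q:ℚ) = p := by exact_mod_cast hne.symm
      rw [e1, ← hb, ← hc, ← hd, ← hb', ← hc', ← hd']
      linear_combination (-4 * s^2 * s'^2 * p * q * (x.imK * y.imI - x.imI * y.imK)^2) * hne'
    exact_mod_cast this
  · have hq' : ¬ (p:ℤ) ∣ q := fun h =>
      hne ((Nat.prime_dvd_prime_iff_eq hp hq).1 (Int.natCast_dvd_natCast.1 h))
    apply dvd_of_smul hp (nd_mul hp hss2 hq') (n := 4 * (q * (c*d'-d*c')^2 + p * (d*b'-b*d')^2 + q^2*(b*c'-c*b')^2))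
    have : ((s*s'*(s*s')):ℚ) * q * K = p * (4 * (q*(c*d'-d*c')^2 + p*(d*b'-b*d')^2 + q^2*(b*c'-c*b')^2)) := by
      rw [e1, ← hb, ← hc, ← hd, ← hb', ← hc', ← hd']; ring
    exact_mod_cast this

/-- determinant of imaginary coordinates -/
def det3 (x y z : Bq p q) : ℚ :=
  x.imI * (y.imJ * z.imK - y.imK * z.imJ) - x.imJ * (y.imI * z.imK - y.imK * z.imI)
    + x.imK * (y.imI * z.imJ - y.imJ * z.imI)

lemma det_dvd (hp : p.Prime) (hodd : Odd p) (hq : q.Prime) (hq8 : q % 8 = 3)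
    (hqr : ∃ r : ℤ, (q : ℤ) ∣ r ^ 2 + p) {O : Subring (Bq p q)} (hO : IsOrder O)
    {x y z : Bq p q} (hx : x ∈ O) (hy : y ∈ O) (hz : z ∈ O) :
    ∃ n : ℤ, 4 * (p * q * det3 x y z) = p * n := by
  obtain ⟨K, hK⟩ := order_Tr hO (O.mul_mem (O.sub_mem (O.mul_mem hy hx) (O.mul_mem hx hy)) hz)
  obtain ⟨s, hs, ⟨b, hb⟩, ⟨c, hc⟩, ⟨d, hd⟩⟩ := loc_int hp hodd hq hq8 hqr x (order_Nr hO hx)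
  obtain ⟨s', hs', ⟨b', hb'⟩, ⟨c', hc'⟩, ⟨d', hd'⟩⟩ := loc_int hp hodd hq hq8 hqr y (order_Nr hO hy)
  obtain ⟨s'', hs'', ⟨b'', hb''⟩, ⟨c'', hc''⟩, ⟨d'', hd''⟩⟩ :=
    loc_int hp hodd hq hq8 hqr z (order_Nr hO hz)
  have e1 : (K:ℚ) = 4 * (p * q * det3 x y z) := by
    rw [← hK, det3]; simp; ring
  suffices h : (p:ℤ) ∣ K by
    obtain ⟨n, hn⟩ := h
    exact ⟨n, by rw [← e1, hn]; push_cast; rfl⟩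
  apply dvd_of_smul hp (nd_mul hp (nd_mul hp hs hs') hs'')
    (n := 4 * (b * (c'*d''-d'*c'') - c * (b' * d'' - d' * b'') + d * (b' * c'' - c' * b'')))
  have : ((s*s'*s''):ℚ) * K = p * (4 * (b * (c'*d''-d'*c'') - c * (b' * d'' - d' * b'') + d * (b' * c'' - c' * b''))) := by
    rw [e1, det3, ← hb, ← hc, ← hd, ← hb', ← hc', ← hd', ← hb'', ← hc'', ← hd'']; ring
  exact_mod_cast this

/-- inner product on pure quaternions -/
def ip (u v : Bq p q) : ℚ := p * u.imI * v.imI + q * u.imJ * v.imJ + p * q * u.imK * v.imK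

lemma ip_add_left (u v w : Bq p q) : ip (u+v) w = ip u w + ip v w := by simp [ip]; ring
lemma ip_smul_left (r : ℚ) (u w : Bq p q) : ip (r • u) w = r * ip u w := by simp [ip]; ring
lemma ip_comm (u w : Bq p q) : ip u w = ip w u := by simp [ip]; ring
lemma ip_add_right (u v w : Bq p q) : ip w (u+v) = ip w u + ip w v := by simp [ip]; ring
lemma ip_smul_right (r : ℚ) (u w : Bq p q) : ip w (r • u) = r * ip w u := by simp [ip]; ring
lemma Nrq_ip {u : Bq p q} (h : u.re = 0) : Nrq u = ip u u := by rw [Nrq_eq, ip, h]; ring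

lemma Nrq_pos (hp : p.Prime) (hq : q.Prime) {u : Bq p q} (h : u ≠ 0) : 0 < Nrq u := by
  have hp' : (0:ℚ) < p := by exact_mod_cast hp.pos
  have hq' : (0:ℚ) < q := by exact_mod_cast hq.pos
  rw [Nrq_eq]
  have : u.re ≠ 0 ∨ u.imI ≠ 0 ∨ u.imJ ≠ 0 ∨ u.imK ≠ 0 := by
    by_contra hc
    push Not at hc
    exact h (QuaternionAlgebra.ext hc.1 hc.2.1 hc.2.2.1 hc.2.2.2)
  rcases this with h | h | h | h <;> positivity

/-- Gram determinant -/
def gd (u v : Bq p q) : ℚ := ip u u * ip v v - ip u v ^ 2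

lemma gd_eq_zero (hp : p.Prime) (hq : q.Prime) {u v : Bq p q} (hu : u.re = 0) (hv : v.re = 0)
    (h0 : u ≠ 0) (h : gd u v = 0) : ∃ r : ℚ, v = r • u := by
  have hN := Nrq_pos hp hq h0
  rw [Nrq_ip hu] at hN
  refine ⟨ip u v / ip u u, ?_⟩
  by_contra hne
  have hp2 := Nrq_pos hp hq (sub_ne_zero.2 hne)
  have hre : (v - (ip u v / ip u u) • u).re = 0 := by simp [hu, hv]
  rw [Nrq_ip hre] at hp2
  have : ip (v - (ip u v / ip u u) • u) (v - (ip u v / ip u u) • u) = gd u v / ip u u := by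
    have e : v - (ip u v / ip u u) • u = v + (-(ip u v / ip u u)) • u := by
      rw [neg_smul, sub_eq_add_neg]
    rw [e, ip_add_left, ip_add_right, ip_add_right, ip_smul_left, ip_smul_left, ip_smul_right, ip_smul_right, gd, ip_comm v u]
    field_simp
    ring
  rw [this, h] at hp2
  simp at hp2

lemma li_of_gd {u v : Bq p q} (h : gd u v ≠ 0) : LinearIndependent ℚ ![u, v] := by
  rw [LinearIndependent.pair_iff]
  intro s t hst
  have h1 : s * ip u u + t * ip u v = 0 := by
    have : ip u (s • u + t • v) = 0 := by rw [hst]; simp [ip]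
    rwa [ip_add_right, ip_smul_right, ip_smul_right] at this
  have h2 : s * ip u v + t * ip v v = 0 := by
    have : ip v (s • u + t • v) = 0 := by rw [hst]; simp [ip]
    rwa [ip_add_right, ip_smul_right, ip_smul_right, ip_comm v u] at this
  constructor
  · have : s * gd u v = 0 := by rw [gd]; linear_combination ip v v * h1 - ip u v * h2
    exact (mul_eq_zero.1 this).resolve_right h
  · have : t * gd u v = 0 := by rw [gd]; linear_combination ip u u * h2 - ip u v * h1
    exact (mul_eq_zero.1 this).resolve_right h

lemma gd_of_li (hp : p.Prime) (hq : q.Prime) {u v : Bq p q} (hu : u.re = 0) (hv : v.re = 0)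
    (h : LinearIndependent ℚ ![u, v]) : gd u v ≠ 0 := by
  intro h0
  have hu0 : u ≠ 0 := h.ne_zero 0
  obtain ⟨r, rfl⟩ := gd_eq_zero hp hq hu hv hu0 h0
  rw [LinearIndependent.pair_iff] at h
  have := (h (-r) 1 (by simp)).2
  simp at this

section GLat
variable {O : Subring (Bq p q)}

lemma gl_re {t : Bq p q} (ht : t ∈ GrossLat O) : t.re = 0 := by
  obtain ⟨x, hx, rfl⟩ := ht
  simp [Trq, two_mul]

lemma gl_spec {t : Bq p q} (ht : t ∈ GrossLat O) :
    ∃ x ∈ O, t.re = 0 ∧ t.imI = 2 * x.imI ∧ t.imJ = 2 * x.imJ ∧ t.imK = 2 * x.imK := by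
  have := gl_re ht
  obtain ⟨x, hx, rfl⟩ := ht
  exact ⟨x, hx, this, by simp [two_mul], by simp [two_mul], by simp [two_mul]⟩

lemma gl_add {t u : Bq p q} (ht : t ∈ GrossLat O) (hu : u ∈ GrossLat O) : t + u ∈ GrossLat O := by
  obtain ⟨x, hx, rfl⟩ := ht
  obtain ⟨y, hy, rfl⟩ := hu
  refine ⟨x+y, O.add_mem hx hy, ?_⟩
  have : Trq (x+y) = Trq x + Trq y := by simp [Trq, mul_add]
  rw [this, map_add, mul_add]; abel

lemma gl_zsmul {t : Bq p q} (n : ℤ) (ht : t ∈ GrossLat O) : n • t ∈ GrossLat O := by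
  obtain ⟨x, hx, rfl⟩ := ht
  refine ⟨n • x, O.zsmul_mem hx n, ?_⟩
  have : Trq (n • x) = n • Trq x := by simp [Trq]; ring
  rw [this, map_zsmul, smul_sub, mul_smul_comm]

lemma gl_ip_int (hO : IsOrder O) {t u : Bq p q} (ht : t ∈ GrossLat O) (hu : u ∈ GrossLat O) :
    IsI (ip t u) := by
  obtain ⟨x, hx, h0, h1, h2, h3⟩ := gl_spec ht
  obtain ⟨y, hy, h0', h1', h2', h3'⟩ := gl_spec hu
  have a := order_Tr hO hx
  have b := order_Tr hO hy
  have c := order_Tr hO (O.mul_mem hx hy)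
  convert (a.mul b).sub ((IsI.int 2).mul c) using 1
  rw [ip, h1, h2, h3, h1', h2', h3']
  simp; ring

lemma gl_gd (hp : p.Prime) (hodd : Odd p) (hq : q.Prime) (hq8 : q % 8 = 3)
    (hqr : ∃ r : ℤ, (q : ℤ) ∣ r ^ 2 + p) (hO : IsOrder O) {t u : Bq p q} (ht : t ∈ GrossLat O)
    (hu : u ∈ GrossLat O) : ∃ n : ℤ, gd t u = 4 * p * n := by
  obtain ⟨x, hx, h0, h1, h2, h3⟩ := gl_spec ht
  obtain ⟨y, hy, h0', h1', h2', h3'⟩ := gl_spec hu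
  obtain ⟨n, hn⟩ := comm_dvd hp hodd hq hq8 hqr hO hx hy
  refine ⟨n, ?_⟩
  rw [mul_assoc, ← hn, gd, ip, ip, ip, h1, h2, h3, h1', h2', h3', Nrq_eq]
  simp; ring

lemma gl_det (hp : p.Prime) (hodd : Odd p) (hq : q.Prime) (hq8 : q % 8 = 3)
    (hqr : ∃ r : ℤ, (q : ℤ) ∣ r ^ 2 + p) (hO : IsOrder O) {t u w : Bq p q} (ht : t ∈ GrossLat O)
    (hu : u ∈ GrossLat O) (hw : w ∈ GrossLat O) : ∃ n : ℤ, p * q * det3 t u w = 2 * p * n := by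
  obtain ⟨x, hx, h0, h1, h2, h3⟩ := gl_spec ht
  obtain ⟨y, hy, h0', h1', h2', h3'⟩ := gl_spec hu
  obtain ⟨z, hz, h0'', h1'', h2'', h3''⟩ := gl_spec hw
  obtain ⟨n, hn⟩ := det_dvd hp hodd hq hq8 hqr hO hx hy hz
  refine ⟨n, ?_⟩
  rw [mul_assoc 2, ← hn, det3, det3, h1, h2, h3, h1', h2', h3', h1'', h2'', h3'']
  ring

end GLat

lemma det_sq_le (hp : p.Prime) (hq : q.Prime) (u v w : Bq p q) :
    (p * q * det3 u v w)^2 ≤ gd u v * ip w w := by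
  have hp' : (0:ℚ) < p := by exact_mod_cast hp.pos
  have hq' : (0:ℚ) < q := by exact_mod_cast hq.pos
  -- the cross product
  let X : Bq p q := ⟨0, q * (u.imJ * v.imK - u.imK * v.imJ), p * (u.imK * v.imI - u.imI * v.imK),
    u.imI * v.imJ - u.imJ * v.imI⟩
  have h1 : ip X w = p * q * det3 u v w := by simp [X, ip, det3]; ring
  have h2 : ip X X = gd u v := by simp [X, ip, gd]; ring
  rw [← h1, ← h2]
  have : 0 ≤ ip X X * ip w w - ip X w ^ 2 := by
    have : ip X X * ip w w - ip X w ^ 2 = p * q * (X.imI * w.imJ - X.imJ * w.imI)^2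
      + p * p * q * (X.imI * w.imK - X.imK * w.imI)^2 + q * p * q * (X.imJ * w.imK - X.imK * w.imJ)^2 := by
      simp only [ip]; ring
    rw [this]; positivity
  linarith

lemma det_zero (hp : p.Prime) (hq : q.Prime) {u v w : Bq p q} (hu : u.re = 0) (hv : v.re = 0)
    (hw : w.re = 0) (hg : gd u v ≠ 0)
    (h : (p:ℚ) * q * det3 u v w = 0) : ∃ a b : ℚ, w = a • u + b • v := by
  have hp' : (0:ℚ) < p := by exact_mod_cast hp.pos
  have hq' : (0:ℚ) < q := by exact_mod_cast hq.pos
  refine ⟨(ip v v * ip u w - ip u v * ip v w) / gd u v, (ip u u * ip v w - ip u v * ip u w) / gd u v, ?_⟩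
  have hd : det3 u v w = 0 := by
    have : (p:ℚ)*q ≠ 0 := by positivity
    exact (mul_eq_zero.1 h).resolve_left this
  rw [det3] at hd
  have key : gd u v • w = (ip v v * ip u w - ip u v * ip v w) • u + (ip u u * ip v w - ip u v * ip u w) • v := by
    ext
    · simp [hu, hv, hw]
    · simp [gd, ip]
      linear_combination (p * q * q * (u.imJ * v.imK - u.imK * v.imJ)) * hd
    · simp [gd, ip]
      linear_combination (p * p * q * (u.imK * v.imI - u.imI * v.imK)) * hd
    · simp [gd, ip]
      linear_combination (p * q * (u.imI * v.imJ - u.imJ * v.imI)) * hd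
  have : w = (gd u v)⁻¹ • (gd u v • w) := by rw [smul_smul, inv_mul_cancel₀ hg, one_smul]
  rw [key, smul_add, smul_smul, smul_smul] at this
  rw [div_eq_inv_mul, div_eq_inv_mul]
  exact this

lemma gd_nonneg (u v : Bq p q) : 0 ≤ gd u v := by
  have : gd u v = p * q * (u.imI * v.imJ - u.imJ * v.imI)^2
      + p * p * q * (u.imI * v.imK - u.imK * v.imI)^2 + q * p * q * (u.imJ * v.imK - u.imK * v.imJ)^2 := by
    simp only [ip, gd]; ring
  rw [this]; positivity

lemma prim_le {O : Subring (Bq p q)} (hp : p.Prime) (hq : q.Prime) {u v : Bq p q}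
    (hu : u ∈ GrossLat O) (hu0 : u ≠ 0)
    (hv : Primitive (GrossLat O) v) {r : ℚ} (h : v = r • u) : Nrq v ≤ Nrq u := by
  obtain ⟨hvG, hv0, hprim⟩ := hv
  have hd : (r.den : ℚ) ≠ 0 := by exact_mod_cast r.den_nz
  have hnv : (r.den : ℤ) • v = r.num • u := by
    rw [h, ← Int.cast_smul_eq_zsmul ℚ, ← Int.cast_smul_eq_zsmul ℚ, smul_smul]
    congr 1
    rw [mul_comm]; exact_mod_cast Rat.mul_den_eq_num r
  have hc : IsCoprime r.num (r.den:ℤ) := by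
    rw [Int.isCoprime_iff_gcd_eq_one]
    simpa [Int.gcd] using r.reduced
  obtain ⟨a, b, hab⟩ := hc
  have hs : v = r.num • (a • v + b • u) := by
    have e1 : r.num • (a • v + b • u) = a • (r.num • v) + b • (r.num • u) := by module
    rw [e1, ← hnv, smul_smul, smul_smul, ← add_smul, hab, one_smul]
  have hm := hprim r.num _ (gl_add (gl_zsmul a hvG) (gl_zsmul b hu)) hs
  have hm2 : (r.num:ℚ)^2 = 1 := by
    rcases hm with h | h <;> rw [h] <;> norm_num
  have hr : r^2 ≤ 1 := by
    have h1 : (1:ℚ) ≤ r.den := by exact_mod_cast r.den_pos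
    rw [← Rat.mul_den_eq_num r, mul_pow] at hm2
    have h2 : (1:ℚ) ≤ (r.den:ℚ)^2 := by nlinarith
    nlinarith [sq_nonneg r]
  have hN := Nrq_pos hp hq hu0
  have hur := gl_re hu
  rw [Nrq_ip (gl_re hvG), h, ip_smul_left, ip_smul_right]
  rw [Nrq_ip hur] at *
  nlinarith

lemma val01 (hp : p.Prime) {g : ℚ} {n : ℤ} (h : g = 4 * p * n) (h0 : 0 ≤ g) (h1 : g < 16/3 * p) :
    g = 0 ∨ g = 4 * p := by
  have hp' : (0:ℚ) < p := by exact_mod_cast hp.pos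
  have a : (n:ℚ) < 2 := by
    by_contra hc; push Not at hc; nlinarith
  have b : (-1:ℚ) < n := by
    by_contra hc; push Not at hc; nlinarith
  have a' : n < 2 := by exact_mod_cast a
  have b' : -1 < n := by exact_mod_cast b
  have : n = 0 ∨ n = 1 := by omega
  rcases this with rfl | rfl
  · left; simpa using h
  · right; simpa using h

lemma core (hp : p.Prime) (hodd : Odd p) (hq : q.Prime) (hq8 : q % 8 = 3)
    (hqr : ∃ r : ℤ, (q : ℤ) ∣ r ^ 2 + p) {O : Subring (Bq p q)} (hO : IsOrder O) {u v w : Bq p q}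
    (hu : u ∈ GrossLat O) (hu0 : u ≠ 0) (hv : Primitive (GrossLat O) v)
    (hw : Primitive (GrossLat O) w) {A C : ℚ} (hA : Nrq v = A) (hC : Nrq w = C)
    (huA : Nrq u < A) (hAC : A ≤ C) (hlt : A * C < 16/3 * p) (h8 : 8 ≤ A)
    (x : ℤ) (hx : A * C - x^2 = 4 * p) (hx1 : 2 * (x:ℚ) ≤ A) (hx2 : - 2 * (x:ℚ) ≤ A) : False := by
  have hp' : (0:ℚ) < p := by exact_mod_cast hp.pos
  have hur := gl_re hu
  have hvr := gl_re hv.1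
  have hwr := gl_re hw.1
  have hupos := Nrq_pos hp hq hu0
  have hp12 : (12:ℚ) < p := by nlinarith
  have g1 : gd u v ≠ 0 := by
    intro h
    obtain ⟨r, hr⟩ := gd_eq_zero hp hq hur hvr hu0 h
    have := prim_le hp hq hu hu0 hv hr
    linarith
  have g2 : gd u w ≠ 0 := by
    intro h
    obtain ⟨r, hr⟩ := gd_eq_zero hp hq hur hwr hu0 h
    have := prim_le hp hq hu hu0 hw hr
    linarith
  obtain ⟨n1, hn1⟩ := gl_gd hp hodd hq hq8 hqr hO hu hv.1
  obtain ⟨n2, hn2⟩ := gl_gd hp hodd hq hq8 hqr hO hu hw.1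
  obtain ⟨n3, hn3⟩ := gl_gd hp hodd hq hq8 hqr hO hv.1 hw.1
  obtain ⟨Ai, hAi⟩ := gl_ip_int hO hv.1 hv.1
  rw [Nrq_ip hvr] at hA
  rw [Nrq_ip hwr] at hC
  rw [Nrq_ip hur] at huA hupos
  have G1 : gd u v = 4 * p := by
    refine (val01 hp hn1 (gd_nonneg _ _) ?_).resolve_left g1
    rw [gd, hA]; nlinarith [sq_nonneg (ip u v)]
  have G2 : gd u w = 4 * p := by
    refine (val01 hp hn2 (gd_nonneg _ _) ?_).resolve_left g2
    rw [gd, hC]; nlinarith [sq_nonneg (ip u w)]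
  have G3 : gd v w = 0 ∨ gd v w = 4 * p := by
    refine val01 hp hn3 (gd_nonneg _ _) ?_
    rw [gd, hA, hC]; nlinarith [sq_nonneg (ip v w)]
  obtain ⟨n, hn⟩ := gl_det hp hodd hq hq8 hqr hO hu hv.1 hw.1
  have hn0 : n = 0 := by
    by_contra hne
    have h1 := det_sq_le hp hq u v w
    rw [hn, G1, hC] at h1
    have h2 : (1:ℚ) ≤ n^2 := by
      have : 1 ≤ n^2 := by have := sq_nonneg n; have := pow_ne_zero 2 hne; omega
      exact_mod_cast this
    have h3 : (p:ℚ) * p ≤ p * C := by nlinarith [mul_pos hp' hp']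
    have h4 : (p:ℚ) ≤ C := le_of_mul_le_mul_left h3 hp'
    nlinarith
  obtain ⟨a, b, hab⟩ := det_zero hp hq hur hvr hwr g1 (by rw [hn, hn0]; simp)
  have e2 : gd u w = b^2 * gd u v := by
    rw [hab]; simp only [gd, ip_add_left, ip_add_right, ip_smul_left, ip_smul_right, ip_comm v u]; ring
  have e3 : gd v w = a^2 * gd u v := by
    rw [hab]; simp only [gd, ip_add_left, ip_add_right, ip_smul_left, ip_smul_right, ip_comm v u]; ring
  have hb : b^2 = 1 := by
    rw [G2, G1] at e2
    have : (4 * (p:ℚ)) ≠ 0 := by positivity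
    apply mul_right_cancel₀ this; linarith
  rcases G3 with G3 | G3
  · have ha : a = 0 := by
      rw [G3] at e3
      rcases mul_eq_zero.1 e3.symm with h | h
      · simpa using h
      · exact absurd h g1
    have hCA : C = A := by
      rw [← hC, hab, ha, zero_smul, zero_add, ip_smul_left, ip_smul_right, hA]
      linear_combination A * hb
    rw [hCA] at hx hlt
    rw [hA] at hAi
    have hz : (Ai - x) * (Ai + x) = p * 4 := by
      have : ((Ai:ℚ) - x) * (Ai + x) = p * 4 := by rw [← hAi]; linarith
      exact_mod_cast this
    have hle : (p:ℚ) ≤ 3/2 * A := by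
      rcases (Nat.prime_iff_prime_int.1 hp).dvd_or_dvd ⟨4, hz⟩ with h | h
      · have h0 : (0:ℤ) < Ai - x := by
          have : (0:ℚ) < Ai - x := by rw [← hAi]; linarith
          exact_mod_cast this
        have := Int.le_of_dvd h0 h
        have : (p:ℚ) ≤ Ai - x := by exact_mod_cast this
        rw [← hAi] at this; linarith
      · have h0 : (0:ℤ) < Ai + x := by
          have : (0:ℚ) < Ai + x := by rw [← hAi]; linarith
          exact_mod_cast this
        have := Int.le_of_dvd h0 h
        have : (p:ℚ) ≤ Ai + x := by exact_mod_cast this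
        rw [← hAi] at this; linarith
    nlinarith
  · have ha : a^2 = 1 := by
      rw [G3, G1] at e3
      have : (4 * (p:ℚ)) ≠ 0 := by positivity
      apply mul_right_cancel₀ this; linarith
    have hd : ip v w ^ 2 = x^2 := by rw [gd, hA, hC] at G3; linarith
    have hU : ip u u = C + A - 2 * b * ip v w := by
      rw [← hC, ← hA, hab]
      simp only [ip_add_left, ip_add_right, ip_smul_left, ip_smul_right, ip_comm v u]
      linear_combination (-ip u u) * ha + ip v v * hb
    have hbd : 2 * (b * ip v w) ≤ A := by
      have h1 : (b * ip v w)^2 = (x:ℚ)^2 := by rw [mul_pow, hb, hd, one_mul]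
      rcases sq_eq_sq_iff_eq_or_eq_neg.1 h1 with h | h <;> rw [h] <;> linarith
    linarith

/-- first minimum attained -/
lemma min1 {O : Subring (Bq p q)} {D : ℝ} (h : SuccMin (GrossLat O) 1 D) :
    (∃ t ∈ GrossLat O, t ≠ 0 ∧ (Nrq t : ℝ) = D) ∧ ∀ t ∈ GrossLat O, t ≠ 0 → D ≤ Nrq t := by
  obtain ⟨⟨v, hv, hl, hn⟩, hb⟩ := h
  have h2 : ∀ t ∈ GrossLat O, t ≠ 0 → D ≤ Nrq t := fun t ht h0 =>
    hb ⟨fun _ => t, fun _ => ht, LinearIndependent.of_subsingleton (0 : Fin 1) h0, fun _ => le_rfl⟩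
  exact ⟨⟨v 0, hv 0, hl.ne_zero 0, le_antisymm (hn 0) (h2 _ (hv 0) (hl.ne_zero 0))⟩, h2⟩

lemma min2 (hp : p.Prime) (hq : q.Prime) {O : Subring (Bq p q)} {D : ℝ} (h : SuccMin (GrossLat O) 2 D)
    {t : Bq p q} (ht : t ∈ GrossLat O) (ht0 : t ≠ 0)
    (hmin : ∀ s ∈ GrossLat O, s ≠ 0 → Nrq t ≤ Nrq s) :
    ∃ s ∈ GrossLat O, gd t s ≠ 0 ∧ (Nrq s : ℝ) = D ∧
      ∀ s' ∈ GrossLat O, gd t s' ≠ 0 → Nrq s ≤ Nrq s' := by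
  obtain ⟨⟨v, hv, hl, hn⟩, hb⟩ := h
  have htr := gl_re ht
  have h2 : ∀ s' ∈ GrossLat O, gd t s' ≠ 0 → D ≤ Nrq s' := by
    intro s' hs' hg
    have hli := li_of_gd hg
    refine hb ⟨![t, s'], ?_, hli, ?_⟩
    · intro n; fin_cases n
      exacts [ht, hs']
    · intro n; fin_cases n
      · exact Rat.cast_le.2 (hmin s' hs' (hli.ne_zero 1))
      · exact le_rfl
  have key : ∃ i, gd t (v i) ≠ 0 := by
    by_contra hc
    push Not at hc
    obtain ⟨r0, h0⟩ := gd_eq_zero hp hq htr (gl_re (hv 0)) ht0 (hc 0)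
    obtain ⟨r1, h1⟩ := gd_eq_zero hp hq htr (gl_re (hv 1)) ht0 (hc 1)
    have hl' : LinearIndependent ℚ ![v 0, v 1] := by
      convert hl using 1
      ext n <;> fin_cases n <;> rfl
    apply gd_of_li hp hq (gl_re (hv 0)) (gl_re (hv 1)) hl'
    rw [h0, h1]
    simp only [gd, ip_smul_left, ip_smul_right]; ring
  obtain ⟨i, hi⟩ := key
  have hD : (Nrq (v i) : ℝ) = D := le_antisymm (hn i) (h2 _ (hv i) hi)
  refine ⟨v i, hv i, hi, hD, fun s' hs' hg => ?_⟩
  have := h2 s' hs' hg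
  rw [← hD] at this
  exact_mod_cast this

end GrossPaper

/-- Lemma firstmin: the first successive minima agree. -/
theorem first_min (p q : ℕ) (hp : Nat.Prime p) (hodd : Odd p) (hq : Nat.Prime q)
    (hq8 : q % 8 = 3) (hqr : ∃ r : ℤ, (q : ℤ) ∣ r ^ 2 + p)
    (O O' : Subring (Bq p q)) (hO : IsMaximalOrder O) (hO' : IsMaximalOrder O')
    (D₁ D₂ D₃ D₁' D₂' D₃' : ℝ)
    (hm1 : SuccMin (GrossLat O) 1 D₁) (hm2 : SuccMin (GrossLat O) 2 D₂)
    (hm3 : SuccMin (GrossLat O) 3 D₃)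
    (hm1' : SuccMin (GrossLat O') 1 D₁') (hm2' : SuccMin (GrossLat O') 2 D₂')
    (hm3' : SuccMin (GrossLat O') 3 D₃')
    (hD2le : D₂' ≤ D₂)
    (h1 : OptRep (GrossLat O') D₁) (h2 : OptRep (GrossLat O') D₂)
    (hc1 : D₁ * D₂ < 16 / 3 * p) (hc2 : (8 : ℝ) ≤ D₁) :
    D₁ = D₁' := by
  obtain ⟨⟨t, ht, ht0, htD⟩, hmin⟩ := min1 hm1
  have hmin' : ∀ s ∈ GrossLat O, s ≠ 0 → Nrq t ≤ Nrq s := by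
    intro s hs h0
    have := hmin s hs h0
    rw [← htD] at this
    exact_mod_cast this
  obtain ⟨s, hs, hg, hsD, hsm⟩ := min2 hp hq hm2 ht ht0 hmin'
  obtain ⟨⟨u, hu, hu0, huD⟩, humin⟩ := min1 hm1'
  obtain ⟨v, hv, hvD⟩ := h1
  obtain ⟨w, hw, hwD⟩ := h2
  by_contra hne
  have hlt : D₁' < D₁ := lt_of_le_of_ne (by rw [← hvD]; exact humin v hv.1 hv.2.1) (Ne.symm hne)
  subst htD hsD huD
  have hA : Nrq v = Nrq t := by exact_mod_cast hvD
  have hC : Nrq w = Nrq s := by exact_mod_cast hwD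
  have hlt' : Nrq u < Nrq t := by exact_mod_cast hlt
  have hc1' : Nrq t * Nrq s < 16/3 * p := by
    have : ((Nrq t * Nrq s : ℚ) : ℝ) < ((16/3 * p : ℚ) : ℝ) := by push_cast; exact hc1
    exact_mod_cast this
  have hc2' : 8 ≤ Nrq t := by exact_mod_cast hc2
  have hts : Nrq t ≤ Nrq s := hmin' s hs ((li_of_gd hg).ne_zero 1)
  obtain ⟨x, hx⟩ := gl_ip_int hO.1 ht hs
  have htr := gl_re ht
  have hsr := gl_re hs
  obtain ⟨n, hn⟩ := gl_gd hp hodd hq hq8 hqr hO.1 ht hs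
  have hgd : gd t s = 4 * p := by
    refine (val01 hp hn (gd_nonneg _ _) ?_).resolve_left hg
    rw [gd, ← Nrq_ip htr, ← Nrq_ip hsr]
    nlinarith [sq_nonneg (ip t s)]
  have hpm : ∀ e : ℤ, e^2 = 1 → 0 ≤ Nrq t + 2 * e * ip t s := by
    intro e he
    have he' : (e:ℚ)^2 = 1 := by exact_mod_cast he
    have hm := gl_add hs (gl_zsmul e ht)
    have h3 := hsm _ hm (by
      rw [← Int.cast_smul_eq_zsmul ℚ]
      convert hg using 1
      simp only [gd, ip_add_left, ip_add_right, ip_smul_left, ip_smul_right, ip_comm s t]; ring)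
    rw [Nrq_ip (gl_re hm), Nrq_ip hsr, ← Int.cast_smul_eq_zsmul ℚ] at h3
    simp only [ip_add_left, ip_add_right, ip_smul_left, ip_smul_right, ip_comm s t] at h3
    rw [Nrq_ip htr]
    have : (e:ℚ) * (e * ip t t) = ip t t := by linear_combination ip t t * he'
    linarith
  have hp1 := hpm 1 (by norm_num)
  have hp2 := hpm (-1) (by norm_num)
  rw [hx] at hp1 hp2
  push_cast at hp1 hp2
  refine core hp hodd hq hq8 hqr hO'.1 hu hu0 hv hw hA hC hlt' hts hc1' hc2' x ?_ ?_ ?_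
  · rw [← hgd, gd, Nrq_ip htr, Nrq_ip hsr, hx]
  · linarith
  · linarith
end
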